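/- Let $m\ge 1$ be an integer, $\mu>0$, $T>0$, $\nu,\tau\in\mathbb C$ with $\mathrm{Re}\,\nu>0$, and let $\mathbb T^2=(\mathbb R/\mathbb Z)^2$ with normalised Lebesgue measure. Fix a smooth radial dyadic partition of unity $(\chi_j)_{j\ge-1}$ on $\mathbb R^2$ ($\chi_{-1},\chi_0$ take values in $[0,1]$, $\mathrm{supp}\,\chi_{-1}\subseteq B(0,\frac43)$, $\mathrm{supp}\,\chi_0\subseteq B(0,\frac83)\setminus B(0,\frac34)$, $\chi_j=\chi_0(2^{-j}\cdot)$ for $j\ge 0$, $\sum_{j\ge-1}\chi_j=1$), put $\delta_ju=\sum_{k\in\mathbb Z^2}\chi_j(k)\hat u(k)e^{2\pi i k\cdot x}$, and for $a\in\mathbb R$ let $\mathcal C^a$ be the completion of $C^\infty(\mathbb T^2,\mathbb C)$ for $\|u\|_{\mathcal C^a}=\sup_{j\ge-1}2^{aj}\|\delta_ju\|_{L^\infty}$. Products of an element of $\mathcal C^a$ and one of $\mathcal C^{-b}$, and the pairing $\langle f,g\rangle$ extending $\int_{\mathbb T^2}fg\,dx$ (no complex conjugation), are the continuous extensions from smooth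 functions, for $0<b<a$ (equivalently, $\widehat{fu}(k)=\sum_l\hat f(k-l)\hat u(l)$ and $\langle f,u\rangle=\sum_k\hat f(-k)\hat u(k)$). Let $L=\{(i,j)\in\mathbb N^2: i\le m+1,\ j\le m,\ i\ge j,\ i+j>1\}$ and let $\underline Z=\{Z_t,\,Z^{:i,j:}_t:(i,j)\in L\}$ be such that for all $\alpha,\alpha'\in(0,1)$: $Z\in C([0,T];\mathcal C^{-\alpha})$, $Z^{:i,j:}\in C((0,T];\mathcal C^{-\alpha})$ for $(i,j)\in L$, and $$\|\underline Z\|_{\alpha,\alpha',T}=\sup_{0\le t\le T}\|Z_t\|_{\mathcal C^{-\alpha}}\ \vee\ \sup_{0<t\le T}\sup_{(i,j)\in L}t^{(i+j-1)\alpha'}\|Z^{:i,j:}_t\|_{\mathcal C^{-\alpha}}<\infty .$$ (Almost every realization of the Wick powers of the solution, started at $0$, of the stochastic heat equation with dispersion $\partial_tZ=[(i+\mu)\Delta-1]Z+\xi$, with $\xi$ complex space-time white noise, is of this kind.) Put $Z^{:0,0:}=1$, $Z^{:1,0:}=Z$, $Z^{:k,l:}=\overline{Z^{:l,k:}}$ for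 $k<l$, and $$\Psi(v,\underline Z_t)=-\nu\sum_{i=0}^{m+1}\sum_{j=0}^{m}\binom{m+1}{i}\binom mj v^i\bar v^jZ_t^{:m+1-i,m-j:}+(\tau+1)(v+Z_t),\qquad \Psi'(v,\underline Z_t)=\Psi(v,\underline Z_t)+\nu v^{m+1}\bar v^m .$$ Let $\alpha_0>0$, $\beta>0$, $\frac{\alpha_0+\beta}2<\gamma<\frac1{2m+1}$, $u_0\in\mathcal C^{-\alpha_0}$, and let $v$ be a mild solution on $(0,T]$ of $\partial_tv=[(i+\mu)\Delta-1]v+\Psi(v,\underline Z)$, $v_0=u_0$; that is, $v\in C((0,T];\mathcal C^\beta)$, $\sup_{0<t\le T}t^\gamma\|v_t\|_{\mathcal C^\beta}<\infty$, and, with $P_t=e^{t((i+\mu)\Delta-1)}$, $v_t=P_tu_0+\int_0^tP_{t-s}\Psi(v_s,\underline Z_s)\,ds$ for all $t\in(0,T]$. Let $1\le p\le 1+\mu(\mu+\sqrt{1+\mu^2})$ and let $0\le\delta<1$ satisfy $\frac{p-1}{\mu(\mu+\sqrt{1+\mu^2})}\le 1-\delta$. Then for every $t\in(0,T]$ the function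 $v_t$ is continuously differentiable on $\mathbb T^2$, the series defining the pairing $\langle|v_t|^{2p-2},\mathrm{Re}(\overline{v_t}\Psi'(v_t,\underline Z_t))\rangle$ converges absolutely, $r\mapsto\|v_r\|_{L^{2p}}^{2p}$ is differentiable at $t$ on $(0,T]$ (from the left at $t=T$), and $$\frac1{2p}\partial_t\|v_t\|_{L^{2p}}^{2p}+\delta\mu\big\||\nabla v_t|^2|v_t|^{2p-2}\big\|_{L^1}+\mathrm{Re}(\nu)\|v_t\|_{L^{2p+2m}}^{2p+2m}+\|v_t\|_{L^{2p}}^{2p}\le\big\langle|v_t|^{2p-2},\mathrm{Re}(\overline{v_t}\,\Psi'(v_t,\underline Z_t))\big\rangle .$$ Moreover, for all $0<s_0\le t\le T$ the following integrands are integrable on $[s_0,t]$ and $$\frac1{2p}\Big(\|v_t\|_{L^{2p}}^{2p}-\|v_{s_0}\|_{L^{2p}}^{2p}\Big)+\delta\mu\int_{s_0}^t\big\||\nabla v_s|^2|v_s|^{2p-2}\big\|_{L^1}ds+\mathrm{Re}(\nu)\int_{s_0}^t\|v_s\|_{L^{2p+2m}}^{2p+2m}ds+\int_{s_0}^t\|v_s\|_{L^{2p}}^{2p}ds\le\int_{s_0}^t\big\langle|v_s|^{2p-2},\mathrm{Re}(\overline{v_s}\,\Psi'(v_s,\underline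 Z_s))\big\rangle ds .$$ -/

import Mathlib

open MeasureTheory Filter Topology
open scoped ENNReal ContDiff

noncomputable section

namespace SCGL

/-! ### The torus and functions on it -/

/-- The two-dimensional torus `𝕋² = (ℝ/ℤ)²`. -/
abbrev Torus : Type := UnitAddTorus (Fin 2)

/-- The frequency lattice `ℤ²`. -/
abbrev Freq : Type := Fin 2 → ℤ

/-- Normalised Lebesgue measure on `𝕋²` (the one with respect to which Mathlib's Fourier
coefficients `UnitAddTorus.mFourierCoeff` are taken). -/
def torusMeasure : Measure Torus :=
  Measure.pi fun _ => (AddCircle.haarAddCircle : Measure UnitAddCircle)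

/-- The periodic function on `ℝ²` given by a function on `𝕋²`. -/
def lift (f : Torus → ℂ) : (Fin 2 → ℝ) → ℂ :=
  fun x => f fun i => (x i : UnitAddCircle)

/-- The partial derivative `∂_i f` on the torus. -/
def partialDeriv (i : Fin 2) (f : Torus → ℂ) (x : Torus) : ℂ :=
  deriv (fun h : ℝ => f (x + Pi.single i (h : UnitAddCircle))) 0

/-- `‖f‖_{L^q}^q = ∫_{𝕋²} |f|^q dx`. -/
def lpPow (q : ℝ) (f : Torus → ℂ) : ℝ :=
  ∫ x, ‖f x‖ ^ q ∂torusMeasure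

/-- `‖ |∇f|² |f|^{2p-2} ‖_{L¹}`. -/
def gradTerm (p : ℝ) (f : Torus → ℂ) : ℝ :=
  ∫ x, (∑ i, ‖partialDeriv i f x‖ ^ 2) * ‖f x‖ ^ (2 * p - 2) ∂torusMeasure

/-! ### Distributions on the torus -/

/-- A distribution on `𝕋²`, given by its Fourier coefficients `û(k)`, `k ∈ ℤ²`. (Distributions
are the families of polynomial growth; every family that is used below lies in some space
`𝒞^a`, and the elements of `𝒞^a` have polynomial growth.) -/
abbrev Dist : Type := Freq → ℂ

/-- The distribution given by a function: `f̂(k) = ∫_{𝕋²} f(x) e^{-2πi k·x} dx`. -/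
def ofFun (f : Torus → ℂ) : Dist := UnitAddTorus.mFourierCoeff f

/-- The complex conjugate of a distribution. -/
def conjDist (u : Dist) : Dist := fun k => (starRingEnd ℂ) (u (-k))

/-- The real part of a distribution. -/
def reDist (u : Dist) : Dist := fun k => (u k + conjDist u k) / 2

/-- The product of a function and a distribution,
`(f u)^(k) = ∑_l f̂(k - l) û(l)`. For `f ∈ 𝒞^a`, `u ∈ 𝒞^{-b}` with `0 < b < a` the series
converges absolutely, and it is the continuous extension of the product of smooth functions. -/
def mulDist (f : Torus → ℂ) (u : Dist) : Dist :=
  fun k => ∑' l : Freq, ofFun f (k - l) * u l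

/-- The `k`-th term `f̂(-k) û(k)` of the duality pairing of `f` and `u`. -/
def pairingTerm (f : Torus → ℂ) (u : Dist) (k : Freq) : ℂ :=
  ofFun f (-k) * u k

/-- The duality pairing `⟨f, u⟩`, extending `∫_{𝕋²} f u dx` (no complex conjugation). -/
def pairing (f : Torus → ℂ) (u : Dist) : ℂ := ∑' k : Freq, pairingTerm f u k

/-! ### Besov spaces -/

/-- A point of `ℤ²` as a point of the Euclidean plane. -/
def freqVec (k : Freq) : EuclideanSpace ℝ (Fin 2) := WithLp.toLp 2 fun i => (k i : ℝ)

/-- A dyadic partition of unity: `χ_{-1} = low`, `χ_j = ann (2^{-j} ·)` for `j ≥ 0`. -/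
structure DyadicPartition where
  low : EuclideanSpace ℝ (Fin 2) → ℝ
  ann : EuclideanSpace ℝ (Fin 2) → ℝ
  low_mem : ∀ x, low x ∈ Set.Icc (0 : ℝ) 1
  ann_mem : ∀ x, ann x ∈ Set.Icc (0 : ℝ) 1
  low_radial : ∀ x y, ‖x‖ = ‖y‖ → low x = low y
  ann_radial : ∀ x y, ‖x‖ = ‖y‖ → ann x = ann y
  low_smooth : ContDiff ℝ ∞ low
  ann_smooth : ContDiff ℝ ∞ ann
  low_supp : tsupport low ⊆ Metric.ball 0 (4 / 3)
  ann_supp : tsupport ann ⊆ Metric.ball 0 (8 / 3) \ Metric.ball 0 (3 / 4)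
  hasSum_one : ∀ x, HasSum (fun j : ℕ => ann (((2 : ℝ) ^ j)⁻¹ • x)) (1 - low x)

/-- The functions of the partition, numbered from `0`: `cutoff n = χ_{n-1}`. -/
def DyadicPartition.cutoff (χ : DyadicPartition) : ℕ → EuclideanSpace ℝ (Fin 2) → ℝ
  | 0 => χ.low
  | j + 1 => fun x => χ.ann (((2 : ℝ) ^ j)⁻¹ • x)

/-- The Littlewood–Paley block `δ_{n-1} u = ∑_k χ_{n-1}(k) û(k) e^{2πi k·x}` (a finite sum). -/
def block (χ : DyadicPartition) (n : ℕ) (u : Dist) (x : Torus) : ℂ :=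
  ∑' k : Freq, (χ.cutoff n (freqVec k) : ℂ) * u k * UnitAddTorus.mFourier k x

/-- `‖u‖_{𝒞^a} = sup_{j ≥ -1} 2^{aj} ‖δ_j u‖_{L^∞}`, with `j = n - 1`; as `δ_j u` is
continuous, its `L^∞` norm is the supremum of its modulus. -/
def besovNorm (χ : DyadicPartition) (a : ℝ) (u : Dist) : ℝ≥0∞ :=
  ⨆ n : ℕ, ENNReal.ofReal ((2 : ℝ) ^ (a * ((n : ℝ) - 1))) * ⨆ x : Torus, ‖block χ n u x‖ₑ

/-- `u ∈ 𝒞^a`, the completion of `C^∞(𝕋², ℂ)` for the norm `‖·‖_{𝒞^a}`: `u` is approximated by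
smooth functions in this norm. -/
def MemBesov (χ : DyadicPartition) (a : ℝ) (u : Dist) : Prop :=
  ∀ ε : ℝ≥0∞, 0 < ε → ∃ f : Torus → ℂ, ContDiff ℝ ∞ (lift f) ∧ besovNorm χ a (u - ofFun f) < ε

/-- `u ∈ C(I; 𝒞^a)`. -/
def ContBesovOn (χ : DyadicPartition) (a : ℝ) (u : ℝ → Dist) (I : Set ℝ) : Prop :=
  (∀ t ∈ I, MemBesov χ a (u t)) ∧
    ∀ t ∈ I, Tendsto (fun s => besovNorm χ a (u s - u t)) (𝓝[I] t) (𝓝 0)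

/-! ### The driving data -/

/-- The index set `L`. -/
def indexSet (m : ℕ) : Set (ℕ × ℕ) :=
  {q | q.1 ≤ m + 1 ∧ q.2 ≤ m ∧ q.2 ≤ q.1 ∧ 1 < q.1 + q.2}

/-- A vector `{Z_t, Z_t^{(i,j)}}` of distribution-valued paths (only `(i,j) ∈ L` matter). -/
structure DrivingData where
  Z : ℝ → Dist
  W : ℕ → ℕ → ℝ → Dist

/-- The norm `‖Z̲‖_{α,α',T}`. -/
def DrivingData.norm (D : DrivingData) (χ : DyadicPartition) (m : ℕ) (α α' T : ℝ) : ℝ≥0∞ :=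
  (⨆ t ∈ Set.Icc (0 : ℝ) T, besovNorm χ (-α) (D.Z t)) ⊔
    ⨆ t ∈ Set.Ioc (0 : ℝ) T, ⨆ q ∈ indexSet m,
      ENNReal.ofReal (t ^ (((q.1 : ℝ) + q.2 - 1) * α')) * besovNorm χ (-α) (D.W q.1 q.2 t)

/-- `Z̲ ∈ C([0,T]; 𝒞^{-α}) × C((0,T]; 𝒞^{-α})^{M-1}` with `‖Z̲‖_{α,α',T} < ∞`, for all
`α, α' ∈ (0,1)`. -/
def DrivingData.Admissible (D : DrivingData) (χ : DyadicPartition) (m : ℕ) (T : ℝ) : Prop :=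
  ∀ α ∈ Set.Ioo (0 : ℝ) 1,
    ContBesovOn χ (-α) D.Z (Set.Icc 0 T) ∧
    (∀ q ∈ indexSet m, ContBesovOn χ (-α) (D.W q.1 q.2) (Set.Ioc 0 T)) ∧
    ∀ α' ∈ Set.Ioo (0 : ℝ) 1, D.norm χ m α α' T < ⊤

/-- All the `Z^{:k,l:}_t`: `Z^{:0,0:} = 1`, `Z^{:1,0:} = Z`, the given ones for `(k,l) ∈ L`, and
`Z^{:k,l:} = conj(Z^{:l,k:})` for `k < l`. -/
def DrivingData.wick (D : DrivingData) (k l : ℕ) (t : ℝ) : Dist :=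
  if k + l = 0 then ofFun fun _ => 1
  else if l ≤ k then (if k + l = 1 then D.Z t else D.W k l t)
  else conjDist (if k + l = 1 then D.Z t else D.W l k t)

/-! ### The remainder equation -/

/-- The function `f^i conj(f)^j`. -/
def monomial (i j : ℕ) (f : Torus → ℂ) : Torus → ℂ :=
  fun x => f x ^ i * (starRingEnd ℂ) (f x) ^ j

/-- `Ψ(f, Z̲_t)`. -/
def Psi (m : ℕ) (ν τ : ℂ) (D : DrivingData) (f : Torus → ℂ) (t : ℝ) : Dist :=
  (-ν) • (∑ i ∈ Finset.range (m + 2), ∑ j ∈ Finset.range (m + 1),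
      (((m + 1).choose i : ℂ) * (m.choose j : ℂ)) •
        mulDist (monomial i j f) (D.wick (m + 1 - i) (m - j) t))
    + (τ + 1) • (ofFun f + D.Z t)

/-- `Ψ′(f, Z̲_t) = Ψ(f, Z̲_t) + ν f^{m+1} conj(f)^m`. -/
def Psi' (m : ℕ) (ν τ : ℂ) (D : DrivingData) (f : Torus → ℂ) (t : ℝ) : Dist :=
  Psi m ν τ D f t + ν • ofFun (monomial (m + 1) m f)

/-- `P_t = e^{t((i+μ)Δ-1)}`, the Fourier multiplier `e^{-t(1+4π²(i+μ)|k|²)}`. -/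
def semigroup (μ t : ℝ) (u : Dist) : Dist :=
  fun k => Complex.exp (-(t : ℂ) *
    (1 + 4 * (Real.pi : ℂ) ^ 2 * (Complex.I + (μ : ℂ)) * ((‖freqVec k‖ ^ 2 : ℝ) : ℂ))) * u k

/-- `v` is a mild solution on `(0,T]` of `∂_t v = [(i+μ)Δ-1]v + Ψ(v,Z̲)`, `v_0 = u₀`: it lies in
`C((0,T]; 𝒞^β)` (for `β > 0` the elements of `𝒞^β` are continuous functions),
`sup_{0<t≤T} t^γ ‖v_t‖_{𝒞^β} < ∞`, and
`v_t = P_t u₀ + ∫_0^t P_{t-s} Ψ(v_s, Z̲_s) ds` as distributions, i.e. for all Fourier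
coefficients. -/
structure IsMildSolution (χ : DyadicPartition) (m : ℕ) (μ : ℝ) (ν τ : ℂ) (D : DrivingData)
    (β γ T : ℝ) (u₀ : Dist) (v : ℝ → Torus → ℂ) : Prop where
  continuous : ∀ t ∈ Set.Ioc (0 : ℝ) T, Continuous (v t)
  cont : ContBesovOn χ β (fun t => ofFun (v t)) (Set.Ioc 0 T)
  bound : (⨆ t ∈ Set.Ioc (0 : ℝ) T, ENNReal.ofReal (t ^ γ) * besovNorm χ β (ofFun (v t))) < ⊤
  duhamel : ∀ t ∈ Set.Ioc (0 : ℝ) T, ∀ k : Freq,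
    ofFun (v t) k =
      semigroup μ t u₀ k + ∫ s in (0 : ℝ)..t, semigroup μ (t - s) (Psi m ν τ D (v s) s) k

/-- The function `|f|^{2p-2}`. -/
def absPow (p : ℝ) (f : Torus → ℂ) : Torus → ℂ :=
  fun x => ((‖f x‖ ^ (2 * p - 2) : ℝ) : ℂ)

/-- The distribution `Re(conj(f) Ψ′(f, Z̲_t))`. -/
def rePsi' (m : ℕ) (ν τ : ℂ) (D : DrivingData) (f : Torus → ℂ) (t : ℝ) : Dist :=
  reDist (mulDist (fun x => (starRingEnd ℂ) (f x)) (Psi' m ν τ D f t))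

/-- `⟨|f|^{2p-2}, Re(conj(f) Ψ′(f, Z̲_t))⟩`, the pairing of a real function and a real
distribution. -/
def pairTerm (m : ℕ) (ν τ : ℂ) (D : DrivingData) (p : ℝ) (f : Torus → ℂ) (t : ℝ) : ℝ :=
  (pairing (absPow p f) (rePsi' m ν τ D f t)).re

end SCGL

end

open MeasureTheory Filter Topology
open scoped ENNReal ContDiff

noncomputable section

namespace SCGL

section

open UnitAddTorus in
/-- The character `e^{2πi k·x}`. -/
abbrev ek (k : Freq) (x : Torus) : ℂ := mFourier k x

/-! ### Fourier series on the torus -/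

instance : IsProbabilityMeasure torusMeasure := by unfold torusMeasure; infer_instance

instance : Measure.IsAddHaarMeasure torusMeasure := by unfold torusMeasure; infer_instance

lemma continuous_ek (k : Freq) : Continuous (ek k) := (UnitAddTorus.mFourier k).continuous

lemma ek_add (k l : Freq) (x : Torus) : ek (k + l) x = ek k x * ek l x :=
  UnitAddTorus.mFourier_add

lemma ek_neg (k : Freq) (x : Torus) : ek (-k) x = (starRingEnd ℂ) (ek k x) :=
  UnitAddTorus.mFourier_neg

lemma ek_zero (x : Torus) : ek 0 x = 1 := by
  simp [ek, UnitAddTorus.mFourier_zero]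

lemma norm_ek (k : Freq) (x : Torus) : ‖ek k x‖ = 1 := by
  simp only [ek, UnitAddTorus.mFourier, ContinuousMap.coe_mk, fourier_apply, norm_prod,
    Circle.norm_coe, Finset.prod_const_one]


lemma ek_add_apply (k : Freq) (x y : Torus) : ek k (x + y) = ek k x * ek k y := by
  simp only [ek, UnitAddTorus.mFourier, ContinuousMap.coe_mk, Pi.add_apply, fourier_apply,
    ← Finset.prod_mul_distrib, smul_add, AddCircle.toCircle_add, Circle.coe_mul]

lemma integrable_of_continuous {E : Type*} [NormedAddCommGroup E] {f : Torus → E}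
    (hf : Continuous f) : Integrable f torusMeasure := by
  have := hf.continuousOn.integrableOn_compact (μ := torusMeasure) (isCompact_univ)
  simpa using this

lemma ofFun_apply (f : Torus → ℂ) (k : Freq) :
    ofFun f k = ∫ x, ek (-k) x * f x ∂torusMeasure := rfl

lemma ofFun_conj (f : Torus → ℂ) (k : Freq) :
    ofFun (fun x => (starRingEnd ℂ) (f x)) k = (starRingEnd ℂ) (ofFun f (-k)) := by
  rw [ofFun_apply, ofFun_apply, ← integral_conj]
  congr 1; ext x
  rw [map_mul, ek_neg (-k), ek_neg k]; simp

lemma toLp_coeff {f : Torus → ℂ} (hf : Continuous f) (k : Freq) :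
    UnitAddTorus.mFourierCoeff
      (ContinuousMap.toLp (E := ℂ) 2 torusMeasure ℂ ⟨f, hf⟩ : Lp ℂ 2 torusMeasure) k = ofFun f k :=
  UnitAddTorus.mFourierCoeff_toLp ⟨f, hf⟩ k

lemma parseval_conj {f g : Torus → ℂ} (hf : Continuous f) (hg : Continuous g) :
    HasSum (fun k => (starRingEnd ℂ) (ofFun f k) * ofFun g k)
      (∫ x, (starRingEnd ℂ) (f x) * g x ∂torusMeasure) := by
  have h := UnitAddTorus.hasSum_prod_mFourierCoeff
    (ContinuousMap.toLp (E := ℂ) 2 torusMeasure ℂ ⟨f, hf⟩ : Lp ℂ 2 torusMeasure)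
    (ContinuousMap.toLp (E := ℂ) 2 torusMeasure ℂ ⟨g, hg⟩ : Lp ℂ 2 torusMeasure)
  convert h using 1
  · ext k
    exact congrArg₂ (fun a b => (starRingEnd ℂ) a * b) (toLp_coeff hf k).symm (toLp_coeff hg k).symm
  refine integral_congr_ae ?_
  filter_upwards [ContinuousMap.coeFn_toLp (𝕜 := ℂ) (p := 2) torusMeasure ⟨f, hf⟩,
    ContinuousMap.coeFn_toLp (𝕜 := ℂ) (p := 2) torusMeasure ⟨g, hg⟩] with x h1 h2
  exact congrArg₂ (fun a b => (starRingEnd ℂ) a * b) h1.symm h2.symm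

lemma parseval {f g : Torus → ℂ} (hf : Continuous f) (hg : Continuous g) :
    HasSum (fun k => ofFun f (-k) * ofFun g k) (∫ x, f x * g x ∂torusMeasure) := by
  have h := parseval_conj (f := fun x => (starRingEnd ℂ) (f x))
    (Complex.continuous_conj.comp hf) hg
  simpa only [ofFun_conj, Complex.conj_conj] using h

lemma parseval_sq {f : Torus → ℂ} (hf : Continuous f) :
    HasSum (fun k => ‖ofFun f k‖ ^ 2) (∫ x, ‖f x‖ ^ 2 ∂torusMeasure) := by
  have h := parseval_conj hf hf
  simp only [Complex.conj_mul'] at h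
  have h2 := Complex.hasSum_re h
  have e : ∀ k, ((‖ofFun f k‖ : ℂ) ^ 2).re = ‖ofFun f k‖ ^ 2 := fun k => by
    rw [← Complex.ofReal_pow, Complex.ofReal_re]
  simp only [e] at h2
  convert h2 using 1
  have : ∀ x, ((‖f x‖ : ℂ) ^ 2) = ((‖f x‖ ^ 2 : ℝ) : ℂ) := fun x => by push_cast; rfl
  simp only [this]
  rw [integral_complex_ofReal, Complex.ofReal_re]

lemma ofFun_ek_mul (f : Torus → ℂ) (j k : Freq) :
    ofFun (fun x => ek j x * f x) k = ofFun f (k - j) := by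
  rw [ofFun_apply, ofFun_apply]
  congr 1; ext x
  rw [← mul_assoc, ← ek_add]; congr 2; abel_nf

lemma ofFun_mul {f g : Torus → ℂ} (hf : Continuous f) (hg : Continuous g) (k : Freq) :
    HasSum (fun l => ofFun f (k - l) * ofFun g l) (ofFun (fun x => f x * g x) k) := by
  have h := parseval (f := fun x => ek (-k) x * f x) ((continuous_ek _).mul hf) hg
  simp only [ofFun_ek_mul] at h
  convert h using 1
  · ext l; congr 2; abel
  · rw [ofFun_apply]; simp only [mul_assoc]

lemma ofFun_const_mul (c : ℂ) (f : Torus → ℂ) (k : Freq) :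
    ofFun (fun x => c * f x) k = c * ofFun f k := by
  simp only [ofFun_apply, ← integral_const_mul]
  congr 1; ext x; ring

lemma ofFun_sub {f g : Torus → ℂ} (hf : Continuous f) (hg : Continuous g) :
    ofFun (fun x => f x - g x) = ofFun f - ofFun g := by
  ext k
  simp only [Pi.sub_apply, ofFun_apply, mul_sub]
  exact integral_sub (integrable_of_continuous ((continuous_ek _).mul hf))
    (integrable_of_continuous ((continuous_ek _).mul hg))

lemma ofFun_sum {ι : Type*} (s : Finset ι) {f : ι → Torus → ℂ} (hf : ∀ i ∈ s, Continuous (f i))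
    (k : Freq) : ofFun (fun x => ∑ i ∈ s, f i x) k = ∑ i ∈ s, ofFun (f i) k := by
  simp only [ofFun_apply, Finset.mul_sum]
  exact integral_finsetSum _ fun i hi =>
    integrable_of_continuous ((continuous_ek _).mul (hf i hi))

lemma ofFun_ek (j k : Freq) : ofFun (ek j) k = if k = j then 1 else 0 := by
  have h := (orthonormal_iff_ite.mp (UnitAddTorus.orthonormal_mFourier (d := Fin 2))) k j
  rw [ContinuousMap.inner_toLp] at h
  rw [← h, ofFun_apply]
  refine integral_congr_ae (Eventually.of_forall fun x => ?_)
  simp only [ek_neg, mul_comm, ek]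

lemma ofFun_trig (S : Finset Freq) (c : Freq → ℂ) (k : Freq) :
    ofFun (fun x => ∑ j ∈ S, c j * ek j x) k = if k ∈ S then c k else 0 := by
  rw [ofFun_sum (f := fun j x => c j * ek j x) S
    fun i _ => continuous_const.mul (continuous_ek i)]
  simp only [ofFun_const_mul, ofFun_ek, mul_ite, mul_one, mul_zero]
  rw [Finset.sum_ite_eq]

lemma ofFun_one (k : Freq) : ofFun (fun _ => 1) k = if k = 0 then 1 else 0 := by
  rw [← ofFun_ek]; congr 1; ext x; rw [ek_zero]

lemma eq_of_ofFun_eq {f g : Torus → ℂ} (hf : Continuous f) (hg : Continuous g)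
    (h : ofFun f = ofFun g) : f = g := by
  have h1 := parseval_sq (hf.sub hg)
  have h0 : ∀ k, ‖ofFun (f - g) k‖ ^ 2 = 0 := fun k => by
    have := congrFun (ofFun_sub hf hg) k
    rw [h, sub_self] at this
    change ofFun (f - g) k = 0 at this
    simp [this]
  rw [funext h0] at h1
  have h2 : ∫ x, ‖f x - g x‖ ^ 2 ∂torusMeasure = 0 := h1.unique hasSum_zero
  have hc : Continuous fun x => ‖f x - g x‖ ^ 2 := by fun_prop
  rw [integral_eq_zero_iff_of_nonneg (fun x => by positivity) (integrable_of_continuous hc)] at h2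
  have h3 := hc.ae_eq_iff_eq torusMeasure continuous_zero |>.1 h2
  ext x
  have := congrFun h3 x
  simpa [sub_eq_zero] using this

lemma integral_mono_bound {f : Torus → ℝ} (hf : Continuous f) {C : ℝ} (h : ∀ x, f x ≤ C) :
    ∫ x, f x ∂torusMeasure ≤ C := by
  calc ∫ x, f x ∂torusMeasure ≤ ∫ _, C ∂torusMeasure :=
        integral_mono (integrable_of_continuous hf) (integrable_const _) h
    _ = C := by simp

lemma bessel_integral {f : Torus → ℂ} (hf : Continuous f) (S : Finset Freq) :
    ∑ k ∈ S, ‖ofFun f k‖ ^ 2 ≤ ∫ x, ‖f x‖ ^ 2 ∂torusMeasure :=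
  sum_le_hasSum S (fun _ _ => by positivity) (parseval_sq hf)

lemma bessel {f : Torus → ℂ} (hf : Continuous f) {C : ℝ} (h : ∀ x, ‖f x‖ ≤ C)
    (S : Finset Freq) : ∑ k ∈ S, ‖ofFun f k‖ ^ 2 ≤ C ^ 2 :=
  (bessel_integral hf S).trans (integral_mono_bound (by fun_prop) fun x => by gcongr; exact h x)

lemma integral_norm_sq_le {f : Torus → ℂ} (hf : Continuous f) :
    (∫ x, ‖f x‖ ∂torusMeasure) ^ 2 ≤ ∫ x, ‖f x‖ ^ 2 ∂torusMeasure := by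
  set a := ∫ x, ‖f x‖ ∂torusMeasure
  have h : 0 ≤ ∫ x, (‖f x‖ - a) ^ 2 ∂torusMeasure := integral_nonneg fun x => by positivity
  have i1 : Integrable (fun x => ‖f x‖ ^ 2) torusMeasure := integrable_of_continuous (by fun_prop)
  have i2 : Integrable (fun x => 2 * a * ‖f x‖) torusMeasure :=
    integrable_of_continuous (by fun_prop)
  have e : ∀ x, (‖f x‖ - a) ^ 2 = ‖f x‖ ^ 2 - 2 * a * ‖f x‖ + a ^ 2 := fun x => by ring
  simp only [e] at h
  rw [integral_add (f := fun x => ‖f x‖ ^ 2 - 2 * a * ‖f x‖) (i1.sub i2) (integrable_const _),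
    integral_sub i1 i2, integral_const_mul] at h
  simp only [integral_const, probReal_univ, one_smul] at h
  change 0 ≤ _ - 2 * a * a + a ^ 2 at h
  linarith

/-! ### The frequency lattice -/

/-- The weight `1 + |k|`. -/
def wt (k : Freq) : ℝ := 1 + ‖freqVec k‖

lemma one_le_wt (k : Freq) : 1 ≤ wt k := by unfold wt; linarith [norm_nonneg (freqVec k)]

lemma wt_pos (k : Freq) : 0 < wt k := zero_lt_one.trans_le (one_le_wt k)

lemma freqVec_add (k l : Freq) : freqVec (k + l) = freqVec k + freqVec l := by
  ext i; simp [freqVec]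

lemma freqVec_neg (k : Freq) : freqVec (-k) = -freqVec k := by
  ext i; simp [freqVec]

lemma norm_freqVec_neg (k : Freq) : ‖freqVec (-k)‖ = ‖freqVec k‖ := by
  rw [freqVec_neg, norm_neg]

lemma wt_neg (k : Freq) : wt (-k) = wt k := by rw [wt, wt, norm_freqVec_neg]

lemma norm_freqVec_add_le (k l : Freq) : ‖freqVec (k + l)‖ ≤ ‖freqVec k‖ + ‖freqVec l‖ := by
  rw [freqVec_add]; exact norm_add_le _ _

lemma wt_add_le (k l : Freq) : wt (k + l) ≤ wt k * wt l := by
  have := norm_freqVec_add_le k l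
  unfold wt
  nlinarith [norm_nonneg (freqVec k), norm_nonneg (freqVec l)]

lemma norm_freqVec_sq (k : Freq) : ‖freqVec k‖ ^ 2 = (k 0 : ℝ) ^ 2 + (k 1 : ℝ) ^ 2 := by
  rw [EuclideanSpace.norm_sq_eq, Fin.sum_univ_two]
  simp [freqVec]

lemma abs_coord_le (k : Freq) (i : Fin 2) : |(k i : ℝ)| ≤ ‖freqVec k‖ := by
  apply abs_le_of_sq_le_sq _ (norm_nonneg _)
  rw [norm_freqVec_sq]
  fin_cases i <;> simp <;> positivity

/-- The lattice points in a box. -/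
def box (N : ℕ) : Finset Freq := Finset.Icc (fun _ => -(N : ℤ)) (fun _ => (N : ℤ))

lemma mem_box {N : ℕ} {k : Freq} (h : ‖freqVec k‖ ≤ N) : k ∈ box N := by
  rw [box, Finset.mem_Icc]
  have : ∀ i, |k i| ≤ (N : ℤ) := fun i => by
    have := (abs_coord_le k i).trans h
    exact_mod_cast this
  exact ⟨fun i => (abs_le.1 (this i)).1, fun i => (abs_le.1 (this i)).2⟩

lemma card_box (N : ℕ) : (box N).card = (2 * N + 1) ^ 2 := by
  rw [box, Pi.card_Icc]
  simp only [Int.card_Icc, Fin.prod_univ_two, sq]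
  congr 1 <;> omega

/-- The lattice points of norm at most `R`. -/
def lball (R : ℝ) : Finset Freq := (box ⌈R⌉₊).filter fun k => ‖freqVec k‖ ≤ R

lemma mem_lball {R : ℝ} {k : Freq} : k ∈ lball R ↔ ‖freqVec k‖ ≤ R := by
  rw [lball, Finset.mem_filter, and_iff_right_iff_imp]
  exact fun h => mem_box (h.trans (Nat.le_ceil R))

lemma exists_ball_superset (S : Finset Freq) : ∃ R : ℝ, ∀ k ∈ S, ‖freqVec k‖ ≤ R := by
  refine ⟨∑ k ∈ S, ‖freqVec k‖, fun k hk => ?_⟩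
  exact Finset.single_le_sum (f := fun k => ‖freqVec k‖) (fun _ _ => norm_nonneg _) hk

/-! ### Band-limited functions -/

/-- A continuous function with Fourier coefficients supported in `|k| ≤ R`. -/
structure BandLim (R : ℝ) (Q : Torus → ℂ) : Prop where
  cont : Continuous Q
  supp : ∀ k, R < ‖freqVec k‖ → ofFun Q k = 0

lemma BandLim.mul {R R' : ℝ} {Q Q' : Torus → ℂ} (h : BandLim R Q) (h' : BandLim R' Q') :
    BandLim (R + R') (fun x => Q x * Q' x) := by
  refine ⟨h.cont.mul h'.cont, fun k hk => ?_⟩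
  refine (ofFun_mul h.cont h'.cont k).unique ?_
  convert hasSum_zero with l
  by_cases hl : R' < ‖freqVec l‖
  · rw [h'.supp l hl, mul_zero]
  · rw [h.supp, zero_mul]
    have := norm_freqVec_add_le (k - l) l
    rw [sub_add_cancel] at this
    linarith

lemma BandLim.mono {R R' : ℝ} {Q : Torus → ℂ} (h : BandLim R Q) (hR : R ≤ R') : BandLim R' Q :=
  ⟨h.cont, fun k hk => h.supp k (hR.trans_lt hk)⟩

lemma bandLim_trig (S : Finset Freq) (c : Freq → ℂ) {R : ℝ} (h : ∀ k ∈ S, ‖freqVec k‖ ≤ R) :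
    BandLim R (fun x => ∑ j ∈ S, c j * ek j x) := by
  refine ⟨continuous_finsetSum _ fun i _ => continuous_const.mul (continuous_ek i), fun k hk => ?_⟩
  rw [ofFun_trig, if_neg]
  exact fun hS => hk.not_ge (h k hS)

lemma BandLim.conj {R : ℝ} {Q : Torus → ℂ} (h : BandLim R Q) :
    BandLim R (fun x => (starRingEnd ℂ) (Q x)) := by
  refine ⟨Complex.continuous_conj.comp h.cont, fun k hk => ?_⟩
  rw [ofFun_conj, h.supp, map_zero]
  rwa [norm_freqVec_neg]

lemma bandLim_const (c : ℂ) : BandLim 0 (fun _ => c) := by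
  refine ⟨continuous_const, fun k hk => ?_⟩
  have : ofFun (fun _ : Torus => c * 1) k = c * ofFun (fun _ => 1) k := ofFun_const_mul c _ k
  rw [mul_one] at this
  rw [this, ofFun_one, if_neg, mul_zero]
  rintro rfl
  have : freqVec 0 = 0 := by ext i; simp [freqVec]
  rw [this, norm_zero] at hk
  exact lt_irrefl _ hk

lemma BandLim.pairing_eq {R : ℝ} {Q : Torus → ℂ} (h : BandLim R Q) (u : Dist) :
    pairing Q u = ∑ k ∈ lball R, ofFun Q (-k) * u k := by
  rw [pairing, tsum_eq_sum]
  · rfl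
  · intro k hk
    rw [mem_lball, not_le] at hk
    rw [pairingTerm, h.supp, zero_mul]
    rwa [norm_freqVec_neg]

lemma pairing_ofFun {f g : Torus → ℂ} (hf : Continuous f) (hg : Continuous g) :
    pairing f (ofFun g) = ∫ x, f x * g x ∂torusMeasure :=
  (parseval hf hg).tsum_eq

lemma norm_integral_mul_le {f g : Torus → ℂ} (hf : Continuous f) (hg : Continuous g) {C : ℝ}
    (h : ∀ x, ‖g x‖ ≤ C) :
    ‖∫ x, f x * g x ∂torusMeasure‖ ≤ C * ∫ x, ‖f x‖ ∂torusMeasure := by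
  refine (norm_integral_le_integral_norm _).trans ?_
  rw [← integral_const_mul]
  refine integral_mono (integrable_of_continuous (hf.mul hg).norm)
    (integrable_of_continuous (by fun_prop)) fun x => ?_
  simp only [norm_mul]
  rw [mul_comm]
  exact mul_le_mul_of_nonneg_right (h x) (norm_nonneg _)

end

section

/-! ### Dyadic powers -/

/-- The dyadic power `2^{sn}`. -/
def dy (s : ℝ) (n : ℕ) : ℝ := (2 : ℝ) ^ (s * n)

lemma dy_pos (s : ℝ) (n : ℕ) : 0 < dy s n := Real.rpow_pos_of_pos two_pos _

lemma dy_nonneg (s : ℝ) (n : ℕ) : 0 ≤ dy s n := (dy_pos s n).le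

lemma dy_mul (s t : ℝ) (n : ℕ) : dy s n * dy t n = dy (s + t) n := by
  rw [dy, dy, dy, ← Real.rpow_add two_pos, add_mul]

lemma dy_sq (s : ℝ) (n : ℕ) : dy s n ^ 2 = dy (2 * s) n := by
  rw [sq, dy_mul, two_mul]

lemma dy_eq_pow (s : ℝ) (n : ℕ) : dy s n = ((2 : ℝ) ^ s) ^ n := by
  rw [dy, Real.rpow_mul_natCast two_pos.le]

lemma dy_add_right (s : ℝ) (n j : ℕ) : dy s (n + j) = dy s n * dy s j := by
  rw [dy_eq_pow, dy_eq_pow, dy_eq_pow, pow_add]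

lemma dy_one (n : ℕ) : dy 1 n = 2 ^ n := by simp [dy]

lemma dy_zero_left (n : ℕ) : dy 0 n = 1 := by simp [dy]

lemma dy_zero_right (s : ℝ) : dy s 0 = 1 := by simp [dy]

lemma pow_rpow_eq_dy (s : ℝ) (n : ℕ) : ((2 : ℝ) ^ n) ^ s = dy s n := by
  rw [dy, ← Real.rpow_natCast, ← Real.rpow_mul two_pos.le, mul_comm]

lemma dy_mono {s t : ℝ} (h : s ≤ t) (n : ℕ) : dy s n ≤ dy t n :=
  Real.rpow_le_rpow_of_exponent_le one_le_two (by gcongr)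

/-- The sum of the geometric series `∑ 2^{-εn}`. -/
def geo (ε : ℝ) : ℝ := (1 - (2 : ℝ) ^ (-ε))⁻¹

lemma two_rpow_neg_lt_one {ε : ℝ} (h : 0 < ε) : (2 : ℝ) ^ (-ε) < 1 :=
  Real.rpow_lt_one_of_one_lt_of_neg one_lt_two (by linarith)

lemma hasSum_dy {ε : ℝ} (h : 0 < ε) : HasSum (dy (-ε)) (geo ε) := by
  have := hasSum_geometric_of_lt_one (r := (2 : ℝ) ^ (-ε)) (by positivity) (two_rpow_neg_lt_one h)
  rw [geo, funext (dy_eq_pow (-ε))]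
  exact this

lemma geo_pos {ε : ℝ} (h : 0 < ε) : 0 < geo ε :=
  inv_pos.2 (by linarith [two_rpow_neg_lt_one h])

lemma sum_dy_le {ε : ℝ} (h : 0 < ε) (S : Finset ℕ) : ∑ n ∈ S, dy (-ε) n ≤ geo ε :=
  sum_le_hasSum S (fun n _ => dy_nonneg _ n) (hasSum_dy h)

lemma rpow_le_four_rpow {a e : ℝ} (h1 : 1 / 4 ≤ a) (h2 : a ≤ 4) : a ^ e ≤ (4 : ℝ) ^ |e| := by
  have ha : 0 < a := by linarith
  rcases le_total 0 e with h | h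
  · rw [abs_of_nonneg h]; exact Real.rpow_le_rpow ha.le h2 h
  · rw [abs_of_nonpos h]
    have := Real.rpow_le_rpow_of_nonpos (by norm_num) h1 h
    refine this.trans (le_of_eq ?_)
    rw [one_div, Real.inv_rpow (by norm_num), ← Real.rpow_neg (by norm_num)]

/-! ### The blocks -/

variable (χ : DyadicPartition)

lemma cutoff_nonneg (n : ℕ) (x) : 0 ≤ χ.cutoff n x := by
  cases n with
  | zero => exact (χ.low_mem x).1
  | succ j => exact (χ.ann_mem _).1

lemma cutoff_le_one (n : ℕ) (x) : χ.cutoff n x ≤ 1 := by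
  cases n with
  | zero => exact (χ.low_mem x).2
  | succ j => exact (χ.ann_mem _).2

lemma cutoff_neg (n : ℕ) (k : Freq) : χ.cutoff n (freqVec (-k)) = χ.cutoff n (freqVec k) := by
  cases n with
  | zero => exact χ.low_radial _ _ (norm_freqVec_neg k)
  | succ j =>
    refine χ.ann_radial _ _ ?_
    rw [freqVec_neg, smul_neg, norm_neg]

lemma norm_le_of_cutoff_ne {n : ℕ} {x} (h : χ.cutoff n x ≠ 0) : ‖x‖ ≤ 4 / 3 * 2 ^ n := by
  cases n with
  | zero =>
    have := χ.low_supp (subset_tsupport _ h)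
    rw [mem_ball_zero_iff] at this
    simpa using this.le
  | succ j =>
    have := (χ.ann_supp (subset_tsupport _ h)).1
    rw [mem_ball_zero_iff, norm_smul, norm_inv, norm_pow, Real.norm_two,
      inv_mul_lt_iff₀ (by positivity)] at this
    rw [pow_succ]; linarith

lemma le_norm_of_cutoff_ne {n : ℕ} {x} (hn : n ≠ 0) (h : χ.cutoff n x ≠ 0) :
    3 / 8 * 2 ^ n ≤ ‖x‖ := by
  cases n with
  | zero => exact absurd rfl hn
  | succ j =>
    have := (χ.ann_supp (subset_tsupport _ h)).2
    rw [mem_ball_zero_iff, norm_smul, norm_inv, norm_pow, Real.norm_two, not_lt,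
      le_inv_mul_iff₀ (by positivity)] at this
    rw [pow_succ]; linarith

lemma le_wt_of_cutoff_ne {n : ℕ} {k : Freq} (h : χ.cutoff n (freqVec k) ≠ 0) :
    3 / 8 * 2 ^ n ≤ wt k := by
  rcases eq_or_ne n 0 with rfl | hn
  · have := one_le_wt k; norm_num; linarith
  · have := le_norm_of_cutoff_ne χ hn h
    unfold wt; linarith

lemma wt_le_of_cutoff_ne {n : ℕ} {k : Freq} (h : χ.cutoff n (freqVec k) ≠ 0) :
    wt k ≤ 7 / 3 * 2 ^ n := by
  have := norm_le_of_cutoff_ne χ h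
  have h1 : (1 : ℝ) ≤ 2 ^ n := one_le_pow₀ one_le_two
  unfold wt; linarith

lemma wt_rpow_le_of_cutoff_ne (e : ℝ) {n : ℕ} {k : Freq} (h : χ.cutoff n (freqVec k) ≠ 0) :
    wt k ^ e ≤ (4 : ℝ) ^ |e| * dy e n := by
  have h1 := le_wt_of_cutoff_ne χ h
  have h2 := wt_le_of_cutoff_ne χ h
  have hp : (0 : ℝ) < 2 ^ n := by positivity
  have : wt k = (wt k / 2 ^ n) * 2 ^ n := by field_simp
  rw [this, Real.mul_rpow (div_nonneg (wt_pos k).le hp.le) hp.le, pow_rpow_eq_dy]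
  gcongr
  · exact dy_nonneg _ _
  · refine rpow_le_four_rpow ?_ ?_
    · rw [le_div_iff₀ hp]; linarith
    · rw [div_le_iff₀ hp]; linarith

lemma hasSum_cutoff (x) : HasSum (fun n => χ.cutoff n x) 1 := by
  have := χ.hasSum_one x
  rw [← hasSum_nat_add_iff' 1]
  simpa [DyadicPartition.cutoff] using this

lemma sum_cutoff_eq_one {k : Freq} {M : ℕ} (h : wt k < 3 / 8 * 2 ^ M) :
    ∑ n ∈ Finset.range M, χ.cutoff n (freqVec k) = 1 := by
  refine (hasSum_sum_of_ne_finset_zero fun n hn => ?_).unique (hasSum_cutoff χ (freqVec k))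
  by_contra h0
  have h1 := le_wt_of_cutoff_ne χ h0
  rw [Finset.mem_range, not_lt] at hn
  have : (2 : ℝ) ^ M ≤ 2 ^ n := pow_le_pow_right₀ one_le_two hn
  linarith

lemma exists_large_dyadic (S : Finset Freq) : ∃ M : ℕ, ∀ k ∈ S, wt k < 3 / 8 * 2 ^ M := by
  obtain ⟨R, hR⟩ := exists_ball_superset S
  obtain ⟨M, hM⟩ := pow_unbounded_of_one_lt (8 / 3 * (1 + R)) one_lt_two
  refine ⟨M, fun k hk => ?_⟩
  have := hR k hk
  unfold wt; linarith

lemma block_eq_sum (n : ℕ) (u : Dist) (x : Torus) :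
    block χ n u x = ∑ k ∈ lball (4 / 3 * 2 ^ n),
      ((χ.cutoff n (freqVec k) : ℂ) * u k) * ek k x := by
  rw [block, tsum_eq_sum]
  intro k hk
  have : χ.cutoff n (freqVec k) = 0 := by
    by_contra h
    exact hk (mem_lball.2 (norm_le_of_cutoff_ne χ h))
  simp [this]

lemma bandLim_block (n : ℕ) (u : Dist) : BandLim (4 / 3 * 2 ^ n) (block χ n u) := by
  rw [funext (block_eq_sum χ n u)]
  exact bandLim_trig _ _ fun k hk => mem_lball.1 hk

lemma continuous_block (n : ℕ) (u : Dist) : Continuous (block χ n u) := (bandLim_block χ n u).cont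

lemma ofFun_block (n : ℕ) (u : Dist) (k : Freq) :
    ofFun (block χ n u) k = (χ.cutoff n (freqVec k) : ℂ) * u k := by
  rw [funext (block_eq_sum χ n u), ofFun_trig]
  split_ifs with h
  · rfl
  · have : χ.cutoff n (freqVec k) = 0 := by
      by_contra h'
      exact h (mem_lball.2 (norm_le_of_cutoff_ne χ h'))
    simp [this]

lemma block_conjDist (n : ℕ) (u : Dist) (x : Torus) :
    block χ n (conjDist u) x = (starRingEnd ℂ) (block χ n u x) := by
  unfold block
  rw [Complex.conj_tsum, ← (Equiv.neg Freq).tsum_eq]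
  congr 1; ext k
  simp only [Equiv.neg_apply, conjDist, neg_neg, map_mul, Complex.conj_ofReal, cutoff_neg]
  congr 1
  exact ek_neg k x

/-- `‖δ_{n-1} u‖_{L^∞} ≤ C 2^{-sn}` for all `n`. -/
def BlockBound (s C : ℝ) (u : Dist) : Prop := ∀ n x, ‖block χ n u x‖ ≤ C * dy (-s) n

variable {χ}

lemma BlockBound.nonneg {s C : ℝ} {u : Dist} (h : BlockBound χ s C u) : 0 ≤ C := by
  have := (norm_nonneg _).trans (h 0 0)
  rwa [dy_zero_right, mul_one] at this

lemma BlockBound.mono {s C C' : ℝ} {u : Dist} (h : BlockBound χ s C u) (hC : C ≤ C') :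
    BlockBound χ s C' u := fun n x =>
  (h n x).trans (mul_le_mul_of_nonneg_right hC (dy_nonneg _ _))

lemma BlockBound.conj {s C : ℝ} {u : Dist} (h : BlockBound χ s C u) :
    BlockBound χ s C (conjDist u) := fun n x => by
  rw [block_conjDist, RCLike.norm_conj]; exact h n x

lemma blockBound_of_besovNorm {s B : ℝ} {u : Dist} (hB : 0 ≤ B)
    (h : besovNorm χ s u ≤ ENNReal.ofReal B) : BlockBound χ s (2 ^ s * B) u := fun n x => by
  have h1 : ENNReal.ofReal ((2 : ℝ) ^ (s * ((n : ℝ) - 1))) * ‖block χ n u x‖ₑ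
      ≤ ENNReal.ofReal B := by
    refine le_trans ?_ h
    refine le_trans ?_ (le_iSup _ n)
    gcongr
    exact le_iSup (fun x => ‖block χ n u x‖ₑ) x
  rw [← ofReal_norm, ← ENNReal.ofReal_mul (by positivity),
    ENNReal.ofReal_le_ofReal_iff hB] at h1
  have e : (2 : ℝ) ^ (s * ((n : ℝ) - 1)) = (2 ^ s)⁻¹ * dy s n := by
    rw [dy, ← Real.rpow_neg two_pos.le, ← Real.rpow_add two_pos]; ring_nf
  have e2 : dy s n * dy (-s) n = 1 := by rw [dy_mul, add_neg_cancel, dy_zero_left]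
  have hs : (0 : ℝ) < 2 ^ s := by positivity
  rw [e] at h1
  calc ‖block χ n u x‖ = 2 ^ s * ((2 ^ s)⁻¹ * dy s n * ‖block χ n u x‖) * dy (-s) n := by
        rw [mul_assoc, mul_assoc, mul_assoc, mul_inv_cancel_left₀ hs.ne', mul_comm ‖_‖,
          ← mul_assoc, e2, one_mul]
    _ ≤ 2 ^ s * B * dy (-s) n := by
        gcongr
        exact dy_nonneg _ _

/-! ### Weighted square sums -/

/-- `∑ (1+|k|)^{2s} |u(k)|² ≤ M`. -/
def WBound (s M : ℝ) (u : Dist) : Prop :=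
  ∀ S : Finset Freq, ∑ k ∈ S, wt k ^ (2 * s) * ‖u k‖ ^ 2 ≤ M

lemma WBound.nonneg {s M : ℝ} {u : Dist} (h : WBound s M u) : 0 ≤ M := by simpa using h ∅

lemma wterm_nonneg (s : ℝ) (u : Dist) (k : Freq) : 0 ≤ wt k ^ (2 * s) * ‖u k‖ ^ 2 :=
  mul_nonneg (Real.rpow_nonneg (wt_pos k).le _) (by positivity)

lemma WBound.mono {s M M' : ℝ} {u : Dist} (h : WBound s M u) (hM : M ≤ M') : WBound s M' u :=
  fun S => (h S).trans hM

lemma WBound.anti {s s' M : ℝ} {u : Dist} (h : WBound s M u) (hs : s' ≤ s) : WBound s' M u :=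
  fun S => (Finset.sum_le_sum fun k _ => by
    gcongr ?_ * _
    exact Real.rpow_le_rpow_of_exponent_le (one_le_wt k) (by linarith)).trans (h S)

lemma WBound.summable {s M : ℝ} {u : Dist} (h : WBound s M u) :
    Summable fun k => wt k ^ (2 * s) * ‖u k‖ ^ 2 :=
  summable_of_sum_le (fun k => wterm_nonneg s u k) h

lemma WBound.add {s M M' : ℝ} {u w : Dist} (h : WBound s M u) (h' : WBound s M' w) :
    WBound s (2 * M + 2 * M') (u + w) := fun S => by
  have := add_le_add (mul_le_mul_of_nonneg_left (h S) zero_le_two)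
    (mul_le_mul_of_nonneg_left (h' S) zero_le_two)
  refine le_trans ?_ this
  rw [Finset.mul_sum, Finset.mul_sum, ← Finset.sum_add_distrib]
  refine Finset.sum_le_sum fun k _ => ?_
  have h1 : ‖(u + w) k‖ ^ 2 ≤ 2 * ‖u k‖ ^ 2 + 2 * ‖w k‖ ^ 2 := by
    have := norm_add_le (u k) (w k)
    have h3 := pow_le_pow_left₀ (norm_nonneg _) this 2
    rw [Pi.add_apply]
    nlinarith [sq_nonneg (‖u k‖ - ‖w k‖)]
  have := mul_le_mul_of_nonneg_left h1 (Real.rpow_nonneg (wt_pos k).le (2 * s))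
  linarith

lemma WBound.smul {s M : ℝ} {u : Dist} (h : WBound s M u) (c : ℂ) :
    WBound s (‖c‖ ^ 2 * M) (c • u) := fun S => by
  refine le_trans (le_of_eq ?_) (mul_le_mul_of_nonneg_left (h S) (sq_nonneg ‖c‖))
  rw [Finset.mul_sum]
  refine Finset.sum_congr rfl fun k _ => ?_
  rw [Pi.smul_apply, smul_eq_mul, norm_mul]; ring

lemma WBound.reindex {s M c : ℝ} {u : Dist} (h : WBound s M u) (e : Freq ≃ Freq)
    (hc : ∀ k, wt k ^ (2 * s) ≤ c * wt (e k) ^ (2 * s)) :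
    WBound s (c * M) (fun k => u (e k)) := fun S => by
  have hc0 : 0 ≤ c := by
    have h1 := hc 0
    have h2 : (0 : ℝ) < wt 0 ^ (2 * s) := Real.rpow_pos_of_pos (wt_pos 0) _
    have h3 : (0 : ℝ) < wt (e 0) ^ (2 * s) := Real.rpow_pos_of_pos (wt_pos _) _
    exact le_of_lt (pos_of_mul_pos_left (h2.trans_le h1) h3.le)
  refine le_trans ?_ (mul_le_mul_of_nonneg_left (h (S.map e.toEmbedding)) hc0)
  rw [Finset.sum_map, Finset.mul_sum]
  refine Finset.sum_le_sum fun k _ => ?_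
  rw [← mul_assoc]
  exact mul_le_mul_of_nonneg_right (hc k) (by positivity)

lemma WBound.neg {s M : ℝ} {u : Dist} (h : WBound s M u) : WBound s M (fun k => u (-k)) := by
  have := h.reindex (Equiv.neg Freq) (c := 1) fun k => by simp [wt_neg]
  rwa [one_mul] at this

lemma WBound.subLeft {s M : ℝ} {u : Dist} (h : WBound s M u) (hs : 0 ≤ s) (j : Freq) :
    WBound s (wt j ^ (2 * s) * M) (fun k => u (j - k)) := by
  refine h.reindex (Equiv.subLeft j) fun k => ?_
  rw [← Real.mul_rpow (wt_pos _).le (wt_pos _).le]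
  refine Real.rpow_le_rpow (wt_pos _).le ?_ (by linarith)
  have := wt_add_le j (-(j - k))
  rwa [wt_neg, show j + -(j - k) = k by abel] at this

lemma WBound.sum_mul_le {a b M M' : ℝ} {u w : Dist} (h : WBound a M u) (h' : WBound (-b) M' w)
    (S : Finset Freq) : ∑ k ∈ S, wt k ^ (a - b) * ‖u k * w k‖ ≤ (M + M') / 2 := by
  have := add_le_add (h S) (h' S)
  rw [← Finset.sum_add_distrib] at this
  rw [le_div_iff₀ two_pos, Finset.sum_mul]
  refine le_trans (Finset.sum_le_sum fun k _ => ?_) this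
  have e1 : wt k ^ (a - b) = wt k ^ a * wt k ^ (-b) := by
    rw [← Real.rpow_add (wt_pos k), sub_eq_add_neg]
  have e2 : wt k ^ (2 * a) = (wt k ^ a) ^ 2 := by
    rw [← Real.rpow_mul_natCast (wt_pos k).le]; ring_nf
  have e3 : wt k ^ (2 * -b) = (wt k ^ (-b)) ^ 2 := by
    rw [← Real.rpow_mul_natCast (wt_pos k).le]; ring_nf
  rw [e1, e2, e3, norm_mul]
  nlinarith [sq_nonneg (wt k ^ a * ‖u k‖ - wt k ^ (-b) * ‖w k‖)]

lemma WBound.summable_mul {a b M M' : ℝ} {u w : Dist} (h : WBound a M u) (h' : WBound (-b) M' w)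
    (hab : b ≤ a) : Summable fun k => u k * w k := by
  refine Summable.of_norm (summable_of_sum_le (c := (M + M') / 2) (fun k => norm_nonneg _)
    fun S => le_trans (Finset.sum_le_sum fun k _ => ?_) (h.sum_mul_le h' S))
  exact le_mul_of_one_le_left (norm_nonneg _)
    (Real.one_le_rpow (one_le_wt k) (by linarith))

/-- Convergence of sums with uniformly small tails. -/
lemma tendsto_tsum_of_weighted {X : Type*} {F : Filter X} {c : X → Freq → ℂ} {c₀ : Freq → ℂ}
    {ε M : ℝ} (hε : 0 < ε) (hb : ∀ᶠ x in F, ∀ S : Finset Freq, ∑ k ∈ S, wt k ^ ε * ‖c x k‖ ≤ M)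
    (hc : ∀ k, Tendsto (fun x => c x k) F (𝓝 (c₀ k))) :
    Tendsto (fun x => ∑' k, c x k) F (𝓝 (∑' k, c₀ k)) := by
  rcases F.eq_or_neBot with rfl | hF
  · exact tendsto_bot
  have hb0 : ∀ S : Finset Freq, ∑ k ∈ S, wt k ^ ε * ‖c₀ k‖ ≤ M := fun S =>
    le_of_tendsto (tendsto_finsetSum S fun k _ => (hc k).norm.const_mul _)
      (hb.mono fun x hx => hx S)
  have summ : ∀ d : Freq → ℂ, (∀ S : Finset Freq, ∑ k ∈ S, wt k ^ ε * ‖d k‖ ≤ M) →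
      Summable d := fun d hd =>
    Summable.of_norm (summable_of_sum_le (c := M) (fun k => norm_nonneg _)
      fun S => le_trans (Finset.sum_le_sum fun k _ => le_mul_of_one_le_left (norm_nonneg _)
        (Real.one_le_rpow (one_le_wt k) hε.le)) (hd S))
  have tail : ∀ d : Freq → ℂ, (∀ S : Finset Freq, ∑ k ∈ S, wt k ^ ε * ‖d k‖ ≤ M) →
      ∀ R : ℝ, 0 < R → ‖∑' k, d k - ∑ k ∈ lball R, d k‖ ≤ M / R ^ ε := by
    intro d hd R hR
    have hs := summ d hd
    have hlim : Tendsto (fun S : Finset Freq => ‖∑ k ∈ S, d k - ∑ k ∈ lball R, d k‖) atTop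
        (𝓝 ‖∑' k, d k - ∑ k ∈ lball R, d k‖) := (hs.hasSum.sub_const _).norm
    refine le_of_tendsto hlim ?_
    filter_upwards [eventually_ge_atTop (lball R)] with S hS
    rw [← Finset.sum_sdiff hS, add_sub_cancel_right]
    have hRε : 0 < R ^ ε := Real.rpow_pos_of_pos hR _
    rw [le_div_iff₀ hRε]
    calc ‖∑ k ∈ S \ lball R, d k‖ * R ^ ε ≤ (∑ k ∈ S \ lball R, ‖d k‖) * R ^ ε := by
          gcongr; exact norm_sum_le _ _
      _ ≤ ∑ k ∈ S \ lball R, wt k ^ ε * ‖d k‖ := by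
          rw [Finset.sum_mul]
          refine Finset.sum_le_sum fun k hk => ?_
          rw [Finset.mem_sdiff, mem_lball, not_le] at hk
          rw [mul_comm]
          gcongr
          unfold wt; linarith [hk.2]
      _ ≤ M := hd _
  have hM : 0 ≤ M := by simpa using hb0 ∅
  rw [Metric.tendsto_nhds]
  intro η hη
  obtain ⟨R, hR0, hR⟩ : ∃ R : ℝ, 0 < R ∧ M / R ^ ε < η / 3 := by
    have : Tendsto (fun R : ℝ => M / R ^ ε) atTop (𝓝 0) :=
      tendsto_const_nhds.div_atTop (tendsto_rpow_atTop hε)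
    exact ((eventually_gt_atTop 0).and (this.eventually (gt_mem_nhds (by positivity)))).exists
  have hfin : Tendsto (fun x => ∑ k ∈ lball R, c x k) F (𝓝 (∑ k ∈ lball R, c₀ k)) :=
    tendsto_finsetSum _ fun k _ => hc k
  filter_upwards [hb, Metric.tendsto_nhds.1 hfin (η / 3) (by positivity)] with x hx hx2
  have t1 := tail (c x) hx R hR0
  have t2 := tail c₀ hb0 R hR0
  rw [dist_eq_norm] at hx2 ⊢
  calc ‖∑' k, c x k - ∑' k, c₀ k‖
      = ‖(∑' k, c x k - ∑ k ∈ lball R, c x k) + (∑ k ∈ lball R, c x k - ∑ k ∈ lball R, c₀ k)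
          - (∑' k, c₀ k - ∑ k ∈ lball R, c₀ k)‖ := by congr 1; ring
    _ ≤ ‖∑' k, c x k - ∑ k ∈ lball R, c x k‖ + ‖∑ k ∈ lball R, c x k - ∑ k ∈ lball R, c₀ k‖
          + ‖∑' k, c₀ k - ∑ k ∈ lball R, c₀ k‖ :=
        (norm_sub_le _ _).trans (by gcongr; exact norm_add_le _ _)
    _ < η := by linarith

lemma tendsto_tsum_mul {X : Type*} {F : Filter X} {u w : X → Dist} {u₀ w₀ : Dist}
    {a b M M' : ℝ} (hab : b < a) (hu : ∀ᶠ x in F, WBound a M (u x))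
    (hw : ∀ᶠ x in F, WBound (-b) M' (w x)) (hu₀ : ∀ k, Tendsto (fun x => u x k) F (𝓝 (u₀ k)))
    (hw₀ : ∀ k, Tendsto (fun x => w x k) F (𝓝 (w₀ k))) :
    Tendsto (fun x => ∑' k, u x k * w x k) F (𝓝 (∑' k, u₀ k * w₀ k)) :=
  tendsto_tsum_of_weighted (sub_pos.2 hab)
    (by filter_upwards [hu, hw] with x h1 h2 using h1.sum_mul_le h2)
    fun k => (hu₀ k).mul (hw₀ k)

lemma BlockBound.wBound {s C s' : ℝ} {u : Dist} (h : BlockBound χ s C u) (hs : s' < s) :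
    WBound s' ((4 : ℝ) ^ |2 * s'| * geo (s - s') ^ 2 * C ^ 2) u := fun S => by
  set ε := s - s' with hε
  have hε0 : 0 < ε := sub_pos.2 hs
  obtain ⟨M, hM⟩ := exists_large_dyadic S
  have key : ∀ n, ∑ k ∈ S, (χ.cutoff n (freqVec k)) ^ 2 * ‖u k‖ ^ 2 ≤ (C * dy (-s) n) ^ 2 := by
    intro n
    refine le_trans (le_of_eq ?_) (bessel (continuous_block χ n u) (h n) S)
    refine Finset.sum_congr rfl fun k _ => ?_
    rw [ofFun_block, norm_mul, Complex.norm_real, Real.norm_eq_abs,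
      abs_of_nonneg (cutoff_nonneg χ n _), mul_pow]
  have pt : ∀ k ∈ S, wt k ^ (2 * s') * ‖u k‖ ^ 2 ≤
      geo ε * ∑ n ∈ Finset.range M, (4 : ℝ) ^ |2 * s'| * dy (ε + 2 * s') n *
        ((χ.cutoff n (freqVec k)) ^ 2 * ‖u k‖ ^ 2) := by
    intro k hk
    have h1 := sum_cutoff_eq_one χ (hM k hk)
    have cs := Finset.sum_mul_sq_le_sq_mul_sq (Finset.range M) (fun n => dy (-(ε / 2)) n)
      (fun n => dy (ε / 2) n * χ.cutoff n (freqVec k))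
    have e1 : ∀ n, dy (-(ε / 2)) n * (dy (ε / 2) n * χ.cutoff n (freqVec k))
        = χ.cutoff n (freqVec k) := fun n => by
      rw [← mul_assoc, dy_mul, neg_add_cancel, dy_zero_left, one_mul]
    simp only [e1, h1, one_pow, dy_sq, mul_pow] at cs
    rw [show 2 * -(ε / 2) = -ε by ring, show 2 * (ε / 2) = ε by ring] at cs
    have cs2 : 1 ≤ geo ε * ∑ n ∈ Finset.range M, dy ε n * χ.cutoff n (freqVec k) ^ 2 :=
      cs.trans (mul_le_mul_of_nonneg_right (sum_dy_le hε0 _)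
        (Finset.sum_nonneg fun n _ => mul_nonneg (dy_nonneg _ _) (sq_nonneg _)))
    calc wt k ^ (2 * s') * ‖u k‖ ^ 2
        ≤ (wt k ^ (2 * s') * ‖u k‖ ^ 2) *
          (geo ε * ∑ n ∈ Finset.range M, dy ε n * χ.cutoff n (freqVec k) ^ 2) :=
          le_mul_of_one_le_right (wterm_nonneg s' u k) cs2
      _ = geo ε * ∑ n ∈ Finset.range M, (wt k ^ (2 * s') * ‖u k‖ ^ 2) *
          (dy ε n * χ.cutoff n (freqVec k) ^ 2) := by
          rw [mul_left_comm, Finset.mul_sum]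
      _ ≤ _ := by
          have hg := geo_pos hε0
          gcongr geo ε * ∑ n ∈ _, ?_ with n hn
          rcases eq_or_ne (χ.cutoff n (freqVec k)) 0 with h0 | h0
          · simp [h0]
          · have := wt_rpow_le_of_cutoff_ne χ (2 * s') h0
            rw [← dy_mul]
            have hd := dy_pos ε n
            calc _ = wt k ^ (2 * s') * (dy ε n * (χ.cutoff n (freqVec k) ^ 2 * ‖u k‖ ^ 2)) := by
                  ring
              _ ≤ ((4 : ℝ) ^ |2 * s'| * dy (2 * s') n) *
                  (dy ε n * (χ.cutoff n (freqVec k) ^ 2 * ‖u k‖ ^ 2)) := by gcongr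
              _ = _ := by ring
  calc ∑ k ∈ S, wt k ^ (2 * s') * ‖u k‖ ^ 2 ≤ ∑ k ∈ S, geo ε * ∑ n ∈ Finset.range M,
        (4 : ℝ) ^ |2 * s'| * dy (ε + 2 * s') n * ((χ.cutoff n (freqVec k)) ^ 2 * ‖u k‖ ^ 2) :=
        Finset.sum_le_sum pt
    _ = geo ε * ∑ n ∈ Finset.range M, (4 : ℝ) ^ |2 * s'| * dy (ε + 2 * s') n *
          ∑ k ∈ S, ((χ.cutoff n (freqVec k)) ^ 2 * ‖u k‖ ^ 2) := by
        rw [← Finset.mul_sum, Finset.sum_comm]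
        simp only [Finset.mul_sum]
    _ ≤ geo ε * ∑ n ∈ Finset.range M, (4 : ℝ) ^ |2 * s'| * dy (ε + 2 * s') n *
          (C * dy (-s) n) ^ 2 := by
        have hg := geo_pos hε0
        gcongr with n hn
        · exact mul_nonneg (by positivity) (dy_nonneg _ _)
        · exact key n
    _ = geo ε * ((4 : ℝ) ^ |2 * s'| * C ^ 2 * ∑ n ∈ Finset.range M, dy (-ε) n) := by
        congr 1
        rw [Finset.mul_sum]
        refine Finset.sum_congr rfl fun n _ => ?_
        rw [mul_pow, dy_sq, show -ε = (ε + 2 * s') + 2 * (-s) by rw [hε]; ring,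
          ← dy_mul (ε + 2 * s')]
        ring
    _ ≤ geo ε * ((4 : ℝ) ^ |2 * s'| * C ^ 2 * geo ε) := by
        have hg := geo_pos hε0
        gcongr
        exact sum_dy_le hε0 _
    _ = _ := by ring

lemma WBound.norm_sq_le {s M : ℝ} {u : Dist} (h : WBound s M u) (k : Freq) :
    ‖u k‖ ^ 2 ≤ wt k ^ (-(2 * s)) * M := by
  have := h {k}
  rw [Finset.sum_singleton] at this
  have hw : 0 < wt k ^ (2 * s) := Real.rpow_pos_of_pos (wt_pos k) _
  rwa [Real.rpow_neg (wt_pos k).le, le_inv_mul_iff₀ hw]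

end

section

variable {χ : DyadicPartition}

/-! ### Approximation by band-limited functions -/

/-- `f` is bounded by `M` and approximated by functions of frequency at most `D 2^J`
up to an error `M 2^{-aJ}`. -/
structure Approx (a D M : ℝ) (f : Torus → ℂ) : Prop where
  cont : Continuous f
  bound : ∀ x, ‖f x‖ ≤ M
  approx : ∀ J : ℕ, ∃ p, BandLim (D * 2 ^ J) p ∧ ∀ x, ‖f x - p x‖ ≤ M * dy (-a) J

lemma Approx.nonneg {a D M : ℝ} {f : Torus → ℂ} (h : Approx a D M f) : 0 ≤ M :=
  (norm_nonneg _).trans (h.bound 0)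

lemma dy_neg_le_one {a : ℝ} (ha : 0 ≤ a) (J : ℕ) : dy (-a) J ≤ 1 := by
  have := dy_mono (show -a ≤ 0 by linarith) J
  rwa [dy_zero_left] at this

lemma approx_one (a : ℝ) : Approx a 0 1 (fun _ => 1) :=
  ⟨continuous_const, fun x => by simp, fun J => ⟨fun _ => 1, by
    rw [zero_mul]; exact bandLim_const 1, fun x => by
    rw [sub_self, norm_zero, one_mul]; exact dy_nonneg _ _⟩⟩

lemma Approx.conj {a D M : ℝ} {f : Torus → ℂ} (h : Approx a D M f) :
    Approx a D M (fun x => (starRingEnd ℂ) (f x)) :=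
  ⟨Complex.continuous_conj.comp h.cont, fun x => by rw [RCLike.norm_conj]; exact h.bound x,
    fun J => by
      obtain ⟨p, hp, hp2⟩ := h.approx J
      refine ⟨_, hp.conj, fun x => ?_⟩
      rw [← map_sub, RCLike.norm_conj]; exact hp2 x⟩

lemma Approx.mul {a D M D' M' : ℝ} {f g : Torus → ℂ} (ha : 0 ≤ a) (hf : Approx a D M f)
    (hg : Approx a D' M' g) : Approx a (D + D') (3 * M * M') (fun x => f x * g x) := by
  have hM := hf.nonneg
  have hM' := hg.nonneg
  refine ⟨hf.cont.mul hg.cont, fun x => ?_, fun J => ?_⟩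
  · rw [norm_mul]
    calc ‖f x‖ * ‖g x‖ ≤ M * M' := by gcongr; exacts [hf.bound x, hg.bound x]
      _ ≤ 3 * M * M' := by nlinarith [mul_nonneg hM hM']
  · obtain ⟨p, hp, hp2⟩ := hf.approx J
    obtain ⟨q, hq, hq2⟩ := hg.approx J
    refine ⟨_, (hp.mul hq).mono (by ring_nf; rfl), fun x => ?_⟩
    have hd := dy_nonneg (-a) J
    have hd1 := dy_neg_le_one ha J
    have h1 : ‖p x‖ ≤ 2 * M := by
      have := norm_sub_norm_le (p x) (f x)
      rw [norm_sub_rev] at this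
      have h2 := hp2 x
      have h3 := hf.bound x
      nlinarith
    calc ‖f x * g x - p x * q x‖ = ‖(f x - p x) * g x + p x * (g x - q x)‖ := by congr 1; ring
      _ ≤ ‖f x - p x‖ * ‖g x‖ + ‖p x‖ * ‖g x - q x‖ :=
        (norm_add_le _ _).trans (by rw [norm_mul, norm_mul])
      _ ≤ (M * dy (-a) J) * M' + (2 * M) * (M' * dy (-a) J) := by
        gcongr
        exacts [hp2 x, hg.bound x, hq2 x]
      _ = _ := by ring

lemma Approx.pow {a D M : ℝ} {f : Torus → ℂ} (ha : 0 ≤ a) (hf : Approx a D M f) (i : ℕ) :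
    Approx a (D * i) ((3 * M) ^ i) (fun x => f x ^ i) := by
  induction i with
  | zero => simpa using approx_one a
  | succ i ih =>
    have := hf.mul ha ih
    convert this using 1
    · push_cast; ring
    · ring
    · ext x; ring

lemma Approx.monomial {a D M : ℝ} {f : Torus → ℂ} (ha : 0 ≤ a) (hf : Approx a D M f) (i j : ℕ) :
    Approx a (D * (i + j)) (3 * (3 * M) ^ (i + j)) (monomial i j f) := by
  have := (hf.pow ha i).mul ha (hf.conj.pow ha j)
  convert this using 1
  · ring
  · rw [pow_add]; ring
  · rfl

lemma hasSum_ofFun {f : ℕ → Torus → ℂ} {b : ℕ → ℝ} (hf : ∀ n, Continuous (f n))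
    (hb : Summable b) (h : ∀ n x, ‖f n x‖ ≤ b n) (k : Freq) :
    HasSum (fun n => ofFun (f n) k) (ofFun (fun x => ∑' n, f n x) k) := by
  simp only [ofFun_apply]
  have := hasSum_integral_of_summable_integral_norm (μ := torusMeasure)
    (F := fun n x => ek (-k) x * f n x)
    (fun n => integrable_of_continuous ((continuous_ek _).mul (hf n)))
    (Summable.of_nonneg_of_le (fun n => integral_nonneg fun x => norm_nonneg _)
      (fun n => integral_mono_bound ((continuous_ek _).fun_mul (hf n)).norm fun x => by
        rw [norm_mul, norm_ek, one_mul]; exact h n x) hb)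
  simpa only [tsum_mul_left] using this

lemma BlockBound.hasSum_block {β C : ℝ} (hβ : 0 < β) {v : Torus → ℂ} (hv : Continuous v)
    (h : BlockBound χ β C (ofFun v)) (x : Torus) :
    HasSum (fun n => block χ n (ofFun v) x) (v x) := by
  have hb : Summable fun n => C * dy (-β) n := (hasSum_dy hβ).summable.mul_left C
  have hc : Continuous fun x => ∑' n, block χ n (ofFun v) x :=
    continuous_tsum (fun n => continuous_block χ n _) hb h
  have e : (fun x => ∑' n, block χ n (ofFun v) x) = v := by
    refine eq_of_ofFun_eq hc hv (funext fun k => ?_)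
    have h1 := hasSum_ofFun (fun n => continuous_block χ n (ofFun v)) hb h k
    simp only [ofFun_block] at h1
    have h2 := (Complex.hasSum_ofReal.2 (hasSum_cutoff χ (freqVec k))).mul_right (ofFun v k)
    rw [Complex.ofReal_one, one_mul] at h2
    exact h1.unique h2
  have := (Summable.of_norm_bounded hb fun n => h n x).hasSum
  rwa [congrFun e x] at this

lemma BlockBound.approx {β C : ℝ} (hβ : 0 < β) {v : Torus → ℂ} (hv : Continuous v)
    (h : BlockBound χ β C (ofFun v)) : Approx β (4 / 3) (C * geo β) v := by
  have tail : ∀ J x, ‖v x - ∑ n ∈ Finset.range J, block χ n (ofFun v) x‖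
      ≤ C * geo β * dy (-β) J := by
    intro J x
    have h1 := (hasSum_nat_add_iff' J).2 (h.hasSum_block hβ hv x)
    have h2 : HasSum (fun n => C * dy (-β) (n + J)) (C * geo β * dy (-β) J) := by
      have := ((hasSum_dy hβ).mul_left C).mul_right (dy (-β) J)
      simpa only [dy_add_right, mul_assoc] using this
    have := tsum_of_norm_bounded h2 fun n => h (n + J) x
    rwa [h1.tsum_eq] at this
  refine ⟨hv, fun x => ?_, fun J => ⟨_, ?_, tail J⟩⟩
  · have := tail 0 x
    simpa [dy_zero_right] using this
  · refine ⟨continuous_finsetSum _ fun n _ => continuous_block χ n _, fun k hk => ?_⟩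
    rw [ofFun_sum _ fun n _ => continuous_block χ n _]
    refine Finset.sum_eq_zero fun n hn => (bandLim_block χ n _).supp k (lt_of_le_of_lt ?_ hk)
    have := pow_le_pow_right₀ (one_le_two (α := ℝ)) (Finset.mem_range.1 hn).le
    linarith

lemma Approx.wBound {a D M s : ℝ} {f : Torus → ℂ} (hD : 0 < D) (hf : Approx a D M f)
    (hs : 0 ≤ s) (hsa : s < a) :
    WBound s ((1 + 2 * D) ^ (2 * s) * (1 + geo (2 * (a - s))) * M ^ 2) (ofFun f) := fun S => by
  have hM := hf.nonneg
  obtain ⟨R, hR⟩ := exists_ball_superset S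
  obtain ⟨N, hN⟩ := pow_unbounded_of_one_lt (R / D) one_lt_two
  set W := (1 + 2 * D) ^ (2 * s)
  have hW : 0 ≤ W := Real.rpow_nonneg (by linarith) _
  have pt : ∀ k ∈ S, wt k ^ (2 * s) ≤ W * (1 + ∑ J ∈ Finset.range N,
      dy (2 * s) J * (if D * 2 ^ J < ‖freqVec k‖ then 1 else 0)) := by
    intro k hk
    have hex : ∃ J : ℕ, ‖freqVec k‖ ≤ D * 2 ^ J := ⟨N, by
      have := hR k hk
      rw [div_lt_iff₀ hD] at hN
      linarith⟩
    have hsum : 0 ≤ ∑ J ∈ Finset.range N,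
        dy (2 * s) J * (if D * 2 ^ J < ‖freqVec k‖ then (1 : ℝ) else 0) :=
      Finset.sum_nonneg fun J _ => mul_nonneg (dy_nonneg _ _) (by split_ifs <;> norm_num)
    have hJ := Nat.find_spec hex
    have hmin := fun i => Nat.find_min hex (m := i)
    have hle : Nat.find hex ≤ N := Nat.find_min' hex (by
      have := hR k hk
      rw [div_lt_iff₀ hD] at hN
      linarith)
    generalize Nat.find hex = J at hJ hmin hle
    rcases J with _ | j
    · have : wt k ^ (2 * s) ≤ W := by
        refine Real.rpow_le_rpow (wt_pos k).le ?_ (by linarith)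
        unfold wt
        rw [pow_zero] at hJ
        linarith
      nlinarith
    · have hj := hmin j (Nat.lt_succ_self j)
      rw [not_le] at hj
      have h2 : (1 : ℝ) ≤ 2 ^ j := one_le_pow₀ one_le_two
      have h1 : wt k ^ (2 * s) ≤ W * dy (2 * s) j := by
        rw [← pow_rpow_eq_dy, ← Real.mul_rpow (by linarith) (by positivity)]
        refine Real.rpow_le_rpow (wt_pos k).le ?_ (by linarith)
        unfold wt
        rw [pow_succ] at hJ
        nlinarith
      refine h1.trans (mul_le_mul_of_nonneg_left ?_ hW)
      have h3 := Finset.single_le_sum (f := fun J =>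
        dy (2 * s) J * (if D * 2 ^ J < ‖freqVec k‖ then (1 : ℝ) else 0))
        (fun J _ => mul_nonneg (dy_nonneg _ _) (by split_ifs <;> norm_num))
        (Finset.mem_range.2 (Nat.lt_of_succ_le hle))
      simp only [hj, if_true, mul_one] at h3
      linarith
  have key : ∀ J : ℕ, ∑ k ∈ S, (if D * 2 ^ J < ‖freqVec k‖ then 1 else 0) * ‖ofFun f k‖ ^ 2
      ≤ M ^ 2 * dy (-(2 * a)) J := by
    intro J
    obtain ⟨p, hp, hp2⟩ := hf.approx J
    have := bessel (hf.cont.sub hp.cont) (C := M * dy (-a) J) hp2 S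
    rw [mul_pow, dy_sq, show 2 * -a = -(2 * a) by ring] at this
    refine le_trans (Finset.sum_le_sum fun k _ => ?_) this
    split_ifs with hk
    · have e := congrFun (ofFun_sub hf.cont hp.cont) k
      rw [Pi.sub_apply, hp.supp k hk, sub_zero] at e
      rw [one_mul, ← e]
      rfl
    · rw [zero_mul]; positivity
  have e0 : 0 < 2 * (a - s) := by linarith
  calc ∑ k ∈ S, wt k ^ (2 * s) * ‖ofFun f k‖ ^ 2
      ≤ ∑ k ∈ S, W * (1 + ∑ J ∈ Finset.range N,
        dy (2 * s) J * (if D * 2 ^ J < ‖freqVec k‖ then 1 else 0)) * ‖ofFun f k‖ ^ 2 :=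
        Finset.sum_le_sum fun k hk => mul_le_mul_of_nonneg_right (pt k hk) (by positivity)
    _ = W * (∑ k ∈ S, ‖ofFun f k‖ ^ 2 + ∑ J ∈ Finset.range N, dy (2 * s) J *
          ∑ k ∈ S, (if D * 2 ^ J < ‖freqVec k‖ then 1 else 0) * ‖ofFun f k‖ ^ 2) := by
        simp only [Finset.mul_sum]
        rw [Finset.sum_comm, ← Finset.sum_add_distrib, Finset.mul_sum]
        refine Finset.sum_congr rfl fun k _ => ?_
        rw [mul_assoc, add_mul, one_mul, Finset.sum_mul]
        simp only [mul_assoc]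
    _ ≤ W * (M ^ 2 + ∑ J ∈ Finset.range N, dy (2 * s) J * (M ^ 2 * dy (-(2 * a)) J)) := by
        gcongr with J hJ
        · exact bessel hf.cont hf.bound S
        · exact dy_nonneg _ _
        · exact key J
    _ = W * (M ^ 2 + M ^ 2 * ∑ J ∈ Finset.range N, dy (-(2 * (a - s))) J) := by
        rw [Finset.mul_sum]
        congr 2
        refine Finset.sum_congr rfl fun J _ => ?_
        rw [show -(2 * (a - s)) = 2 * s + -(2 * a) by ring, ← dy_mul]; ring
    _ ≤ W * (M ^ 2 + M ^ 2 * geo (2 * (a - s))) := by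
        gcongr
        exact sum_dy_le e0 _
    _ = _ := by ring

/-! ### Distributions of negative regularity -/

/-- `|⟨Q, u⟩| ≤ C R^α ‖Q‖_{L¹}` for all `Q` of frequency at most `R`. -/
def DualBound (α C : ℝ) (u : Dist) : Prop :=
  ∀ R : ℝ, 1 ≤ R → ∀ Q, BandLim R Q → ‖pairing Q u‖ ≤ C * R ^ α * ∫ x, ‖Q x‖ ∂torusMeasure

lemma integral_norm_nonneg (Q : Torus → ℂ) : 0 ≤ ∫ x, ‖Q x‖ ∂torusMeasure :=
  integral_nonneg fun _ => norm_nonneg _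

lemma DualBound.mono {α C C' : ℝ} {u : Dist} (h : DualBound α C u) (hC : C ≤ C') :
    DualBound α C' u := fun R hR Q hQ => (h R hR Q hQ).trans (by
  have := integral_norm_nonneg Q
  gcongr)

lemma DualBound.add {α C C' : ℝ} {u w : Dist} (h : DualBound α C u) (h' : DualBound α C' w) :
    DualBound α (C + C') (u + w) := fun R hR Q hQ => by
  have e : pairing Q (u + w) = pairing Q u + pairing Q w := by
    simp only [hQ.pairing_eq, Pi.add_apply, mul_add, Finset.sum_add_distrib]
  rw [e, add_mul, add_mul]
  exact (norm_add_le _ _).trans (add_le_add (h R hR Q hQ) (h' R hR Q hQ))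

lemma DualBound.smul {α C : ℝ} {u : Dist} (h : DualBound α C u) (c : ℂ) :
    DualBound α (‖c‖ * C) (c • u) := fun R hR Q hQ => by
  have e : pairing Q (c • u) = c * pairing Q u := by
    simp only [hQ.pairing_eq, Pi.smul_apply, smul_eq_mul, Finset.mul_sum]
    exact Finset.sum_congr rfl fun k _ => by ring
  rw [e, norm_mul, mul_assoc, mul_assoc]
  refine mul_le_mul_of_nonneg_left ?_ (norm_nonneg c)
  rw [← mul_assoc]
  exact h R hR Q hQ

lemma dualBound_zero (α : ℝ) : DualBound α 0 0 := fun R _ Q hQ => by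
  simp [hQ.pairing_eq]

lemma DualBound.sum {ι : Type*} {α : ℝ} (s : Finset ι) {C : ι → ℝ} {u : ι → Dist}
    (h : ∀ i ∈ s, DualBound α (C i) (u i)) : DualBound α (∑ i ∈ s, C i) (∑ i ∈ s, u i) := by
  classical
  induction s using Finset.induction_on with
  | empty => simpa using dualBound_zero α
  | insert i s hi ih =>
    rw [Finset.sum_insert hi, Finset.sum_insert hi]
    exact (h i (Finset.mem_insert_self i s)).add
      (ih fun j hj => h j (Finset.mem_insert_of_mem hj))

lemma dualBound_ofFun {α C : ℝ} (hα : 0 ≤ α) {f : Torus → ℂ} (hf : Continuous f)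
    (h : ∀ x, ‖f x‖ ≤ C) : DualBound α C (ofFun f) := fun R hR Q hQ => by
  have hC : 0 ≤ C := (norm_nonneg _).trans (h 0)
  rw [pairing_ofFun hQ.cont hf]
  refine (norm_integral_mul_le hQ.cont hf h).trans ?_
  have := integral_norm_nonneg Q
  have h1 : 1 ≤ R ^ α := Real.one_le_rpow hR hα
  gcongr
  exact le_mul_of_one_le_right hC h1

lemma DualBound.norm_coeff_le {α C : ℝ} {u : Dist} (h : DualBound α C u) (k : Freq) :
    ‖u k‖ ≤ C * wt k ^ α := by
  have hb : BandLim (wt k) (ek (-k)) := by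
    refine ⟨continuous_ek _, fun j hj => ?_⟩
    rw [ofFun_ek, if_neg]
    rintro rfl
    rw [norm_freqVec_neg] at hj
    unfold wt at hj; linarith
  have := h (wt k) (one_le_wt k) _ hb
  have e : pairing (ek (-k)) u = u k := by
    rw [hb.pairing_eq]
    simp only [ofFun_ek, neg_inj, ite_mul, one_mul, zero_mul]
    rw [Finset.sum_ite_eq', if_pos]
    rw [mem_lball]; unfold wt; linarith
  rw [e] at this
  simpa [norm_ek] using this

lemma DualBound.sum_sq_le {α C R : ℝ} {u : Dist} (h : DualBound α C u) (hC : 0 ≤ C) (hR : 1 ≤ R)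
    (S : Finset Freq) (hS : ∀ k ∈ S, ‖freqVec k‖ ≤ R) :
    ∑ k ∈ S, ‖u k‖ ^ 2 ≤ (C * R ^ α) ^ 2 := by
  classical
  set Q : Torus → ℂ := fun x => ∑ j ∈ S.image Neg.neg, (starRingEnd ℂ) (u (-j)) * ek j x with hQ
  have hb : BandLim R Q := bandLim_trig _ _ fun k hk => by
    obtain ⟨j, hj, rfl⟩ := Finset.mem_image.1 hk
    rw [norm_freqVec_neg]; exact hS j hj
  have hco : ∀ k, ofFun Q (-k) = if k ∈ S then (starRingEnd ℂ) (u k) else 0 := by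
    intro k
    rw [hQ, ofFun_trig]
    simp
  set X := ∑ k ∈ S, ‖u k‖ ^ 2 with hX
  have hX0 : 0 ≤ X := Finset.sum_nonneg fun _ _ => by positivity
  have e1 : pairing Q u = (X : ℂ) := by
    rw [hb.pairing_eq]
    simp only [hco, ite_mul, zero_mul]
    rw [Finset.sum_ite_mem, hX, Complex.ofReal_sum, Finset.inter_eq_right.2
      fun k hk => mem_lball.2 (hS k hk)]
    refine Finset.sum_congr rfl fun k _ => ?_
    rw [Complex.conj_mul']; push_cast; rfl
  have e2 : ∫ x, ‖Q x‖ ^ 2 ∂torusMeasure = X := by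
    refine (parseval_sq hb.cont).unique ?_
    have h1 : HasSum (fun k => ‖ofFun Q (-k)‖ ^ 2) X := by
      have : ∀ k ∉ S, ‖ofFun Q (-k)‖ ^ 2 = 0 := fun k hk => by simp [hco, hk]
      have e : X = ∑ k ∈ S, ‖ofFun Q (-k)‖ ^ 2 := Finset.sum_congr rfl fun k hk => by
        rw [hco, if_pos hk, RCLike.norm_conj]
      rw [e]
      exact hasSum_sum_of_ne_finset_zero this
    exact (Equiv.neg Freq).hasSum_iff.1 h1
  have h3 := h R hR Q hb
  have h4 := integral_norm_sq_le hb.cont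
  rw [e2] at h4
  rw [e1, Complex.norm_real, Real.norm_eq_abs, abs_of_nonneg hX0] at h3
  have hI := integral_norm_nonneg Q
  have hRα : 0 ≤ C * R ^ α := mul_nonneg hC (Real.rpow_nonneg (by linarith) _)
  by_contra hlt
  rw [not_le] at hlt
  have h5 : X ^ 2 ≤ (C * R ^ α) ^ 2 * X :=
    calc X ^ 2 ≤ (C * R ^ α * ∫ x, ‖Q x‖ ∂torusMeasure) ^ 2 := by gcongr
      _ = (C * R ^ α) ^ 2 * (∫ x, ‖Q x‖ ∂torusMeasure) ^ 2 := by ring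
      _ ≤ _ := by gcongr
  have hXp : 0 < X := lt_of_le_of_lt (sq_nonneg _) hlt
  nlinarith

lemma DualBound.wBound {α C s : ℝ} {u : Dist} (h : DualBound α C u) (hC : 0 ≤ C) (hα : 0 ≤ α)
    (hs : α < s) : WBound (-s) (dy (2 * α) 1 * geo (2 * (s - α)) * C ^ 2) u := fun S => by
  classical
  set ℓ : Freq → ℕ := fun k => Nat.log 2 ⌊wt k⌋₊ with hℓ
  have h1 : ∀ k, (2 : ℝ) ^ ℓ k ≤ wt k := fun k => by
    have h0 : ⌊wt k⌋₊ ≠ 0 := by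
      rw [← Nat.one_le_iff_ne_zero, Nat.le_floor_iff (wt_pos k).le]
      exact_mod_cast one_le_wt k
    have := Nat.pow_log_le_self 2 h0
    calc (2 : ℝ) ^ ℓ k ≤ (⌊wt k⌋₊ : ℝ) := by exact_mod_cast this
      _ ≤ wt k := Nat.floor_le (wt_pos k).le
  have h2 : ∀ k, wt k ≤ (2 : ℝ) ^ (ℓ k + 1) := fun k => by
    have := Nat.lt_pow_succ_log_self one_lt_two ⌊wt k⌋₊
    have h3 : (⌊wt k⌋₊ : ℝ) + 1 ≤ 2 ^ (ℓ k + 1) := by exact_mod_cast this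
    exact (Nat.lt_floor_add_one (wt k)).le.trans h3
  have hmaps : ∀ k ∈ S, ℓ k ∈ S.image ℓ := fun k hk => Finset.mem_image_of_mem ℓ hk
  rw [← Finset.sum_fiberwise_of_maps_to hmaps]
  have ring : ∀ n, ∑ k ∈ S with ℓ k = n, wt k ^ (2 * -s) * ‖u k‖ ^ 2
      ≤ dy (2 * α) 1 * C ^ 2 * dy (-(2 * (s - α))) n := by
    intro n
    have h3 := h.sum_sq_le hC (R := 2 ^ (n + 1)) (one_le_pow₀ one_le_two) {k ∈ S | ℓ k = n}
      fun k hk => by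
        rw [Finset.mem_filter] at hk
        have := h2 k
        rw [hk.2] at this
        unfold wt at this
        linarith
    rw [pow_rpow_eq_dy, mul_pow, dy_sq, dy_add_right] at h3
    calc ∑ k ∈ S with ℓ k = n, wt k ^ (2 * -s) * ‖u k‖ ^ 2
        ≤ ∑ k ∈ S with ℓ k = n, dy (2 * -s) n * ‖u k‖ ^ 2 := by
          refine Finset.sum_le_sum fun k hk => ?_
          rw [Finset.mem_filter] at hk
          gcongr
          rw [← pow_rpow_eq_dy]
          refine Real.rpow_le_rpow_of_nonpos (by positivity) ?_ (by linarith)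
          rw [← hk.2]; exact h1 k
      _ = dy (2 * -s) n * ∑ k ∈ S with ℓ k = n, ‖u k‖ ^ 2 := by rw [Finset.mul_sum]
      _ ≤ dy (2 * -s) n * (C ^ 2 * (dy (2 * α) n * dy (2 * α) 1)) :=
          mul_le_mul_of_nonneg_left h3 (dy_nonneg _ _)
      _ = _ := by
          rw [show -(2 * (s - α)) = 2 * -s + 2 * α by ring, ← dy_mul (2 * -s)]; ring
  calc ∑ n ∈ S.image ℓ, ∑ k ∈ S with ℓ k = n, wt k ^ (2 * -s) * ‖u k‖ ^ 2
      ≤ ∑ n ∈ S.image ℓ, dy (2 * α) 1 * C ^ 2 * dy (-(2 * (s - α))) n :=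
        Finset.sum_le_sum fun n _ => ring n
    _ = dy (2 * α) 1 * C ^ 2 * ∑ n ∈ S.image ℓ, dy (-(2 * (s - α))) n := by rw [Finset.mul_sum]
    _ ≤ dy (2 * α) 1 * C ^ 2 * geo (2 * (s - α)) := by
        have := dy_nonneg (2 * α) 1
        gcongr
        exact sum_dy_le (by linarith) _
    _ = _ := by ring

/-! ### Products -/

lemma summable_mulDist {a D M α N : ℝ} {f : Torus → ℂ} {u : Dist} (hD : 0 < D) (hα : 0 < α)
    (hαa : α < a) (hf : Approx a D M f) (hu : BlockBound χ (-α) N u) (k : Freq) :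
    Summable fun l => ofFun f (k - l) * u l := by
  have h1 := (hf.wBound hD (s := (a + α) / 2) (by linarith) (by linarith)).subLeft
    (by linarith) k
  have h2 := hu.wBound (s' := -((a + α) / 2)) (by linarith)
  exact h1.summable_mul h2 le_rfl

lemma hasSum_mulDist {f : Torus → ℂ} {u : Dist} (hf : Continuous f) (k : Freq)
    (hs : Summable fun l => ofFun f (k - l) * u l) :
    HasSum (fun n => ofFun (fun x => f x * block χ n u x) k) (mulDist f u k) := by
  set g : Freq → ℂ := fun l => ofFun f (k - l) * u l with hg
  have hfib : ∀ l, HasSum (fun n => (χ.cutoff n (freqVec l) : ℂ) * g l) (g l) := fun l => by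
    have := (Complex.hasSum_ofReal.2 (hasSum_cutoff χ (freqVec l))).mul_right (g l)
    rwa [Complex.ofReal_one, one_mul] at this
  have hfibn : ∀ l, HasSum (fun n => ‖(χ.cutoff n (freqVec l) : ℂ) * g l‖) ‖g l‖ := fun l => by
    have := (hasSum_cutoff χ (freqVec l)).mul_right ‖g l‖
    rw [one_mul] at this
    refine this.congr_fun fun n => ?_
    rw [norm_mul, Complex.norm_real, Real.norm_eq_abs, abs_of_nonneg (cutoff_nonneg χ n _)]
  have hsum : Summable fun q : Freq × ℕ => (χ.cutoff q.2 (freqVec q.1) : ℂ) * g q.1 := by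
    refine Summable.of_norm ?_
    rw [summable_prod_of_nonneg fun _ => norm_nonneg _]
    refine ⟨fun l => (hfibn l).summable, ?_⟩
    simp only [fun l => (hfibn l).tsum_eq]
    exact hs.norm
  have h1 : HasSum (fun q : Freq × ℕ => (χ.cutoff q.2 (freqVec q.1) : ℂ) * g q.1)
      (mulDist f u k) := by
    have h2 := hsum.hasSum.prod_fiberwise hfib
    have := h2.unique hs.hasSum
    rw [mulDist, ← this]
    exact hsum.hasSum
  have h3 : HasSum (fun q : ℕ × Freq => (χ.cutoff q.1 (freqVec q.2) : ℂ) * g q.2)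
      (mulDist f u k) := (Equiv.prodComm ℕ Freq).hasSum_iff.2 h1
  refine h3.prod_fiberwise fun n => ?_
  have := ofFun_mul hf (continuous_block χ n u) k
  refine this.congr_fun fun l => ?_
  rw [ofFun_block, hg]; ring

lemma sum_range_dy_le {α : ℝ} (hα : 0 < α) (N : ℕ) :
    ∑ n ∈ Finset.range N, dy α n ≤ dy α N / ((2 : ℝ) ^ α - 1) := by
  have hq : 0 < (2 : ℝ) ^ α - 1 := by
    have := Real.one_lt_rpow one_lt_two hα; linarith
  induction N with
  | zero => simp [dy_zero_right, hq.le]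
  | succ N ih =>
    rw [Finset.sum_range_succ, dy_add_right]
    have e : dy α N * dy α 1 / ((2 : ℝ) ^ α - 1) = dy α N / ((2 : ℝ) ^ α - 1) + dy α N := by
      have : dy α 1 = 2 ^ α := by rw [dy_eq_pow, pow_one]
      rw [this]; field_simp; ring
    rw [e]; linarith

lemma integral_block_eq_zero {R : ℝ} {Q : Torus → ℂ} (hQ : BandLim R Q) {n : ℕ} (hn : n ≠ 0)
    (hR : R < 3 / 8 * 2 ^ n) (u : Dist) : ∫ x, Q x * block χ n u x ∂torusMeasure = 0 := by
  rw [← pairing_ofFun hQ.cont (continuous_block χ n u), pairing]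
  refine (tsum_congr fun k => ?_).trans tsum_zero
  rw [pairingTerm, ofFun_block]
  by_cases h0 : χ.cutoff n (freqVec k) = 0
  · simp [h0]
  · rw [hQ.supp, zero_mul]
    rw [norm_freqVec_neg]
    exact hR.trans_le (le_norm_of_cutoff_ne χ hn h0)

/-- The product of a function of regularity `a` and a distribution of regularity `-α`, `α < a`,
has regularity `-α`. -/
lemma exists_dualBound_mulDist {a D α : ℝ} (hD : 0 < D) (hα : 0 < α) (hαa : α < a) :
    ∃ K : ℝ, 0 ≤ K ∧ ∀ (χ : DyadicPartition) (M N : ℝ) (f : Torus → ℂ) (u : Dist),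
      Approx a D M f → BlockBound χ (-α) N u → DualBound α (K * (M * N)) (mulDist f u) := by
  obtain ⟨c, hc⟩ := pow_unbounded_of_one_lt (16 * D) (one_lt_two (α := ℝ))
  have hq : 0 < (2 : ℝ) ^ α - 1 := by
    have := Real.one_lt_rpow one_lt_two hα; linarith
  have hg := geo_pos (ε := a - α) (by linarith)
  refine ⟨8 ^ α / ((2 : ℝ) ^ α - 1) + dy a c * geo (a - α),
    add_nonneg (div_nonneg (by positivity) hq.le) (mul_nonneg (dy_nonneg _ _) hg.le), ?_⟩
  intro χ M N f u hf hu R hR Q hQ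
  have hM := hf.nonneg
  have hN := hu.nonneg
  set I := ∫ x, ‖Q x‖ ∂torusMeasure with hI
  have hI0 : 0 ≤ I := integral_norm_nonneg Q
  have hsum : HasSum (fun n => ∫ x, Q x * (f x * block χ n u x) ∂torusMeasure)
      (pairing Q (mulDist f u)) := by
    rw [hQ.pairing_eq]
    have h1 := hasSum_sum fun k (_ : k ∈ lball R) =>
      (hasSum_mulDist (χ := χ) hf.cont k (summable_mulDist hD hα hαa hf hu k)).mul_left
        (ofFun Q (-k))
    refine h1.congr_fun fun n => ?_
    rw [← pairing_ofFun hQ.cont (hf.cont.fun_mul (continuous_block χ n u)), hQ.pairing_eq]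
  have hub : ∀ n x, ‖block χ n u x‖ ≤ N * dy α n := fun n x => by
    have := hu n x; rwa [neg_neg] at this
  have low : ∀ n, ‖∫ x, Q x * (f x * block χ n u x) ∂torusMeasure‖ ≤ M * N * I * dy α n := by
    intro n
    refine (norm_integral_mul_le hQ.cont (hf.cont.mul (continuous_block χ n u))
      (C := M * (N * dy α n)) fun x => ?_).trans (le_of_eq (by ring))
    rw [Pi.mul_apply, norm_mul]
    gcongr
    exacts [hf.bound x, hub n x]
  have high : ∀ n, 4 * R ≤ 2 ^ n → ‖∫ x, Q x * (f x * block χ n u x) ∂torusMeasure‖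
      ≤ M * N * I * dy a c * dy (-(a - α)) n := by
    intro n hn
    rcases le_total n c with hnc | hnc
    · refine (low n).trans ?_
      have e : dy α n = dy a n * dy (-(a - α)) n := by rw [dy_mul]; congr 1; ring
      rw [e, ← mul_assoc]
      gcongr
      · exact dy_nonneg _ _
      · exact Real.rpow_le_rpow_of_exponent_le one_le_two
          (mul_le_mul_of_nonneg_left (by exact_mod_cast hnc) (by linarith))
    · obtain ⟨J, rfl⟩ := Nat.exists_eq_add_of_le' hnc
      obtain ⟨p, hp, hp2⟩ := hf.approx J
      have hn0 : J + c ≠ 0 := by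
        intro h0; rw [h0, pow_zero] at hn; linarith
      have z := integral_block_eq_zero (χ := χ) (hQ.mul hp) hn0 (by
        have h1 : D * 2 ^ J ≤ 2 ^ (J + c) / 16 := by
          rw [pow_add]
          have : (0 : ℝ) < 2 ^ J := by positivity
          nlinarith
        have : (0 : ℝ) < 2 ^ (J + c) := by positivity
        linarith) u
      have e : ∫ x, Q x * (f x * block χ (J + c) u x) ∂torusMeasure
          = ∫ x, Q x * ((f x - p x) * block χ (J + c) u x) ∂torusMeasure := by
        have hb := continuous_block χ (J + c) u
        rw [← sub_zero (∫ x, Q x * (f x * block χ (J + c) u x) ∂torusMeasure), ← z,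
          ← integral_sub (integrable_of_continuous (hQ.cont.fun_mul (hf.cont.fun_mul hb)))
            (integrable_of_continuous ((hQ.cont.fun_mul hp.cont).fun_mul hb))]
        congr 1; ext x; ring
      rw [e]
      refine (norm_integral_mul_le hQ.cont
        ((hf.cont.sub hp.cont).mul (continuous_block χ (J + c) u))
        (C := M * dy (-a) J * (N * dy α (J + c))) fun x => ?_).trans (le_of_eq ?_)
      · rw [Pi.mul_apply, norm_mul]
        have := dy_nonneg (-a) J
        gcongr
        exacts [hp2 x, hub _ x]
      · have e3 : dy (-(a - α)) (J + c) * dy a c = dy (-a) J * dy α (J + c) := by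
          rw [show -(a - α) = -a + α by ring, ← dy_mul, dy_add_right (-a)]
          have : dy (-a) c * dy a c = 1 := by rw [dy_mul, neg_add_cancel, dy_zero_left]
          calc _ = dy (-a) J * dy α (J + c) * (dy (-a) c * dy a c) := by ring
            _ = _ := by rw [this, mul_one]
        calc M * dy (-a) J * (N * dy α (J + c)) * I
            = M * N * I * (dy (-a) J * dy α (J + c)) := by ring
          _ = _ := by rw [← e3]; ring
  have hex : ∃ n : ℕ, 4 * R ≤ 2 ^ n := by
    obtain ⟨n, hn⟩ := pow_unbounded_of_one_lt (4 * R) (one_lt_two (α := ℝ))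
    exact ⟨n, hn.le⟩
  have hspec := Nat.find_spec hex
  have hmin := fun i => Nat.find_min hex (m := i)
  generalize Nat.find hex = n₀ at hspec hmin
  have hn₀ : (2 : ℝ) ^ n₀ ≤ 8 * R := by
    rcases n₀ with _ | j
    · rw [pow_zero]; linarith
    · have := hmin j (Nat.lt_succ_self j)
      rw [not_le] at this
      rw [pow_succ]; linarith
  have hbd : HasSum (fun n => (if n ∈ Finset.range n₀ then M * N * I * dy α n else 0)
      + M * N * I * dy a c * dy (-(a - α)) n)
      (∑ n ∈ Finset.range n₀, (if n ∈ Finset.range n₀ then M * N * I * dy α n else 0)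
        + M * N * I * dy a c * geo (a - α)) :=
    (hasSum_sum_of_ne_finset_zero fun n hn => if_neg hn).add
      ((hasSum_dy (by linarith)).mul_left _)
  have hpos : ∀ n, 0 ≤ M * N * I * dy a c * dy (-(a - α)) n := fun n => by
    have h1 := dy_nonneg a c
    have h2 := dy_nonneg (-(a - α)) n
    positivity
  have hfin := tsum_of_norm_bounded hbd fun n => by
    show ‖∫ x, Q x * (f x * block χ n u x) ∂torusMeasure‖ ≤ _
    split_ifs with h
    · exact (low n).trans (le_add_of_nonneg_right (hpos n))
    · rw [zero_add]
      rw [Finset.mem_range, not_lt] at h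
      exact high n (hspec.trans (pow_le_pow_right₀ one_le_two h))
  rw [hsum.tsum_eq] at hfin
  refine hfin.trans ?_
  rw [Finset.sum_ite_mem, Finset.inter_self, ← Finset.mul_sum]
  have h8 : dy α n₀ ≤ 8 ^ α * R ^ α := by
    rw [← pow_rpow_eq_dy, ← Real.mul_rpow (by norm_num) (by linarith)]
    exact Real.rpow_le_rpow (by positivity) hn₀ hα.le
  have hs1 : ∑ n ∈ Finset.range n₀, dy α n ≤ 8 ^ α * R ^ α / ((2 : ℝ) ^ α - 1) :=
    (sum_range_dy_le hα n₀).trans (by gcongr)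
  have hR1 : 1 ≤ R ^ α := Real.one_le_rpow hR hα.le
  calc M * N * I * ∑ n ∈ Finset.range n₀, dy α n + M * N * I * dy a c * geo (a - α)
      ≤ M * N * I * (8 ^ α * R ^ α / ((2 : ℝ) ^ α - 1))
        + M * N * I * dy a c * geo (a - α) * R ^ α := by
        have h1 := dy_nonneg a c
        exact add_le_add (by gcongr) (le_mul_of_one_le_right (by positivity) hR1)
    _ = _ := by ring

end

section

variable {χ : DyadicPartition}

lemma Approx.mono {a D D' M M' : ℝ} {f : Torus → ℂ} (h : Approx a D M f) (hD : D ≤ D')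
    (hM : M ≤ M') : Approx a D' M' f :=
  ⟨h.cont, fun x => (h.bound x).trans hM, fun J => by
    obtain ⟨p, hp, hp2⟩ := h.approx J
    exact ⟨p, hp.mono (by gcongr), fun x =>
      (hp2 x).trans (mul_le_mul_of_nonneg_right hM (dy_nonneg _ _))⟩⟩

lemma mulDist_one (u : Dist) : mulDist (fun _ => 1) u = u := by
  ext k
  rw [mulDist, tsum_eq_single k]
  · simp [ofFun_one]
  · intro l hl
    rw [ofFun_one, if_neg, zero_mul]
    exact sub_ne_zero.2 hl.symm

lemma blockBound_one {α : ℝ} (hα : 0 ≤ α) : BlockBound χ (-α) 1 (ofFun fun _ => 1) := fun n x => by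
  have e : block χ n (ofFun fun _ => 1) x = χ.cutoff n (freqVec 0) := by
    rw [block, tsum_eq_single 0]
    · simp [ofFun_one, UnitAddTorus.mFourier_zero]
    · intro k hk
      rw [ofFun_one, if_neg hk]; simp
  rw [e, Complex.norm_real, Real.norm_eq_abs, abs_of_nonneg (cutoff_nonneg χ n _), one_mul, neg_neg]
  refine (cutoff_le_one χ n _).trans ?_
  have := dy_mono hα n
  rwa [dy_zero_left] at this

/-! ### Bounds for the data -/

/-- The standing assumptions. -/
structure Setting (χ : DyadicPartition) (m : ℕ) (μ : ℝ) (ν τ : ℂ) (D : DrivingData)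
    (β γ T : ℝ) (u₀ : Dist) (v : ℝ → Torus → ℂ) : Prop where
  hμ : 0 < μ
  hT : 0 < T
  hD : D.Admissible χ m T
  hβ : 0 < β
  hγ : 0 < γ
  hγ' : γ * (2 * m + 1) < 1
  hv : IsMildSolution χ m μ ν τ D β γ T u₀ v

lemma ENNReal_le_of_mul_le {x A : ℝ} {b : ℝ≥0∞} (hx : 0 < x)
    (h : ENNReal.ofReal x * b ≤ ENNReal.ofReal A) : b ≤ ENNReal.ofReal (x⁻¹ * A) := by
  rw [ENNReal.ofReal_mul (inv_nonneg.2 hx.le), ENNReal.ofReal_inv_of_pos hx]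
  exact (ENNReal.mul_le_iff_le_inv (by simp [hx]) (by simp)).1 h

section Bounds

variable {m : ℕ} {μ : ℝ} {ν τ : ℂ} {D : DrivingData} {β γ T : ℝ} {u₀ : Dist}
  {v : ℝ → Torus → ℂ}

lemma Setting.exists_blockBound_sol (H : Setting χ m μ ν τ D β γ T u₀ v)
    : ∃ B : ℝ, 0 ≤ B ∧ ∀ t ∈ Set.Ioc 0 T,
    BlockBound χ β (B * t ^ (-γ)) (ofFun (v t)) := by
  have hb := H.hv.bound
  set A := (⨆ t ∈ Set.Ioc (0 : ℝ) T, ENNReal.ofReal (t ^ γ) * besovNorm χ β (ofFun (v t)))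
  refine ⟨2 ^ β * A.toReal, by positivity, fun t ht => ?_⟩
  have h1 : ENNReal.ofReal (t ^ γ) * besovNorm χ β (ofFun (v t)) ≤ ENNReal.ofReal A.toReal := by
    rw [ENNReal.ofReal_toReal hb.ne]
    exact le_iSup₂ (f := fun t (_ : t ∈ Set.Ioc (0 : ℝ) T) =>
      ENNReal.ofReal (t ^ γ) * besovNorm χ β (ofFun (v t))) t ht
  have hpos : 0 < t ^ γ := Real.rpow_pos_of_pos ht.1 _
  have := blockBound_of_besovNorm (by positivity) (ENNReal_le_of_mul_le hpos h1)
  rw [Real.rpow_neg ht.1.le]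
  convert this using 1; ring

lemma one_le_mul_rpow {γ T t : ℝ} (hγ : 0 < γ) (ht : t ∈ Set.Ioc 0 T) :
    1 ≤ T ^ γ * t ^ (-γ) := by
  rw [Real.rpow_neg ht.1.le, ← div_eq_mul_inv, one_le_div (Real.rpow_pos_of_pos ht.1 _)]
  exact Real.rpow_le_rpow ht.1.le ht.2 hγ.le

lemma Setting.exists_blockBound_wick (H : Setting χ m μ ν τ D β γ T u₀ v)
    {α : ℝ} (hα : α ∈ Set.Ioo (0 : ℝ) 1) :
    ∃ C : ℝ, 0 ≤ C ∧ ∀ t ∈ Set.Ioc 0 T, ∀ k l, k ≤ m + 1 → l ≤ m →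
      BlockBound χ (-α) (C * (t ^ (-γ)) ^ (k + l)) (D.wick k l t) := by
  have hγ1 : γ < 1 := by
    have := H.hγ'
    have h2 : (0 : ℝ) ≤ γ * (2 * m) := by have := H.hγ; positivity
    linarith
  have hn := (H.hD α hα).2.2 γ ⟨H.hγ, hγ1⟩
  set A := (D.norm χ m α γ T).toReal with hA
  have hA0 : 0 ≤ A := ENNReal.toReal_nonneg
  have hAe : D.norm χ m α γ T = ENNReal.ofReal A := (ENNReal.ofReal_toReal hn.ne).symm
  have hTγ : 0 < T ^ γ := Real.rpow_pos_of_pos H.hT _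
  have h2 : (0 : ℝ) < 2 ^ (-α) := by positivity
  have hZ : ∀ t ∈ Set.Ioc 0 T,
      BlockBound χ (-α) ((1 + 2 ^ (-α) * A * T ^ γ) * (t ^ (-γ)) ^ 1) (D.Z t) := by
    intro t ht
    have h1 : besovNorm χ (-α) (D.Z t) ≤ ENNReal.ofReal A := by
      rw [← hAe]
      refine le_trans ?_ le_sup_left
      exact le_iSup₂ (f := fun t (_ : t ∈ Set.Icc (0 : ℝ) T) => besovNorm χ (-α) (D.Z t)) t
        ⟨ht.1.le, ht.2⟩
    refine (blockBound_of_besovNorm hA0 h1).mono ?_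
    have h3 := one_le_mul_rpow H.hγ ht
    have h4 : 0 < t ^ (-γ) := Real.rpow_pos_of_pos ht.1 _
    rw [pow_one]
    have h5 : 2 ^ (-α) * A ≤ 2 ^ (-α) * A * (T ^ γ * t ^ (-γ)) :=
      le_mul_of_one_le_right (by positivity) h3
    nlinarith
  have hW : ∀ t ∈ Set.Ioc 0 T, ∀ q ∈ indexSet m,
      BlockBound χ (-α) ((1 + 2 ^ (-α) * A * T ^ γ) * (t ^ (-γ)) ^ (q.1 + q.2))
        (D.W q.1 q.2 t) := by
    intro t ht q hq
    have hpos : 0 < t ^ (((q.1 : ℝ) + q.2 - 1) * γ) := Real.rpow_pos_of_pos ht.1 _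
    have h1 : ENNReal.ofReal (t ^ (((q.1 : ℝ) + q.2 - 1) * γ)) *
        besovNorm χ (-α) (D.W q.1 q.2 t) ≤ ENNReal.ofReal A := by
      rw [← hAe]
      refine le_trans ?_ le_sup_right
      refine le_trans ?_ (le_iSup₂ (f := fun t (_ : t ∈ Set.Ioc (0 : ℝ) T) =>
        ⨆ q ∈ indexSet m, ENNReal.ofReal (t ^ (((q.1 : ℝ) + q.2 - 1) * γ)) *
          besovNorm χ (-α) (D.W q.1 q.2 t)) t ht)
      exact le_iSup₂ (f := fun q (_ : q ∈ indexSet m) =>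
        ENNReal.ofReal (t ^ (((q.1 : ℝ) + q.2 - 1) * γ)) *
          besovNorm χ (-α) (D.W q.1 q.2 t)) q hq
    refine (blockBound_of_besovNorm (by positivity) (ENNReal_le_of_mul_le hpos h1)).mono ?_
    have h3 := one_le_mul_rpow H.hγ ht
    have h4 : 0 < t ^ (-γ) := Real.rpow_pos_of_pos ht.1 _
    have e : (t ^ (((q.1 : ℝ) + q.2 - 1) * γ))⁻¹ = (t ^ (-γ)) ^ (q.1 + q.2) * t ^ γ := by
      rw [← Real.rpow_neg ht.1.le, ← Real.rpow_mul_natCast ht.1.le, ← Real.rpow_add ht.1]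
      congr 1; push_cast; ring
    rw [e]
    have h5 : t ^ γ ≤ T ^ γ := Real.rpow_le_rpow ht.1.le ht.2 H.hγ.le
    have h6 : (0 : ℝ) < (t ^ (-γ)) ^ (q.1 + q.2) := by positivity
    calc 2 ^ (-α) * ((t ^ (-γ)) ^ (q.1 + q.2) * t ^ γ * A)
        ≤ 2 ^ (-α) * ((t ^ (-γ)) ^ (q.1 + q.2) * T ^ γ * A) := by gcongr
      _ ≤ _ := by nlinarith
  refine ⟨1 + 2 ^ (-α) * A * T ^ γ, by positivity, fun t ht k l hk hl => ?_⟩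
  have h4 : 0 < t ^ (-γ) := Real.rpow_pos_of_pos ht.1 _
  unfold DrivingData.wick
  split_ifs with h0 h1 h3 h3
  · have : k + l = 0 := h0
    rw [this, pow_zero, mul_one]
    exact (blockBound_one hα.1.le).mono (le_add_of_nonneg_right (by positivity))
  · rw [h3]; exact hZ t ht
  · exact hW t ht (k, l) ⟨hk, hl, h1, by simp only; omega⟩
  · rw [h3]; exact (hZ t ht).conj
  · have := (hW t ht (l, k) ⟨by simp only; omega, by simp only; omega, by simp only; omega,
      by simp only; omega⟩).conj
    rwa [Nat.add_comm l k] at this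

lemma Setting.exists_approx_monomial (H : Setting χ m μ ν τ D β γ T u₀ v)
    : ∃ B : ℝ, 0 ≤ B ∧ ∀ t ∈ Set.Ioc 0 T, ∀ i j : ℕ,
    i ≤ m + 1 → j ≤ m →
    Approx β (4 / 3 * (2 * m + 1)) (B * (t ^ (-γ)) ^ (i + j)) (monomial i j (v t)) := by
  obtain ⟨B, hB, h⟩ := H.exists_blockBound_sol
  have hg := geo_pos H.hβ
  refine ⟨3 * (3 * (B * geo β) + 1) ^ (2 * m + 1), by positivity, fun t ht i j hi hj => ?_⟩
  have h1 := ((h t ht).approx H.hβ (H.hv.continuous t ht)).monomial H.hβ.le i j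
  have h4 : 0 < t ^ (-γ) := Real.rpow_pos_of_pos ht.1 _
  refine h1.mono ?_ ?_
  · have : (i : ℝ) + j ≤ 2 * m + 1 := by
      have : i + j ≤ 2 * m + 1 := by omega
      exact_mod_cast this
    linarith
  · have e : 3 * (3 * (B * t ^ (-γ) * geo β)) ^ (i + j)
        = 3 * (3 * (B * geo β)) ^ (i + j) * (t ^ (-γ)) ^ (i + j) := by
      rw [mul_assoc 3 _ ((t ^ (-γ)) ^ (i + j)), ← mul_pow]; ring
    rw [e]
    gcongr 3 * ?_ * _
    calc (3 * (B * geo β)) ^ (i + j) ≤ (3 * (B * geo β) + 1) ^ (i + j) := by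
          gcongr; linarith
      _ ≤ _ := pow_le_pow_right₀ (by have : 0 ≤ 3 * (B * geo β) := by positivity
                                     linarith) (by omega)

lemma Setting.exists_bound_sol (H : Setting χ m μ ν τ D β γ T u₀ v)
    : ∃ B : ℝ, 0 ≤ B ∧ ∀ t ∈ Set.Ioc 0 T, ∀ x,
    ‖v t x‖ ≤ B * t ^ (-γ) := by
  obtain ⟨B, hB, h⟩ := H.exists_blockBound_sol
  have hg := geo_pos H.hβ
  refine ⟨B * geo β, by positivity, fun t ht x => ?_⟩
  have := ((h t ht).approx H.hβ (H.hv.continuous t ht)).bound x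
  linarith

lemma Setting.exists_dualBound_Psi (H : Setting χ m μ ν τ D β γ T u₀ v)
    {α : ℝ} (hα : α ∈ Set.Ioo (0 : ℝ) 1) (hαβ : α < β) :
    ∃ C : ℝ, 0 ≤ C ∧ ∀ t ∈ Set.Ioc 0 T,
      DualBound α (C * (t ^ (-γ)) ^ (2 * m + 1)) (Psi m ν τ D (v t) t) := by
  obtain ⟨K, hK, hprod⟩ := exists_dualBound_mulDist (a := β) (D := 4 / 3 * (2 * m + 1))
    (by positivity) hα.1 hαβ
  obtain ⟨B, hB, hB2⟩ := H.exists_approx_monomial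
  obtain ⟨C, hC, hC2⟩ := H.exists_blockBound_wick hα
  obtain ⟨B', hB', hB2'⟩ := H.exists_bound_sol
  have hTγ : 0 < T ^ γ := Real.rpow_pos_of_pos H.hT _
  refine ⟨‖-ν‖ * (∑ i ∈ Finset.range (m + 2), ∑ j ∈ Finset.range (m + 1),
    ‖((m + 1).choose i : ℂ) * (m.choose j : ℂ)‖ * (K * (B * C)))
    + ‖τ + 1‖ * ((B' + K * C) * (T ^ γ) ^ (2 * m)), by positivity, fun t ht => ?_⟩
  have h4 : 0 < t ^ (-γ) := Real.rpow_pos_of_pos ht.1 _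
  set lam := t ^ (-γ) with hlam
  rw [add_mul, mul_assoc ‖-ν‖, mul_assoc ‖τ + 1‖, Finset.sum_mul]
  refine DualBound.add (DualBound.smul ?_ _) (DualBound.smul ?_ _)
  · refine DualBound.sum _ fun i hi => ?_
    rw [Finset.sum_mul]
    refine DualBound.sum _ fun j hj => ?_
    rw [Finset.mem_range] at hi hj
    rw [mul_assoc]
    refine DualBound.smul ?_ _
    refine (hprod χ _ _ _ _ (hB2 t ht i j (by omega) (by omega))
      (hC2 t ht (m + 1 - i) (m - j) (by omega) (by omega))).mono (le_of_eq ?_)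
    have : 2 * m + 1 = (i + j) + ((m + 1 - i) + (m - j)) := by omega
    rw [this, pow_add lam (i + j)]; ring
  · have hl : lam ≤ (T ^ γ) ^ (2 * m) * lam ^ (2 * m + 1) := by
      rw [pow_succ, ← mul_assoc, ← mul_pow]
      exact le_mul_of_one_le_left h4.le (one_le_pow₀ (one_le_mul_rpow H.hγ ht))
    have h1 := dualBound_ofFun hα.1.le (H.hv.continuous t ht) (hB2' t ht)
    have h2 := hprod χ 1 _ _ _ ((approx_one β).mono (by positivity) le_rfl)
      (hC2 t ht 1 0 (by omega) (by omega))
    rw [mulDist_one, show D.wick 1 0 t = D.Z t from by simp [DrivingData.wick]] at h2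
    refine (h1.add h2).mono ?_
    have : B' * lam + K * (1 * (C * lam ^ (1 + 0))) = (B' + K * C) * lam := by
      simp; ring
    rw [this, mul_assoc]
    gcongr

end Bounds

/-! ### Continuity in time -/

lemma exists_norm_coeff_le (χ : DyadicPartition) (a : ℝ) (k : Freq) :
    ∃ c : ℝ, 0 ≤ c ∧ ∀ u : Dist, besovNorm χ a u ≠ ⊤ →
      ‖u k‖ ≤ c * (besovNorm χ a u).toReal := by
  refine ⟨√(wt k ^ (-(2 * (a - 1))) * ((4 : ℝ) ^ |2 * (a - 1)| * geo (a - (a - 1)) ^ 2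
    * (2 ^ a) ^ 2)), by positivity, fun u hu => ?_⟩
  have hw := wt_pos k
  have h1 := blockBound_of_besovNorm ENNReal.toReal_nonneg (ENNReal.ofReal_toReal hu).ge
  have h2 := (h1.wBound (s' := a - 1) (by linarith)).norm_sq_le k
  refine abs_le_of_sq_le_sq' ?_ (by positivity) |>.2
  rw [mul_pow, Real.sq_sqrt (by positivity)]
  refine h2.trans (le_of_eq ?_)
  rw [mul_pow]; ring

lemma tendsto_coeff {a : ℝ} {u : ℝ → Dist} {I : Set ℝ} (h : ContBesovOn χ a u I) (k : Freq) :
    ContinuousOn (fun t => u t k) I := by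
  intro t ht
  obtain ⟨c, hc, hc2⟩ := exists_norm_coeff_le χ a k
  have h1 := h.2 t ht
  have h2 : Tendsto (fun s => c * (besovNorm χ a (u s - u t)).toReal) (𝓝[I] t) (𝓝 (c * 0)) :=
    ((ENNReal.tendsto_toReal ENNReal.zero_ne_top).comp h1).const_mul c
  rw [mul_zero] at h2
  refine tendsto_iff_norm_sub_tendsto_zero.2 (squeeze_zero' (Eventually.of_forall
    fun _ => norm_nonneg _) ?_ h2)
  filter_upwards [h1.eventually (gt_mem_nhds ENNReal.zero_lt_top)] with s hs
  exact hc2 (u s - u t) hs.ne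

lemma tendsto_ofFun {X : Type*} {F : Filter X} [F.IsCountablyGenerated] {f : X → Torus → ℂ}
    {f₀ : Torus → ℂ} {M : ℝ} (hf : ∀ᶠ s in F, Continuous (f s)) (hb : ∀ᶠ s in F, ∀ x, ‖f s x‖ ≤ M)
    (hl : ∀ x, Tendsto (fun s => f s x) F (𝓝 (f₀ x))) (k : Freq) :
    Tendsto (fun s => ofFun (f s) k) F (𝓝 (ofFun f₀ k)) := by
  simp only [ofFun_apply]
  refine tendsto_integral_filter_of_dominated_convergence (fun _ => M) ?_ ?_ (integrable_const _) ?_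
  · filter_upwards [hf] with s hs
    exact (integrable_of_continuous ((continuous_ek _).mul hs)).1
  · filter_upwards [hb] with s hs
    refine Eventually.of_forall fun x => ?_
    rw [norm_mul, norm_ek, one_mul]; exact hs x
  · exact Eventually.of_forall fun x => (hl x).const_mul _

section Cont

variable {m : ℕ} {μ : ℝ} {ν τ : ℂ} {D : DrivingData} {β γ T : ℝ} {u₀ : Dist}
  {v : ℝ → Torus → ℂ}

lemma Setting.continuousOn_sol (H : Setting χ m μ ν τ D β γ T u₀ v)
    (x : Torus) : ContinuousOn (fun t => v t x) (Set.Ioc 0 T) := by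
  intro t ht
  have h1 := H.hv.cont.2 t ht
  have h2 : Tendsto (fun s => 2 ^ β * (besovNorm χ β (ofFun (v s) - ofFun (v t))).toReal * geo β)
      (𝓝[Set.Ioc 0 T] t) (𝓝 (2 ^ β * 0 * geo β)) :=
    (((ENNReal.tendsto_toReal ENNReal.zero_ne_top).comp h1).const_mul _).mul_const _
  rw [mul_zero, zero_mul] at h2
  refine tendsto_iff_norm_sub_tendsto_zero.2 (squeeze_zero' (Eventually.of_forall
    fun _ => norm_nonneg _) ?_ h2)
  filter_upwards [h1.eventually (gt_mem_nhds ENNReal.zero_lt_top), self_mem_nhdsWithin] with s hs hsT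
  have h3 := blockBound_of_besovNorm ENNReal.toReal_nonneg (ENNReal.ofReal_toReal hs.ne).ge
  rw [← ofFun_sub (H.hv.continuous s hsT) (H.hv.continuous t ht)] at h3 ⊢
  exact (h3.approx H.hβ ((H.hv.continuous s hsT).sub (H.hv.continuous t ht))).bound x

lemma Setting.continuousOn_wick (H : Setting χ m μ ν τ D β γ T u₀ v)
    (k l : ℕ) (hk : k ≤ m + 1) (hl : l ≤ m) (q : Freq) :
    ContinuousOn (fun t => D.wick k l t q) (Set.Ioc 0 T) := by
  have hA := H.hD (1 / 2) ⟨by norm_num, by norm_num⟩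
  have hZ : ∀ q, ContinuousOn (fun t => D.Z t q) (Set.Ioc 0 T) := fun q =>
    (tendsto_coeff hA.1 q).mono Set.Ioc_subset_Icc_self
  unfold DrivingData.wick
  by_cases h0 : k + l = 0
  · simp only [h0, if_true]; exact continuousOn_const
  by_cases h1 : l ≤ k
  · by_cases h3 : k + l = 1
    · simp only [h1, h3, if_true, one_ne_zero, if_false]; exact hZ q
    · simp only [h0, h1, h3, if_true, if_false]
      exact tendsto_coeff (hA.2.1 (k, l) ⟨hk, hl, h1, by simp only; omega⟩) q
  · by_cases h3 : k + l = 1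
    · simp only [h1, h3, if_true, one_ne_zero, if_false, conjDist]
      exact Complex.continuous_conj.comp_continuousOn (hZ (-q))
    · simp only [h0, h1, h3, if_false, conjDist]
      exact Complex.continuous_conj.comp_continuousOn (tendsto_coeff (hA.2.1 (l, k)
        ⟨by simp only; omega, by simp only; omega, by simp only; omega, by simp only; omega⟩) (-q))

lemma eventually_half_le {T t : ℝ} (ht : 0 < t) :
    ∀ᶠ s in 𝓝[Set.Ioc 0 T] t, s ∈ Set.Ioc 0 T ∧ t / 2 ≤ s := by
  filter_upwards [self_mem_nhdsWithin,
    mem_nhdsWithin_of_mem_nhds (Ici_mem_nhds (show t / 2 < t by linarith))] with s h1 h2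
  exact ⟨h1, h2⟩

lemma Setting.continuousOn_mulDist (H : Setting χ m μ ν τ D β γ T u₀ v)
    (i j k l : ℕ) (hi : i ≤ m + 1) (hj : j ≤ m) (hk : k ≤ m + 1)
    (hl : l ≤ m) (q : Freq) :
    ContinuousOn (fun t => mulDist (monomial i j (v t)) (D.wick k l t) q) (Set.Ioc 0 T) := by
  intro t ht
  set α := min β 1 / 4 with hα
  have hβ := H.hβ
  have hα0 : 0 < α := by positivity
  have h4β : 4 * α ≤ β := by rw [hα]; linarith [min_le_left β 1]
  have h4 : 4 * α ≤ 1 := by rw [hα]; linarith [min_le_right β 1]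
  obtain ⟨B, hB, hB2⟩ := H.exists_approx_monomial
  obtain ⟨C, hC, hC2⟩ := H.exists_blockBound_wick (α := α) ⟨hα0, by linarith⟩
  have ht0 := ht.1
  have hl' : ∀ s, t / 2 ≤ s → s ^ (-γ) ≤ (t / 2) ^ (-γ) := fun s hs =>
    Real.rpow_le_rpow_of_nonpos (by linarith) hs (by linarith [H.hγ])
  have hD0 : (0 : ℝ) < 4 / 3 * (2 * m + 1) := by positivity
  refine tendsto_tsum_mul (a := 3 * α) (b := 2 * α) (by linarith)
    (u := fun s l => ofFun (monomial i j (v s)) (q - l)) (w := fun s => D.wick k l s) ?_ ?_ ?_ ?_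
    (M := wt q ^ (2 * (3 * α)) * ((1 + 2 * (4 / 3 * (2 * (m : ℝ) + 1))) ^ (2 * (3 * α)) *
      (1 + geo (2 * (β - 3 * α))) * (B * ((t / 2) ^ (-γ)) ^ (i + j)) ^ 2))
    (M' := (4 : ℝ) ^ |2 * (-(2 * α))| * geo (-α - -(2 * α)) ^ 2 *
      (C * ((t / 2) ^ (-γ)) ^ (k + l)) ^ 2)
  · filter_upwards [eventually_half_le ht.1] with s hs
    have hs0 : 0 < s := hs.1.1
    refine WBound.subLeft ?_ (by linarith) q
    refine ((hB2 s hs.1 i j hi hj).wBound hD0 (by linarith) (by linarith)).mono ?_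
    have hg := geo_pos (ε := 2 * (β - 3 * α)) (by linarith)
    have := hl' s hs.2
    gcongr
  · filter_upwards [eventually_half_le ht.1] with s hs
    have hs0 : 0 < s := hs.1.1
    refine ((hC2 s hs.1 k l hk hl).wBound (s' := -(2 * α)) (by linarith)).mono ?_
    have := hl' s hs.2
    gcongr
  · intro p
    refine tendsto_ofFun (M := B * ((t / 2) ^ (-γ)) ^ (i + j)) ?_ ?_ ?_ (q - p)
    · filter_upwards [self_mem_nhdsWithin] with s hs using (hB2 s hs i j hi hj).cont
    · filter_upwards [eventually_half_le ht.1] with s hs x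
      have hs0 : 0 < s := hs.1.1
      refine ((hB2 s hs.1 i j hi hj).bound x).trans ?_
      have := hl' s hs.2
      gcongr
    · intro x
      have h1 : Tendsto (fun s => v s x) (𝓝[Set.Ioc 0 T] t) (𝓝 (v t x)) :=
        H.continuousOn_sol x t ht
      exact (h1.pow i).mul (((Complex.continuous_conj.tendsto _).comp h1).pow j)
  · exact fun p => H.continuousOn_wick k l hk hl p t ht

lemma Setting.continuousOn_Psi (H : Setting χ m μ ν τ D β γ T u₀ v) (q : Freq) :
    ContinuousOn (fun t => Psi m ν τ D (v t) t q) (Set.Ioc 0 T) := by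
  have hA := H.hD (1 / 2) ⟨by norm_num, by norm_num⟩
  have e : (fun t => Psi m ν τ D (v t) t q) = fun t => (-ν) * (∑ i ∈ Finset.range (m + 2),
      ∑ j ∈ Finset.range (m + 1), (((m + 1).choose i : ℂ) * (m.choose j : ℂ)) *
        mulDist (monomial i j (v t)) (D.wick (m + 1 - i) (m - j) t) q)
      + (τ + 1) * (ofFun (v t) q + D.Z t q) := by
    ext t
    simp only [Psi, Pi.add_apply, Pi.smul_apply, Finset.sum_apply, smul_eq_mul]
  rw [e]
  refine ContinuousOn.add (continuousOn_const.mul (continuousOn_finsetSum _ fun i hi =>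
    continuousOn_finsetSum _ fun j hj => continuousOn_const.mul ?_))
    (continuousOn_const.mul (ContinuousOn.add (tendsto_coeff H.hv.cont q)
      ((tendsto_coeff hA.1 q).mono Set.Ioc_subset_Icc_self)))
  rw [Finset.mem_range] at hi hj
  exact H.continuousOn_mulDist i j _ _ (by omega) (by omega) (by omega) (by omega) q

end Cont

end

section

variable {χ : DyadicPartition}

/-! ### The Duhamel formula -/

/-- The symbol `1 + 4π²(i+μ)|k|²` of `1 - (i+μ)Δ`. -/
def symb (μ : ℝ) (k : Freq) : ℂ :=
  1 + 4 * (Real.pi : ℂ) ^ 2 * (Complex.I + (μ : ℂ)) * ((‖freqVec k‖ ^ 2 : ℝ) : ℂ)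

lemma symb_re (μ : ℝ) (k : Freq) : (symb μ k).re = 1 + 4 * Real.pi ^ 2 * μ * ‖freqVec k‖ ^ 2 := by
  have : symb μ k = ((1 + 4 * Real.pi ^ 2 * μ * ‖freqVec k‖ ^ 2 : ℝ) : ℂ)
      + ((4 * Real.pi ^ 2 * ‖freqVec k‖ ^ 2 : ℝ) : ℂ) * Complex.I := by
    unfold symb; push_cast; ring
  rw [this]; simp only [Complex.add_re, Complex.re_ofReal_mul, Complex.ofReal_re, Complex.I_re]
  ring

lemma symb_re_pos {μ : ℝ} (hμ : 0 < μ) (k : Freq) : 0 < (symb μ k).re := by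
  rw [symb_re]; positivity

lemma semigroup_apply (μ t : ℝ) (u : Dist) (k : Freq) :
    semigroup μ t u k = Complex.exp (-(t : ℂ) * symb μ k) * u k := rfl

lemma norm_exp_symb (μ t : ℝ) (k : Freq) :
    ‖Complex.exp (-(t : ℂ) * symb μ k)‖ = Real.exp (-t * (symb μ k).re) := by
  rw [Complex.norm_exp, ← Complex.ofReal_neg, Complex.re_ofReal_mul]

lemma norm_exp_symb_le_one {μ : ℝ} (hμ : 0 < μ) {t : ℝ} (ht : 0 ≤ t) (k : Freq) :
    ‖Complex.exp (-(t : ℂ) * symb μ k)‖ ≤ 1 := by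
  rw [norm_exp_symb, Real.exp_le_one_iff]
  nlinarith [symb_re_pos hμ k]

section Duhamel

variable {m : ℕ} {μ : ℝ} {ν τ : ℂ} {D : DrivingData} {β γ T : ℝ} {u₀ : Dist}
  {v : ℝ → Torus → ℂ}

lemma Setting.exists_dualBound_Psi_unif (H : Setting χ m μ ν τ D β γ T u₀ v)
    {α : ℝ} (hα : α ∈ Set.Ioo (0 : ℝ) 1) (hαβ : α < β)
    {s₀ : ℝ} (hs₀ : 0 < s₀) :
    ∃ C : ℝ, 0 ≤ C ∧ ∀ t ∈ Set.Icc s₀ T, DualBound α C (Psi m ν τ D (v t) t) := by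
  obtain ⟨C, hC, h⟩ := H.exists_dualBound_Psi hα hαβ
  refine ⟨C * (s₀ ^ (-γ)) ^ (2 * m + 1), by positivity, fun t ht => ?_⟩
  have ht0 : 0 < t := hs₀.trans_le ht.1
  refine (h t ⟨ht0, ht.2⟩).mono ?_
  have : t ^ (-γ) ≤ s₀ ^ (-γ) := Real.rpow_le_rpow_of_nonpos hs₀ ht.1 (by linarith [H.hγ])
  gcongr

lemma Setting.exists_bound_sol_unif (H : Setting χ m μ ν τ D β γ T u₀ v) {s₀ : ℝ} (hs₀ : 0 < s₀) :
    ∃ B : ℝ, 0 ≤ B ∧ ∀ t ∈ Set.Icc s₀ T, ∀ x, ‖v t x‖ ≤ B := by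
  obtain ⟨B, hB, h⟩ := H.exists_bound_sol
  refine ⟨B * s₀ ^ (-γ), by positivity, fun t ht x => ?_⟩
  have ht0 : 0 < t := hs₀.trans_le ht.1
  refine (h t ⟨ht0, ht.2⟩ x).trans ?_
  have : t ^ (-γ) ≤ s₀ ^ (-γ) := Real.rpow_le_rpow_of_nonpos hs₀ ht.1 (by linarith [H.hγ])
  gcongr

lemma Setting.intervalIntegrable_duhamel (H : Setting χ m μ ν τ D β γ T u₀ v)
    (k : Freq) {t : ℝ} (ht : t ∈ Set.Ioc 0 T) :
    IntervalIntegrable (fun s => semigroup μ (t - s) (Psi m ν τ D (v s) s) k) volume 0 t := by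
  set α := min β 1 / 2 with hα
  have hβ := H.hβ
  have hα0 : 0 < α := by positivity
  have h4β : 2 * α ≤ β := by rw [hα]; linarith [min_le_left β 1]
  have h4 : 2 * α ≤ 1 := by rw [hα]; linarith [min_le_right β 1]
  obtain ⟨C, hC, h⟩ := H.exists_dualBound_Psi (α := α) ⟨hα0, by linarith⟩ (by linarith)
  have hr : IntervalIntegrable (fun s : ℝ => C * wt k ^ α * s ^ (-(γ * (2 * m + 1)))) volume 0 t :=
    (intervalIntegral.intervalIntegrable_rpow' (by linarith [H.hγ'])).const_mul _
  rw [intervalIntegrable_iff_integrableOn_Ioc_of_le ht.1.le] at hr ⊢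
  refine Integrable.mono' hr ?_ ?_
  · refine ContinuousOn.aestronglyMeasurable ?_ measurableSet_Ioc
    simp only [semigroup_apply]
    refine ContinuousOn.mul (Continuous.continuousOn (by fun_prop))
      ((H.continuousOn_Psi k).mono (Set.Ioc_subset_Ioc_right ht.2))
  · refine (ae_restrict_mem measurableSet_Ioc).mono fun s hs => ?_
    rw [semigroup_apply, norm_mul]
    have h1 := norm_exp_symb_le_one H.hμ (sub_nonneg.2 hs.2) k
    have h2 := (h s ⟨hs.1, hs.2.trans ht.2⟩).norm_coeff_le k
    have e : (s ^ (-γ)) ^ (2 * m + 1) = s ^ (-(γ * (2 * m + 1))) := by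
      rw [← Real.rpow_mul_natCast hs.1.le]; congr 1; push_cast; ring
    rw [e] at h2
    calc _ ≤ 1 * ‖Psi m ν τ D (v s) s k‖ := by gcongr
      _ ≤ _ := by rw [one_mul]; refine h2.trans (le_of_eq (by ring))

lemma Setting.restart (H : Setting χ m μ ν τ D β γ T u₀ v)
    (k : Freq) {s t : ℝ} (hs : 0 < s) (hst : s ≤ t) (htT : t ≤ T) :
    ofFun (v t) k = Complex.exp (-((t - s : ℝ) : ℂ) * symb μ k) * ofFun (v s) k
      + ∫ r in s..t, Complex.exp (-((t - r : ℝ) : ℂ) * symb μ k) * Psi m ν τ D (v r) r k := by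
  have ht : t ∈ Set.Ioc 0 T := ⟨hs.trans_le hst, htT⟩
  have hsm : s ∈ Set.Ioc 0 T := ⟨hs, hst.trans htT⟩
  have hi := H.intervalIntegrable_duhamel k ht
  have h0s : IntervalIntegrable (fun r => semigroup μ (t - r) (Psi m ν τ D (v r) r) k)
      volume 0 s := hi.mono_set (by
        rw [Set.uIcc_of_le hs.le, Set.uIcc_of_le ht.1.le]; exact Set.Icc_subset_Icc_right hst)
  have hst' : IntervalIntegrable (fun r => semigroup μ (t - r) (Psi m ν τ D (v r) r) k)
      volume s t := hi.mono_set (by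
        rw [Set.uIcc_of_le hst, Set.uIcc_of_le ht.1.le]; exact Set.Icc_subset_Icc_left hs.le)
  have e1 := H.hv.duhamel t ht k
  have e2 := H.hv.duhamel s hsm k
  rw [← intervalIntegral.integral_add_adjacent_intervals h0s hst'] at e1
  rw [e1, e2, mul_add, ← intervalIntegral.integral_const_mul, add_assoc]
  have ex : ∀ a : ℂ, ∀ r : ℝ, Complex.exp (-((t - s : ℝ) : ℂ) * symb μ k) *
      (Complex.exp (-((s - r : ℝ) : ℂ) * symb μ k) * a)
      = Complex.exp (-((t - r : ℝ) : ℂ) * symb μ k) * a := fun a r => by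
    rw [← mul_assoc, ← Complex.exp_add]; congr 2; push_cast; ring
  congr 1
  · have := ex (u₀ k) 0
    rw [sub_zero, sub_zero] at this
    rw [semigroup_apply, semigroup_apply, this]
  · congr 1
    refine intervalIntegral.integral_congr fun r _ => ?_
    simp only [semigroup_apply, ex]

lemma Setting.hasDerivWithinAt_coeff (H : Setting χ m μ ν τ D β γ T u₀ v)
    (k : Freq) {t : ℝ} (ht : t ∈ Set.Ioc 0 T) :
    HasDerivWithinAt (fun r => ofFun (v r) k)
      (-symb μ k * ofFun (v t) k + Psi m ν τ D (v t) t k) (Set.Ioc 0 T) t := by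
  set s := t / 2 with hs
  have hs0 : 0 < s := by have := ht.1; positivity
  have hst : s < t := by have := ht.1; rw [hs]; linarith
  have hsT : s ≤ T := hst.le.trans ht.2
  set c := symb μ k with hc
  set ψ : ℝ → ℂ := Set.IccExtend hsT (fun r : Set.Icc s T => Psi m ν τ D (v r) r k) with hψ
  have hψc : Continuous ψ := by
    refine Continuous.Icc_extend' ?_
    exact continuousOn_iff_continuous_domRestrict.1 ((H.continuousOn_Psi k).mono fun r hr =>
      ⟨hs0.trans_le hr.1, hr.2⟩)
  have hψe : ∀ r ∈ Set.Icc s T, ψ r = Psi m ν τ D (v r) r k := fun r hr =>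
    Set.IccExtend_of_mem hsT _ hr
  set y : ℝ → ℂ := fun t => Complex.exp (-((t - s : ℝ) : ℂ) * c) *
    (ofFun (v s) k + ∫ r in s..t, Complex.exp (((r - s : ℝ) : ℂ) * c) * ψ r) with hy
  have hye : ∀ r ∈ Set.Icc s T, ofFun (v r) k = y r := fun r hr => by
    rw [H.restart k hs0 hr.1 hr.2, hy]
    simp only
    rw [mul_add, ← intervalIntegral.integral_const_mul]
    congr 1
    refine intervalIntegral.integral_congr fun q hq => ?_
    rw [Set.uIcc_of_le hr.1] at hq
    rw [← mul_assoc, ← Complex.exp_add, hψe q ⟨hq.1, hq.2.trans hr.2⟩]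
    congr 2; push_cast; ring
  have hexp : ∀ r : ℝ, HasDerivAt (fun t : ℝ => Complex.exp (-((t - s : ℝ) : ℂ) * c))
      (Complex.exp (-((r - s : ℝ) : ℂ) * c) * (-c)) r := fun r => by
    have h1 : HasDerivAt (fun t : ℝ => ((t - s : ℝ) : ℂ)) 1 r := by
      have := ((hasDerivAt_id r).sub_const s).ofReal_comp
      simpa using this
    have := (h1.neg.mul_const c).cexp
    simpa using this
  have hInt : HasDerivAt (fun t => ofFun (v s) k +
      ∫ r in s..t, Complex.exp (((r - s : ℝ) : ℂ) * c) * ψ r)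
      (Complex.exp (((t - s : ℝ) : ℂ) * c) * ψ t) t := by
    have hcont : Continuous fun r : ℝ => Complex.exp (((r - s : ℝ) : ℂ) * c) * ψ r := by fun_prop
    exact (intervalIntegral.integral_hasDerivAt_right (hcont.intervalIntegrable _ _)
      (hcont.stronglyMeasurableAtFilter _ _) hcont.continuousAt).const_add _
  have hyd : HasDerivAt y (-c * y t + ψ t) t := by
    refine ((hexp t).mul hInt).congr_deriv ?_
    rw [← mul_assoc, ← Complex.exp_add, hy]
    rw [show -((t - s : ℝ) : ℂ) * c + ((t - s : ℝ) : ℂ) * c = 0 by ring, Complex.exp_zero]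
    ring
  have htm : t ∈ Set.Icc s T := ⟨hst.le, ht.2⟩
  rw [← hψe t htm, hye t htm]
  refine (hyd.hasDerivWithinAt (s := Set.Ioc 0 T)).congr_of_eventuallyEq ?_ (hye t htm)
  filter_upwards [self_mem_nhdsWithin, mem_nhdsWithin_of_mem_nhds (Ici_mem_nhds hst)] with r h1 h2
  exact hye r ⟨h2, h1.2⟩

end Duhamel

/-! ### Kernel bounds -/

/-- The first lattice vector. -/
def e₁ : Freq := Pi.single 0 1

lemma norm_freqVec_e₁ : ‖freqVec e₁‖ = 1 := by
  have : ‖freqVec e₁‖ ^ 2 = 1 := by rw [norm_freqVec_sq]; simp [e₁]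
  nlinarith [norm_nonneg (freqVec e₁)]

lemma integral_poisson {r : ℝ} (h0 : 0 ≤ r) (h1 : r < 1) :
    ∫ x, ‖(1 - r * ek e₁ x)⁻¹‖ ^ 2 ∂torusMeasure ≤ (1 - r)⁻¹ := by
  have hne : ∀ x, (1 : ℂ) - r * ek e₁ x ≠ 0 := fun x h => by
    have : ‖(r : ℂ) * ek e₁ x‖ = 1 := by rw [← sub_eq_zero.1 h, norm_one]
    rw [norm_mul, norm_ek, mul_one, Complex.norm_real, Real.norm_eq_abs, abs_of_nonneg h0] at this
    linarith
  have hc : Continuous fun x => (1 - r * ek e₁ x)⁻¹ :=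
    (continuous_const.sub (continuous_const.mul (continuous_ek _))).inv₀ hne
  have hg : ∀ x, HasSum (fun n : ℕ => ((r : ℂ) * ek e₁ x) ^ n) (1 - r * ek e₁ x)⁻¹ := fun x =>
    hasSum_geometric_of_norm_lt_one (by
      rwa [norm_mul, norm_ek, mul_one, Complex.norm_real, Real.norm_eq_abs, abs_of_nonneg h0])
  have hinj : Function.Injective fun n : ℕ => (n : ℤ) • e₁ := fun a b hab => by
    have := congrFun hab 0
    simpa [e₁] using this
  have hpow : ∀ (n : ℕ) x, ek e₁ x ^ n = ek ((n : ℤ) • e₁) x := fun n x => by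
    induction n with
    | zero => simp [ek_zero]
    | succ n ih => rw [pow_succ, ih, ← ek_add]; congr 2; push_cast; rw [add_smul, one_smul]
  have hco : ∀ k, ofFun (fun x => (1 - r * ek e₁ x)⁻¹) k =
      ∑' n : ℕ, if k = (n : ℤ) • e₁ then (r : ℂ) ^ n else 0 := by
    intro k
    have h2 := hasSum_ofFun (f := fun n x => (r : ℂ) ^ n * ek ((n : ℤ) • e₁) x) (b := fun n => r ^ n)
      (fun n => continuous_const.mul (continuous_ek _)) (summable_geometric_of_lt_one h0 h1)
      (fun n x => by rw [norm_mul, norm_ek, mul_one, norm_pow, Complex.norm_real,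
        Real.norm_eq_abs, abs_of_nonneg h0]) k
    have e : (fun x => ∑' n : ℕ, (r : ℂ) ^ n * ek ((n : ℤ) • e₁) x)
        = fun x => (1 - r * ek e₁ x)⁻¹ := by
      ext x
      rw [← (hg x).tsum_eq]
      exact tsum_congr fun n => by rw [mul_pow, hpow]
    rw [e] at h2
    rw [← h2.tsum_eq]
    exact tsum_congr fun n => by rw [ofFun_const_mul, ofFun_ek]; simp
  have hsq := parseval_sq hc
  have h3 : HasSum (fun n : ℕ => ‖ofFun (fun x => (1 - r * ek e₁ x)⁻¹) ((n : ℤ) • e₁)‖ ^ 2)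
      (∫ x, ‖(1 - r * ek e₁ x)⁻¹‖ ^ 2 ∂torusMeasure) := by
    refine (hinj.hasSum_iff fun k hk => ?_).2 hsq
    rw [hco]
    have : ∀ n : ℕ, ¬ k = (n : ℤ) • e₁ := fun n h => hk ⟨n, h.symm⟩
    simp only [this, if_false, tsum_zero, norm_zero]
    norm_num
  have h4 : ∀ n : ℕ, ‖ofFun (fun x => (1 - r * ek e₁ x)⁻¹) ((n : ℤ) • e₁)‖ ^ 2 ≤ r ^ n := by
    intro n
    rw [hco, tsum_eq_single n]
    · rw [if_pos rfl, norm_pow, Complex.norm_real, Real.norm_eq_abs, abs_of_nonneg h0, sq]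
      exact mul_le_of_le_one_left (by positivity) (pow_le_one₀ h0 h1.le)
    · intro n' hn'
      rw [if_neg]
      exact fun h => hn' (hinj h).symm
  exact hasSum_le h4 h3 (hasSum_geometric_of_lt_one h0 h1)

lemma integral_weight_le {N : ℝ} (hN : 1 ≤ N) :
    ∫ x, (1 + N ^ 2 * ‖ek e₁ x - 1‖ ^ 2)⁻¹ ∂torusMeasure ≤ N⁻¹ := by
  have hN0 : 0 < N := by linarith
  set r := 1 - N⁻¹ with hr
  have hr0 : 0 ≤ r := by rw [hr, sub_nonneg]; exact inv_le_one_of_one_le₀ hN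
  have hr1 : r < 1 := by rw [hr]; linarith [inv_pos.2 hN0]
  have h := integral_poisson hr0 hr1
  have e : (1 - r)⁻¹ = N := by rw [hr]; simp
  rw [e] at h
  have key : ∀ x, (1 + N ^ 2 * ‖ek e₁ x - 1‖ ^ 2)⁻¹
      ≤ (N⁻¹) ^ 2 * ‖((1 : ℂ) - r * ek e₁ x)⁻¹‖ ^ 2 := by
    intro x
    set z := ek e₁ x
    have hz : Complex.normSq z = 1 := by
      rw [Complex.normSq_eq_norm_sq, norm_ek, one_pow]
    rw [Complex.normSq_apply] at hz
    have e1 : ‖(1 : ℂ) - r * z‖ ^ 2 = (1 - r) ^ 2 + r * ‖z - 1‖ ^ 2 := by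
      rw [← Complex.normSq_eq_norm_sq, ← Complex.normSq_eq_norm_sq, Complex.normSq_apply,
        Complex.normSq_apply]
      simp only [Complex.sub_re, Complex.sub_im, Complex.one_re, Complex.one_im,
        Complex.re_ofReal_mul, Complex.im_ofReal_mul]
      linear_combination (r ^ 2 - r) * hz
    have e2 : 0 < ‖(1 : ℂ) - r * z‖ ^ 2 := by
      rw [e1]
      have : 0 < (1 - r) ^ 2 := by have : 0 < 1 - r := by linarith
                                   positivity
      positivity
    rw [norm_inv, inv_pow, inv_pow, ← mul_inv]
    refine inv_anti₀ (by positivity) ?_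
    rw [e1, show 1 - r = N⁻¹ by rw [hr]; ring, mul_add, ← mul_pow, mul_inv_cancel₀ hN0.ne',
      one_pow]
    gcongr
    exact mul_le_of_le_one_left (by positivity) hr1.le
  have hpos : ∀ x, 1 + N ^ 2 * ‖ek e₁ x - 1‖ ^ 2 ≠ 0 := fun x => by positivity
  have hc1 : Continuous fun x => (1 + N ^ 2 * ‖ek e₁ x - 1‖ ^ 2)⁻¹ := by
    refine Continuous.inv₀ ?_ hpos
    have := continuous_ek e₁
    fun_prop
  have hc2 : Continuous fun x => (N⁻¹) ^ 2 * ‖((1 : ℂ) - r * ek e₁ x)⁻¹‖ ^ 2 := by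
    refine continuous_const.mul ((Continuous.inv₀ ?_ fun x hx => ?_).norm.pow 2)
    · exact continuous_const.sub (continuous_const.mul (continuous_ek _))
    · have : ‖(r : ℂ) * ek e₁ x‖ = 1 := by rw [← sub_eq_zero.1 hx, norm_one]
      rw [norm_mul, norm_ek, mul_one, Complex.norm_real, Real.norm_eq_abs,
        abs_of_nonneg hr0] at this
      linarith
  calc _ ≤ ∫ x, (N⁻¹) ^ 2 * ‖((1 : ℂ) - r * ek e₁ x)⁻¹‖ ^ 2 ∂torusMeasure :=
        integral_mono (integrable_of_continuous hc1) (integrable_of_continuous hc2) key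
    _ = (N⁻¹) ^ 2 * ∫ x, ‖((1 : ℂ) - r * ek e₁ x)⁻¹‖ ^ 2 ∂torusMeasure := integral_const_mul _ _
    _ ≤ (N⁻¹) ^ 2 * N := by gcongr
    _ = N⁻¹ := by field_simp

/-- The `L¹` norm of a kernel in terms of first differences of its symbol. -/
lemma kernel_bound {N : ℕ} (hN : 1 ≤ N) {B : ℝ} {a : Freq → ℂ}
    (hsupp : ∀ k, (N : ℝ) < ‖freqVec k‖ → a k = 0) (hB : ∀ k, ‖a k‖ ≤ B)
    (hd : ∀ k, ‖a (k - e₁) - a k‖ ≤ B / N) :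
    (∫ x, ‖∑ k ∈ lball N, a k * ek k x‖ ∂torusMeasure) ^ 2 ≤ 50 * B ^ 2 * N := by
  have hN0 : (0 : ℝ) < N := by exact_mod_cast hN
  have hN1 : (1 : ℝ) ≤ N := by exact_mod_cast hN
  have hB0 : 0 ≤ B := (norm_nonneg _).trans (hB 0)
  set G : Torus → ℂ := fun x => ∑ k ∈ lball N, a k * ek k x with hG
  have hGb : BandLim N G := bandLim_trig _ _ fun k hk => mem_lball.1 hk
  have hGc : ∀ k, ofFun G k = a k := fun k => by
    rw [hG, ofFun_trig]
    split_ifs with h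
    · rfl
    · rw [mem_lball, not_le] at h; rw [hsupp k h]
  set E : Torus → ℂ := fun x => (ek e₁ x - 1) * G x with hE
  have hEcont : Continuous E := by
    have := continuous_ek e₁
    have := hGb.cont
    fun_prop
  have hEc : ∀ k, ofFun E k = a (k - e₁) - a k := fun k => by
    have : E = fun x => ek e₁ x * G x - G x := by ext x; rw [hE]; ring
    rw [this, ofFun_sub ((continuous_ek _).fun_mul hGb.cont) hGb.cont, Pi.sub_apply, ofFun_ek_mul,
      hGc, hGc]
  have card_le : ∀ S : Finset Freq, (∀ k ∈ S, ‖freqVec k‖ ≤ (N + 1 : ℕ)) →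
      (S.card : ℝ) ≤ 25 * N ^ 2 := fun S hS => by
    have h1 := Finset.card_le_card fun k (hk : k ∈ S) => mem_box (hS k hk)
    rw [card_box] at h1
    have h2 : (S.card : ℝ) ≤ ((2 * (N + 1) + 1) ^ 2 : ℕ) := by exact_mod_cast h1
    refine h2.trans ?_
    push_cast
    nlinarith
  have hfin : ∀ (g : Torus → ℂ) (b : ℝ), Continuous g → (∀ k, ‖ofFun g k‖ ≤ b) →
      (∀ k, ((N + 1 : ℕ) : ℝ) < ‖freqVec k‖ → ofFun g k = 0) →
      ∫ x, ‖g x‖ ^ 2 ∂torusMeasure ≤ 25 * N ^ 2 * b ^ 2 := fun g b hg hb hz => by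
    have h1 : HasSum (fun k => ‖ofFun g k‖ ^ 2)
        (∑ k ∈ lball (N + 1 : ℕ), ‖ofFun g k‖ ^ 2) := by
      refine hasSum_sum_of_ne_finset_zero fun k hk => ?_
      rw [mem_lball, not_le] at hk
      rw [hz k hk]; simp
    rw [(parseval_sq hg).unique h1]
    calc _ ≤ ∑ k ∈ lball (N + 1 : ℕ), b ^ 2 := by
          refine Finset.sum_le_sum fun k _ => ?_
          have := hb k
          gcongr
      _ = (lball (N + 1 : ℕ)).card * b ^ 2 := by rw [Finset.sum_const, nsmul_eq_mul]
      _ ≤ _ := by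
          gcongr
          exact card_le _ fun k hk => mem_lball.1 hk
  have iG := hfin G B hGb.cont (fun k => by rw [hGc]; exact hB k) fun k hk => by
    rw [hGc]; refine hsupp k (lt_trans ?_ hk); push_cast; linarith
  have iE := hfin E (B / N) hEcont (fun k => by rw [hEc]; exact hd k) fun k hk => by
    push_cast at hk
    rw [hEc, hsupp k (by linarith), hsupp, sub_zero]
    have := norm_freqVec_add_le (k - e₁) e₁
    rw [sub_add_cancel, norm_freqVec_e₁] at this
    linarith
  set w : Torus → ℝ := fun x => 1 + (N : ℝ) ^ 2 * ‖ek e₁ x - 1‖ ^ 2 with hw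
  have hwpos : ∀ x, 0 < w x := fun x => by rw [hw]; positivity
  have hwc : Continuous w := by
    have := continuous_ek e₁
    rw [hw]; fun_prop
  have hwi := integral_weight_le hN1
  have iw : ∫ x, w x * ‖G x‖ ^ 2 ∂torusMeasure ≤ 50 * (B ^ 2 * N ^ 2) := by
    have e : ∀ x, w x * ‖G x‖ ^ 2 = ‖G x‖ ^ 2 + N ^ 2 * ‖E x‖ ^ 2 := fun x => by
      rw [hw, hE]; simp only [norm_mul]; ring
    simp only [e]
    have := hGb.cont
    rw [integral_add (integrable_of_continuous (by fun_prop))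
      (integrable_of_continuous (by fun_prop)), integral_const_mul]
    calc _ ≤ 25 * (N : ℝ) ^ 2 * B ^ 2 + N ^ 2 * (25 * N ^ 2 * (B / N) ^ 2) := by gcongr
      _ = _ := by field_simp; ring
  have hGn := hGb.cont
  have hlam : ∀ lam : ℝ, 0 < lam → ∫ x, ‖G x‖ ∂torusMeasure
      ≤ lam / 2 * (50 * (B ^ 2 * N ^ 2)) + lam⁻¹ / 2 * (N : ℝ)⁻¹ := by
    intro lam hlam
    have hic : Continuous fun x => (w x)⁻¹ := hwc.inv₀ fun x => (hwpos x).ne'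
    calc ∫ x, ‖G x‖ ∂torusMeasure
        ≤ ∫ x, (lam / 2 * (w x * ‖G x‖ ^ 2) + lam⁻¹ / 2 * (w x)⁻¹) ∂torusMeasure := by
          refine integral_mono (integrable_of_continuous (by fun_prop))
            (integrable_of_continuous (by fun_prop)) fun x => ?_
          have h1 := hwpos x
          have h2 : 0 ≤ (lam * w x * ‖G x‖ - 1) ^ 2 * (lam⁻¹ / 2 * (w x)⁻¹) := by positivity
          have h3 : (lam * w x * ‖G x‖ - 1) ^ 2 * (lam⁻¹ / 2 * (w x)⁻¹) =
              lam / 2 * (w x * ‖G x‖ ^ 2) + lam⁻¹ / 2 * (w x)⁻¹ - ‖G x‖ := by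
            field_simp; ring
          simp only; linarith
      _ = lam / 2 * ∫ x, w x * ‖G x‖ ^ 2 ∂torusMeasure
          + lam⁻¹ / 2 * ∫ x, (w x)⁻¹ ∂torusMeasure := by
          rw [integral_add (integrable_of_continuous (by fun_prop))
            (integrable_of_continuous (by fun_prop)), integral_const_mul, integral_const_mul]
      _ ≤ _ := by gcongr
  set I := ∫ x, ‖G x‖ ∂torusMeasure with hI
  have hI0 : 0 ≤ I := integral_norm_nonneg G
  by_contra hlt
  rw [not_le] at hlt
  have hIp : 0 < I := by
    rcases hI0.eq_or_lt with h | h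
    · rw [← h] at hlt
      have : 0 ≤ 50 * B ^ 2 * N := by positivity
      norm_num at hlt
      linarith
    · exact h
  have h1 := hlam ((I * N)⁻¹) (by positivity)
  rw [inv_inv] at h1
  have h2 : (I * N)⁻¹ / 2 * (50 * (B ^ 2 * N ^ 2)) + I * N / 2 * (N : ℝ)⁻¹
      = (50 * B ^ 2 * N) / (2 * I) + I / 2 := by field_simp
  rw [h2] at h1
  have h3 : (50 * B ^ 2 * N) / (2 * I) < I / 2 := by
    rw [div_lt_div_iff₀ (by positivity) two_pos]
    nlinarith
  linarith

end

section

variable {χ : DyadicPartition}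

/-! ### Smoothing of the semigroup -/

lemma DualBound.anti {α α' C : ℝ} {u : Dist} (h : DualBound α C u) (hC : 0 ≤ C) (hα : α ≤ α') :
    DualBound α' C u := fun R hR Q hQ => (h R hR Q hQ).trans (by
  have := integral_norm_nonneg Q
  have := Real.rpow_le_rpow_of_exponent_le hR hα
  gcongr)

lemma DualBound.multiplier {α C : ℝ} {u : Dist} (h : DualBound α C u) (hC : 0 ≤ C) {N : ℕ}
    (hN : 1 ≤ N) {B : ℝ} {a : Freq → ℂ}
    (hsupp : ∀ k, (N : ℝ) < ‖freqVec k‖ → a k = 0) (hB : ∀ k, ‖a k‖ ≤ B)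
    (hd : ∀ k, ‖a (k - e₁) - a k‖ ≤ B / N) (x : Torus) :
    ‖∑ k ∈ lball N, a k * u k * ek k x‖ ≤ C * (N : ℝ) ^ α * (8 * B * √N) := by
  have hB0 : 0 ≤ B := (norm_nonneg _).trans (hB 0)
  have hN1 : (1 : ℝ) ≤ N := by exact_mod_cast hN
  have hkb := kernel_bound hN (a := fun k => a (-k)) (B := B)
    (fun k hk => hsupp _ (by rwa [norm_freqVec_neg])) (fun k => hB _) (fun k => by
      have := hd (-k + e₁)
      rw [add_sub_cancel_right, norm_sub_rev] at this
      rwa [show -(k - e₁) = -k + e₁ by abel])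
  set G : Torus → ℂ := fun y => ∑ k ∈ lball N, a (-k) * ek k y with hG
  have hGb : BandLim N G := bandLim_trig _ _ fun k hk => mem_lball.1 hk
  have hGc : ∀ k, ofFun G (-k) = a k := fun k => by
    rw [hG, ofFun_trig, neg_neg]
    split_ifs with h
    · rfl
    · rw [mem_lball, not_le, norm_freqVec_neg] at h; rw [hsupp k h]
  set Q : Torus → ℂ := fun y => G (y - x) with hQ
  have hQc : ∀ k, ofFun Q (-k) = a k * ek k x := fun k => by
    rw [← hGc k, ofFun_apply, ofFun_apply, neg_neg,
      ← integral_add_right_eq_self (fun y => ek k y * Q y) x, ← integral_mul_const]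
    congr 1; ext y
    rw [hQ, ek_add_apply]
    simp only [add_sub_cancel_right]; ring
  have hQb : BandLim N Q := by
    refine ⟨hGb.cont.comp (continuous_id.sub continuous_const), fun k hk => ?_⟩
    have := hQc (-k)
    rw [neg_neg] at this
    rw [this, hsupp _ (by rwa [norm_freqVec_neg]), zero_mul]
  have e : pairing Q u = ∑ k ∈ lball N, a k * u k * ek k x := by
    rw [hQb.pairing_eq]
    exact Finset.sum_congr rfl fun k _ => by rw [hQc]; ring
  have hI : ∫ y, ‖Q y‖ ∂torusMeasure = ∫ y, ‖G y‖ ∂torusMeasure :=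
    integral_sub_right_eq_self (fun y => ‖G y‖) x
  have h1 := h N hN1 Q hQb
  rw [e, hI] at h1
  refine h1.trans ?_
  gcongr
  refine abs_le_of_sq_le_sq' ?_ (by positivity) |>.2
  refine hkb.trans ?_
  rw [mul_pow, mul_pow, Real.sq_sqrt (by positivity)]
  have : 0 ≤ B ^ 2 * (N : ℝ) := by positivity
  linarith

lemma exists_cutoff_lipschitz (χ : DyadicPartition) : ∃ L : ℝ, 0 ≤ L ∧ ∀ (n : ℕ) (k : Freq),
    |χ.cutoff n (freqVec (k - e₁)) - χ.cutoff n (freqVec k)| ≤ L / 2 ^ n := by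
  have hcl : HasCompactSupport χ.low :=
    Metric.isCompact_of_isClosed_isBounded (isClosed_tsupport _)
      (Metric.isBounded_ball.subset χ.low_supp)
  have hca : HasCompactSupport χ.ann :=
    Metric.isCompact_of_isClosed_isBounded (isClosed_tsupport _)
      (Metric.isBounded_ball.subset (χ.ann_supp.trans Set.sdiff_subset))
  obtain ⟨L, hL⟩ := χ.low_smooth.lipschitzWith_of_hasCompactSupport hcl (by simp)
  obtain ⟨L', hL'⟩ := χ.ann_smooth.lipschitzWith_of_hasCompactSupport hca (by simp)
  have he : ∀ k, freqVec (k - e₁) - freqVec k = -freqVec e₁ := fun k => by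
    rw [← freqVec_neg, show k - e₁ = k + -e₁ by abel, freqVec_add]; abel
  refine ⟨L + 2 * L', by positivity, fun n k => ?_⟩
  cases n with
  | zero =>
    have := hL.dist_le_mul (freqVec (k - e₁)) (freqVec k)
    rw [Real.dist_eq, dist_eq_norm, he, norm_neg, norm_freqVec_e₁, mul_one] at this
    rw [pow_zero, div_one]
    refine this.trans ?_
    have : (0 : ℝ) ≤ 2 * L' := by positivity
    linarith
  | succ j =>
    have := hL'.dist_le_mul (((2 : ℝ) ^ j)⁻¹ • freqVec (k - e₁)) (((2 : ℝ) ^ j)⁻¹ • freqVec k)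
    rw [Real.dist_eq, dist_eq_norm, ← smul_sub, he, norm_smul, norm_neg, norm_freqVec_e₁, mul_one,
      norm_inv, norm_pow, Real.norm_two] at this
    refine this.trans ?_
    rw [pow_succ, ← div_eq_mul_inv, div_le_div_iff₀ (by positivity) (by positivity)]
    have h1 : (0 : ℝ) ≤ L := L.2
    have h2 : (0 : ℝ) < 2 ^ j := by positivity
    nlinarith

lemma norm_exp_neg_sub_le {z w : ℂ} {M : ℝ} (hz : M ≤ z.re) (hw : M ≤ w.re) :
    ‖Complex.exp (-w) - Complex.exp (-z)‖ ≤ Real.exp (-M) * ‖w - z‖ := by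
  have hconv : Convex ℝ {z : ℂ | M ≤ z.re} := convex_halfSpace_re_ge M
  refine hconv.norm_image_sub_le_of_norm_hasDerivWithin_le
    (f := fun z => Complex.exp (-z)) (f' := fun z => Complex.exp (-z) * (-1))
    (fun x _ => ?_) (fun x hx => ?_) hz hw
  · exact ((hasDerivAt_neg x).cexp).hasDerivWithinAt
  · rw [norm_mul, norm_neg, norm_one, mul_one, Complex.norm_exp, Real.exp_le_exp, Complex.neg_re]
    exact neg_le_neg hx

lemma norm_symb_sub_le (μ : ℝ) (hμ : 0 < μ) (k l : Freq) :
    ‖symb μ k - symb μ l‖ ≤ 4 * Real.pi ^ 2 * (1 + μ) * |‖freqVec k‖ ^ 2 - ‖freqVec l‖ ^ 2| := by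
  have : symb μ k - symb μ l = ((4 * Real.pi ^ 2 : ℝ) : ℂ) * (Complex.I + (μ : ℂ)) *
      ((‖freqVec k‖ ^ 2 - ‖freqVec l‖ ^ 2 : ℝ) : ℂ) := by
    unfold symb; push_cast; ring
  rw [this, norm_mul, norm_mul, Complex.norm_real, Complex.norm_real, Real.norm_eq_abs,
    Real.norm_eq_abs, abs_of_nonneg (by positivity : 0 ≤ 4 * Real.pi ^ 2)]
  gcongr
  refine (norm_add_le _ _).trans ?_
  rw [Complex.norm_I, Complex.norm_real, Real.norm_eq_abs, abs_of_pos hμ]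

lemma exists_le_symb_re {μ : ℝ} (hμ : 0 < μ) : ∃ c : ℝ, 0 < c ∧ ∀ k, c * wt k ^ 2 ≤ (symb μ k).re := by
  have hpi := Real.pi_pos
  refine ⟨min 1 (4 * Real.pi ^ 2 * μ) / 2, by positivity, fun k => ?_⟩
  rw [symb_re]
  have h1 := min_le_left 1 (4 * Real.pi ^ 2 * μ)
  have h2 := min_le_right 1 (4 * Real.pi ^ 2 * μ)
  have h3 : 0 < min 1 (4 * Real.pi ^ 2 * μ) := by positivity
  set c := min 1 (4 * Real.pi ^ 2 * μ)
  unfold wt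
  have h4 := norm_nonneg (freqVec k)
  nlinarith [sq_nonneg (1 - ‖freqVec k‖), sq_nonneg ‖freqVec k‖,
    mul_le_mul_of_nonneg_right h2 (sq_nonneg ‖freqVec k‖),
    mul_nonneg h3.le (sq_nonneg (1 - ‖freqVec k‖))]

lemma norm_coord_mul_le (j : Fin 2) (k : Freq) :
    ‖2 * (Real.pi : ℂ) * Complex.I * (k j : ℂ)‖ ≤ 2 * Real.pi * ‖freqVec k‖ := by
  have := abs_coord_le k j
  have hpi := Real.pi_pos
  rw [norm_mul, norm_mul, norm_mul, Complex.norm_I, Complex.norm_real, Complex.norm_two,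
    Real.norm_eq_abs, abs_of_pos hpi, mul_one, Complex.norm_intCast]
  gcongr

/-- The symbol `χ_{n-1}(k) 2πi k_j e^{-h(1+4π²(i+μ)|k|²)}`. -/
def gradSymb (χ : DyadicPartition) (μ : ℝ) (n : ℕ) (j : Fin 2) (h : ℝ) (k : Freq) : ℂ :=
  (χ.cutoff n (freqVec k) : ℂ) * (2 * (Real.pi : ℂ) * Complex.I * (k j : ℂ)) *
    Complex.exp (-(h : ℂ) * symb μ k)

lemma exists_gradSymb_bound (χ : DyadicPartition) {μ : ℝ} (hμ : 0 < μ) :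
    ∃ K κ : ℝ, 0 < K ∧ 0 < κ ∧ ∀ (n : ℕ) (j : Fin 2) (h : ℝ), 0 ≤ h → ∀ k,
      ‖gradSymb χ μ n j h k‖ ≤ K * 2 ^ n * Real.exp (-(κ * 4 ^ n) * h) ∧
      ‖gradSymb χ μ n j h (k - e₁) - gradSymb χ μ n j h k‖
        ≤ K * 2 ^ n * Real.exp (-(κ * 4 ^ n) * h) / (4 * 2 ^ n : ℕ) := by
  obtain ⟨L, hL, hL2⟩ := exists_cutoff_lipschitz χ
  obtain ⟨c, hc, hc2⟩ := exists_le_symb_re hμ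
  have hpi := Real.pi_pos
  set κ := c * (9 / 128) with hκ
  have hκ0 : 0 < κ := by positivity
  set K₀ := 6 * Real.pi * L + 2 * Real.pi + 144 * Real.pi ^ 3 * (1 + μ) / κ with hK₀
  have hK₀pos : 0 < K₀ := by positivity
  refine ⟨4 * K₀ + 6 * Real.pi, κ, by positivity, hκ0, fun n j h hh k => ?_⟩
  set E := Real.exp (-(κ * 4 ^ n) * h) with hE
  have hEpos : 0 < E := Real.exp_pos _
  have h2n : (1 : ℝ) ≤ 2 ^ n := one_le_pow₀ one_le_two
  have h4n : (4 : ℝ) ^ n = (2 ^ n) ^ 2 := by rw [← pow_mul, mul_comm, pow_mul]; norm_num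
  have hre : ∀ l, 3 / 8 * 2 ^ n ≤ wt l → 2 * κ * 4 ^ n * h ≤ h * (symb μ l).re := fun l hl => by
    have h1 := hc2 l
    have h2 : (3 / 8 * 2 ^ n) ^ 2 ≤ wt l ^ 2 := by gcongr
    have h3 : 2 * κ * 4 ^ n ≤ (symb μ l).re := by
      refine le_trans ?_ h1
      calc 2 * κ * 4 ^ n = c * (3 / 8 * 2 ^ n) ^ 2 := by rw [h4n, hκ]; ring
        _ ≤ _ := by gcongr
    nlinarith
  have hE2 : Real.exp (-(2 * κ * 4 ^ n * h)) ≤ E := by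
    rw [hE, Real.exp_le_exp]
    have : 0 ≤ κ * 4 ^ n * h := by positivity
    nlinarith
  have hnorm : ∀ l, 3 / 8 * 2 ^ n ≤ wt l → ‖Complex.exp (-(h : ℂ) * symb μ l)‖ ≤ E := fun l hl => by
    rw [norm_exp_symb]
    refine le_trans (Real.exp_le_exp.2 ?_) hE2
    have := hre l hl
    linarith
  have hX : ∀ l, ‖(χ.cutoff n (freqVec l) : ℂ)‖ ≤ 1 := fun l => by
    rw [Complex.norm_real, Real.norm_eq_abs, abs_of_nonneg (cutoff_nonneg χ n _)]
    exact cutoff_le_one χ n _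
  constructor
  · by_cases h0 : χ.cutoff n (freqVec k) = 0
    · rw [gradSymb, h0]; simp only [Complex.ofReal_zero, zero_mul, norm_zero]; positivity
    · rw [gradSymb, norm_mul, norm_mul]
      have h1 := hnorm k (le_wt_of_cutoff_ne χ h0)
      have h2 := norm_le_of_cutoff_ne χ h0
      have h3 := norm_coord_mul_le j k
      calc _ ≤ 1 * (2 * Real.pi * (4 / 3 * 2 ^ n)) * E := by
            gcongr
            · exact hX k
            · exact h3.trans (by gcongr)
        _ = 8 / 3 * Real.pi * (2 ^ n * E) := by ring
        _ ≤ (4 * K₀ + 6 * Real.pi) * (2 ^ n * E) := by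
            gcongr
            linarith
        _ = _ := by ring
  · have htri : |‖freqVec (k - e₁)‖ - ‖freqVec k‖| ≤ 1 := by
      refine (abs_norm_sub_norm_le _ _).trans (le_of_eq ?_)
      rw [← norm_neg, show -(freqVec (k - e₁) - freqVec k) = freqVec e₁ by
        rw [show k - e₁ = k + -e₁ by abel, freqVec_add, freqVec_neg]; abel, norm_freqVec_e₁]
    rw [abs_le] at htri
    suffices hs : ‖gradSymb χ μ n j h (k - e₁) - gradSymb χ μ n j h k‖ ≤ K₀ * E by
      refine hs.trans ?_
      push_cast
      rw [le_div_iff₀ (by positivity)]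
      have : 0 ≤ 6 * Real.pi * 2 ^ n * E := by positivity
      nlinarith
    by_cases hz : χ.cutoff n (freqVec (k - e₁)) = 0 ∧ χ.cutoff n (freqVec k) = 0
    · rw [gradSymb, gradSymb, hz.1, hz.2]
      simp only [Complex.ofReal_zero, zero_mul, sub_self, norm_zero]; positivity
    have hreg : (3 / 8 * 2 ^ n ≤ wt (k - e₁) ∧ 3 / 8 * 2 ^ n ≤ wt k) ∧
        ‖freqVec (k - e₁)‖ ≤ 3 * 2 ^ n ∧ ‖freqVec k‖ ≤ 3 * 2 ^ n := by
      have low : ∀ l l' : Freq, χ.cutoff n (freqVec l) ≠ 0 → ‖freqVec l‖ - ‖freqVec l'‖ ≤ 1 →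
          3 / 8 * 2 ^ n ≤ wt l' := fun l l' hl hll => by
        rcases eq_or_ne n 0 with rfl | hn
        · have := one_le_wt l'; norm_num; linarith
        · have := le_norm_of_cutoff_ne χ hn hl
          unfold wt; linarith
      rcases not_and_or.1 hz with h0 | h0
      · have h1 := norm_le_of_cutoff_ne χ h0
        exact ⟨⟨le_wt_of_cutoff_ne χ h0, low _ _ h0 htri.2⟩, by linarith, by linarith⟩
      · have h1 := norm_le_of_cutoff_ne χ h0
        exact ⟨⟨low _ _ h0 (by linarith), le_wt_of_cutoff_ne χ h0⟩, by linarith, by linarith⟩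
    obtain ⟨⟨hw1, hw2⟩, hn1, hn2⟩ := hreg
    set k' := k - e₁ with hk'
    have split : gradSymb χ μ n j h k' - gradSymb χ μ n j h k =
        ((χ.cutoff n (freqVec k') - χ.cutoff n (freqVec k) : ℝ) : ℂ) *
          (2 * (Real.pi : ℂ) * Complex.I * (k' j : ℂ)) * Complex.exp (-(h : ℂ) * symb μ k')
        + (χ.cutoff n (freqVec k) : ℂ) * (2 * (Real.pi : ℂ) * Complex.I * ((k' j : ℂ) - (k j : ℂ))) *
          Complex.exp (-(h : ℂ) * symb μ k')
        + (χ.cutoff n (freqVec k) : ℂ) * (2 * (Real.pi : ℂ) * Complex.I * (k j : ℂ)) *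
          (Complex.exp (-(h : ℂ) * symb μ k') - Complex.exp (-(h : ℂ) * symb μ k)) := by
      unfold gradSymb; push_cast; ring
    have t1 : ‖((χ.cutoff n (freqVec k') - χ.cutoff n (freqVec k) : ℝ) : ℂ) *
          (2 * (Real.pi : ℂ) * Complex.I * (k' j : ℂ)) * Complex.exp (-(h : ℂ) * symb μ k')‖
        ≤ 6 * Real.pi * L * E := by
      rw [norm_mul, norm_mul, Complex.norm_real, Real.norm_eq_abs]
      calc _ ≤ L / 2 ^ n * (2 * Real.pi * (3 * 2 ^ n)) * E := by
            gcongr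
            · exact hL2 n k
            · exact (norm_coord_mul_le j k').trans (by gcongr)
            · exact hnorm _ hw1
        _ = _ := by field_simp; ring
    have t2 : ‖(χ.cutoff n (freqVec k) : ℂ) *
          (2 * (Real.pi : ℂ) * Complex.I * ((k' j : ℂ) - (k j : ℂ))) *
          Complex.exp (-(h : ℂ) * symb μ k')‖ ≤ 2 * Real.pi * E := by
      have hd : ‖2 * (Real.pi : ℂ) * Complex.I * ((k' j : ℂ) - (k j : ℂ))‖ ≤ 2 * Real.pi := by
        have e : (k' j : ℂ) - (k j : ℂ) = ((-e₁ : Freq) j : ℂ) := by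
          rw [hk']; simp
        rw [e]
        refine (norm_coord_mul_le j (-e₁)).trans ?_
        rw [norm_freqVec_neg, norm_freqVec_e₁, mul_one]
      rw [norm_mul, norm_mul]
      calc _ ≤ 1 * (2 * Real.pi) * E := by
            gcongr
            · exact hX k
            · exact hnorm _ hw1
        _ = _ := by ring
    have t3 : ‖(χ.cutoff n (freqVec k) : ℂ) * (2 * (Real.pi : ℂ) * Complex.I * (k j : ℂ)) *
          (Complex.exp (-(h : ℂ) * symb μ k') - Complex.exp (-(h : ℂ) * symb μ k))‖
        ≤ 144 * Real.pi ^ 3 * (1 + μ) / κ * E := by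
      have hre' : ∀ l, ((h : ℂ) * symb μ l).re = h * (symb μ l).re := fun l =>
        Complex.re_ofReal_mul _ _
      have h5 := norm_exp_neg_sub_le (z := (h : ℂ) * symb μ k) (w := (h : ℂ) * symb μ k')
        (M := 2 * κ * 4 ^ n * h) (by rw [hre']; exact hre k hw2) (by rw [hre']; exact hre k' hw1)
      have h6 : ‖(h : ℂ) * symb μ k' - (h : ℂ) * symb μ k‖
          ≤ h * (4 * Real.pi ^ 2 * (1 + μ) * (6 * 2 ^ n)) := by
        rw [← mul_sub, norm_mul, Complex.norm_real, Real.norm_eq_abs, abs_of_nonneg hh]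
        gcongr
        refine (norm_symb_sub_le μ hμ k' k).trans ?_
        gcongr
        rw [show ‖freqVec k'‖ ^ 2 - ‖freqVec k‖ ^ 2
          = (‖freqVec k'‖ - ‖freqVec k‖) * (‖freqVec k'‖ + ‖freqVec k‖) by ring, abs_mul]
        have p1 := norm_nonneg (freqVec k')
        have p2 := norm_nonneg (freqVec k)
        rw [abs_of_nonneg (add_nonneg p1 p2)]
        have p3 : |‖freqVec k'‖ - ‖freqVec k‖| ≤ 1 := abs_le.2 htri
        have p4 := abs_nonneg (‖freqVec k'‖ - ‖freqVec k‖)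
        nlinarith
      rw [← neg_mul, ← neg_mul] at h5
      rw [norm_mul, norm_mul]
      have hxe : κ * 4 ^ n * h * Real.exp (-(2 * κ * 4 ^ n * h)) ≤ E := by
        set y := κ * 4 ^ n * h with hy
        have e : Real.exp (-(2 * κ * 4 ^ n * h)) = Real.exp (-y) * E := by
          rw [hE, ← Real.exp_add]; congr 1; rw [hy]; ring
        rw [e, ← mul_assoc]
        refine mul_le_of_le_one_left hEpos.le ?_
        rw [Real.exp_neg, ← div_eq_mul_inv, div_le_one (Real.exp_pos _)]
        linarith [Real.add_one_le_exp y]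
      calc _ ≤ 1 * (2 * Real.pi * (3 * 2 ^ n)) * (Real.exp (-(2 * κ * 4 ^ n * h)) *
            (h * (4 * Real.pi ^ 2 * (1 + μ) * (6 * 2 ^ n)))) := by
            gcongr
            · exact hX k
            · exact (norm_coord_mul_le j k).trans (by gcongr)
            · exact h5.trans (by gcongr)
        _ = 144 * Real.pi ^ 3 * (1 + μ) / κ *
            (κ * 4 ^ n * h * Real.exp (-(2 * κ * 4 ^ n * h))) := by
            rw [h4n]; field_simp; ring
        _ ≤ _ := by gcongr
    rw [split]
    calc _ ≤ 6 * Real.pi * L * E + 2 * Real.pi * E + 144 * Real.pi ^ 3 * (1 + μ) / κ * E :=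
          (norm_add_le _ _).trans (add_le_add ((norm_add_le _ _).trans (add_le_add t1 t2)) t3)
      _ = K₀ * E := by rw [hK₀]; ring

/-- The partial derivative of a distribution. -/
def dDist (j : Fin 2) (u : Dist) : Dist := fun k => 2 * (Real.pi : ℂ) * Complex.I * (k j : ℂ) * u k

lemma block_dDist_eq (n : ℕ) (j : Fin 2) (u : Dist) (x : Torus) :
    block χ n (dDist j u) x = ∑ k ∈ lball (4 * 2 ^ n : ℕ), (χ.cutoff n (freqVec k) : ℂ) *
      (2 * (Real.pi : ℂ) * Complex.I * (k j : ℂ)) * u k * ek k x := by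
  rw [block, tsum_eq_sum (s := lball (4 * 2 ^ n : ℕ))]
  · exact Finset.sum_congr rfl fun k _ => by rw [dDist]; ring
  · intro k hk
    have : χ.cutoff n (freqVec k) = 0 := by
      by_contra h
      refine hk (mem_lball.2 ((norm_le_of_cutoff_ne χ h).trans ?_))
      push_cast
      gcongr; norm_num
    simp [this]

lemma integral_exp_decay_le {κ s t : ℝ} (hκ : 0 < κ) :
    ∫ r in s..t, Real.exp (-κ * (t - r)) ≤ κ⁻¹ := by
  have hd : ∀ r ∈ Set.uIcc s t, HasDerivAt (fun r => κ⁻¹ * Real.exp (-κ * (t - r)))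
      (Real.exp (-κ * (t - r))) r := fun r _ => by
    have h1 : HasDerivAt (fun r : ℝ => -κ * (t - r)) (-κ * -1) r :=
      ((hasDerivAt_id r).const_sub t).const_mul _
    refine (h1.exp.const_mul κ⁻¹).congr_deriv ?_
    field_simp
  rw [intervalIntegral.integral_eq_sub_of_hasDerivAt hd
    (Continuous.intervalIntegrable (by fun_prop) _ _)]
  simp only [sub_self, mul_zero, Real.exp_zero, mul_one]
  have : 0 ≤ κ⁻¹ * Real.exp (-κ * (t - s)) := by positivity
  linarith

section Gradient

variable {m : ℕ} {μ : ℝ} {ν τ : ℂ} {D : DrivingData} {β γ T : ℝ} {u₀ : Dist}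
  {v : ℝ → Torus → ℂ}

lemma Setting.exists_blockBound_grad (H : Setting χ m μ ν τ D β γ T u₀ v)
    {s₀ : ℝ} (hs₀ : 0 < s₀) : ∃ C : ℝ, 0 ≤ C ∧
    ∀ t ∈ Set.Icc s₀ T, ∀ j, BlockBound χ (1 / 4) C (dDist j (ofFun (v t))) := by
  obtain ⟨K, κ, hK, hκ, hsym⟩ := exists_gradSymb_bound χ H.hμ
  set α := min β 1 / 4 with hα
  have hβ := H.hβ
  have hα0 : 0 < α := by positivity
  have h4β : 4 * α ≤ β := by rw [hα]; linarith [min_le_left β 1]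
  have h4 : 4 * α ≤ 1 := by rw [hα]; linarith [min_le_right β 1]
  obtain ⟨C₁, hC₁, hΨ⟩ := H.exists_dualBound_Psi_unif (α := α) ⟨hα0, by linarith⟩ (by linarith)
    (half_pos hs₀)
  obtain ⟨C₂, hC₂, hvb⟩ := H.exists_bound_sol_unif (half_pos hs₀)
  refine ⟨32 * K * (C₂ * (κ * (s₀ / 2))⁻¹ + C₁ * κ⁻¹), by positivity, fun t ht j n x => ?_⟩
  have hst : s₀ / 2 ≤ t := by linarith [ht.1]
  have hs2 : s₀ / 2 ∈ Set.Icc (s₀ / 2) T := ⟨le_rfl, hst.trans ht.2⟩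
  set N : ℕ := 4 * 2 ^ n with hN
  have hN1 : 1 ≤ N := by rw [hN]; have := Nat.one_le_two_pow (n := n); omega
  have hsupp : ∀ h k, (N : ℝ) < ‖freqVec k‖ → gradSymb χ μ n j h k = 0 := fun h k hk => by
    have : χ.cutoff n (freqVec k) = 0 := by
      by_contra h0
      have h1 := norm_le_of_cutoff_ne χ h0
      rw [hN] at hk
      push_cast at hk
      have : (0 : ℝ) < 2 ^ n := by positivity
      linarith
    rw [gradSymb, this]; simp
  have hmul : ∀ (u : Dist) (C : ℝ), 0 ≤ C → DualBound (1 / 4) C u → ∀ h, 0 ≤ h →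
      ‖∑ k ∈ lball N, gradSymb χ μ n j h k * u k * ek k x‖
        ≤ 32 * K * C * dy (7 / 4) n * Real.exp (-(κ * 4 ^ n) * h) := fun u C hC hu h hh => by
    refine (hu.multiplier hC hN1 (hsupp h) (fun k => (hsym n j h hh k).1)
      (fun k => (hsym n j h hh k).2) x).trans ?_
    have e1 : (N : ℝ) ^ (1 / 4 : ℝ) * √N ≤ 4 * dy (3 / 4) n := by
      rw [Real.sqrt_eq_rpow, ← Real.rpow_add (by positivity), hN]
      push_cast
      rw [Real.mul_rpow (by norm_num) (by positivity), ← pow_rpow_eq_dy]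
      norm_num
      gcongr
      calc (4 : ℝ) ^ (3 / 4 : ℝ) ≤ (4 : ℝ) ^ (1 : ℝ) :=
            Real.rpow_le_rpow_of_exponent_le (by norm_num) (by norm_num)
        _ = 4 := Real.rpow_one _
    have e2 : dy (7 / 4) n = dy (3 / 4) n * 2 ^ n := by
      rw [← dy_one, dy_mul]; norm_num
    calc C * (N : ℝ) ^ (1 / 4 : ℝ) * (8 * (K * 2 ^ n * Real.exp (-(κ * 4 ^ n) * h)) * √N)
        = 8 * K * C * 2 ^ n * Real.exp (-(κ * 4 ^ n) * h) * ((N : ℝ) ^ (1 / 4 : ℝ) * √N) := by ring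
      _ ≤ 8 * K * C * 2 ^ n * Real.exp (-(κ * 4 ^ n) * h) * (4 * dy (3 / 4) n) := by gcongr
      _ = _ := by rw [e2]; ring
  have hΨc : ∀ k, ContinuousOn (fun r => gradSymb χ μ n j (t - r) k * Psi m ν τ D (v r) r k * ek k x)
      (Set.Icc (s₀ / 2) t) := fun k => by
    refine (ContinuousOn.mul (Continuous.continuousOn ?_)
      ((H.continuousOn_Psi k).mono fun r hr => ⟨by linarith [hr.1], hr.2.trans ht.2⟩)).mul
        continuousOn_const
    unfold gradSymb; fun_prop
  have e : block χ n (dDist j (ofFun (v t))) x =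
      ∑ k ∈ lball N, gradSymb χ μ n j (t - s₀ / 2) k * ofFun (v (s₀ / 2)) k * ek k x
      + ∫ r in (s₀ / 2)..t, ∑ k ∈ lball N,
        gradSymb χ μ n j (t - r) k * Psi m ν τ D (v r) r k * ek k x := by
    rw [intervalIntegral.integral_finsetSum, ← Finset.sum_add_distrib, block_dDist_eq]
    · refine Finset.sum_congr rfl fun k _ => ?_
      rw [H.restart k (half_pos hs₀) hst ht.2, mul_add, add_mul]
      congr 1
      · unfold gradSymb; ring
      · rw [← intervalIntegral.integral_const_mul, ← intervalIntegral.integral_mul_const]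
        refine intervalIntegral.integral_congr fun r _ => ?_
        simp only [gradSymb]; ring
    · intro k _
      exact (hΨc k).intervalIntegrable_of_Icc hst
  have hd0 := dy_nonneg (7 / 4) n
  have b1 := hmul (ofFun (v (s₀ / 2))) C₂ hC₂ (dualBound_ofFun (by norm_num)
    (H.hv.continuous _ ⟨by linarith, hs2.2⟩) (hvb _ hs2)) (t - s₀ / 2) (by linarith)
  have b2 : ‖∫ r in (s₀ / 2)..t, ∑ k ∈ lball N,
      gradSymb χ μ n j (t - r) k * Psi m ν τ D (v r) r k * ek k x‖
      ≤ 32 * K * C₁ * dy (7 / 4) n * (κ * 4 ^ n)⁻¹ := by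
    refine (intervalIntegral.norm_integral_le_of_norm_le hst (g := fun r =>
      32 * K * C₁ * dy (7 / 4) n * Real.exp (-(κ * 4 ^ n) * (t - r))) ?_ ?_).trans ?_
    · refine Eventually.of_forall fun r hr => ?_
      exact hmul _ C₁ hC₁ ((hΨ r ⟨hr.1.le, hr.2.trans ht.2⟩).anti hC₁ (by linarith)) (t - r)
        (by linarith [hr.2])
    · exact Continuous.intervalIntegrable (by fun_prop) _ _
    · rw [intervalIntegral.integral_const_mul]
      gcongr
      exact integral_exp_decay_le (by positivity)
  have b3 : Real.exp (-(κ * 4 ^ n) * (t - s₀ / 2)) ≤ (κ * (s₀ / 2))⁻¹ * (4 ^ n)⁻¹ := by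
    set y := κ * 4 ^ n * (s₀ / 2) with hy
    have hy0 : 0 < y := by positivity
    calc Real.exp (-(κ * 4 ^ n) * (t - s₀ / 2)) ≤ Real.exp (-y) := by
          rw [Real.exp_le_exp, hy, neg_mul, neg_le_neg_iff]
          gcongr
          linarith [ht.1]
      _ ≤ y⁻¹ := by
          rw [Real.exp_neg]
          exact inv_anti₀ hy0 (by linarith [Real.add_one_le_exp y])
      _ = _ := by rw [hy, ← mul_inv]; congr 1; ring
  have e4 : dy (7 / 4) n * ((4 : ℝ) ^ n)⁻¹ = dy (-(1 / 4)) n := by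
    have : (4 : ℝ) ^ n = dy 2 n := by
      rw [dy_eq_pow]; norm_num
    rw [this, mul_inv_eq_iff_eq_mul₀ (dy_pos 2 n).ne', dy_mul]; norm_num
  rw [e]
  calc _ ≤ 32 * K * C₂ * dy (7 / 4) n * ((κ * (s₀ / 2))⁻¹ * (4 ^ n)⁻¹)
        + 32 * K * C₁ * dy (7 / 4) n * (κ * 4 ^ n)⁻¹ :=
        (norm_add_le _ _).trans (add_le_add (b1.trans (by gcongr)) b2)
    _ = 32 * K * (C₂ * (κ * (s₀ / 2))⁻¹ + C₁ * κ⁻¹) * (dy (7 / 4) n * ((4 : ℝ) ^ n)⁻¹) := by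
        rw [mul_inv κ]; ring
    _ = _ := by rw [e4]

end Gradient

end

section

variable {χ : DyadicPartition}

/-! ### Differentiability in space -/

/-- The projection `ℝ² → 𝕋²`. -/
def mk (y : Fin 2 → ℝ) : Torus := fun i => (y i : UnitAddCircle)

lemma exists_mk (x : Torus) : ∃ y, mk y = x := by
  choose y hy using fun i => QuotientAddGroup.mk_surjective (x i)
  exact ⟨y, funext hy⟩

lemma continuous_mk : Continuous mk :=
  continuous_pi fun i => (AddCircle.continuous_mk' 1).comp (continuous_apply i)

lemma lift_apply (f : Torus → ℂ) (y : Fin 2 → ℝ) : lift f y = f (mk y) := rfl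

/-- The linear form `w ↦ ∑ w_j g_j`. -/
def gradMap (g : Fin 2 → ℂ) : (Fin 2 → ℝ) →L[ℝ] ℂ :=
  ∑ j, (ContinuousLinearMap.proj (R := ℝ) (φ := fun _ : Fin 2 => ℝ) j).smulRight (g j)

lemma gradMap_apply (g : Fin 2 → ℂ) (w : Fin 2 → ℝ) : gradMap g w = ∑ j, w j • g j := by
  simp [gradMap]

lemma gradMap_single (g : Fin 2 → ℂ) (j : Fin 2) : gradMap g (Pi.single j 1) = g j := by
  rw [gradMap_apply, Fintype.sum_eq_single j]
  · simp
  · intro i hi; simp [hi]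

lemma norm_gradMap_le (g : Fin 2 → ℂ) : ‖gradMap g‖ ≤ ∑ j, ‖g j‖ := by
  refine ContinuousLinearMap.opNorm_le_bound _ (Finset.sum_nonneg fun _ _ => norm_nonneg _)
    fun w => ?_
  rw [gradMap_apply, Finset.sum_mul]
  refine (norm_sum_le _ _).trans (Finset.sum_le_sum fun j _ => ?_)
  rw [norm_smul, mul_comm]
  gcongr
  exact norm_le_pi_norm w j

lemma continuous_gradMap : Continuous gradMap := by
  have : gradMap = fun g => ∑ j, ContinuousLinearMap.smulRightL ℝ (Fin 2 → ℝ) ℂ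
      (ContinuousLinearMap.proj (R := ℝ) (φ := fun _ : Fin 2 => ℝ) j) (g j) := by
    ext g; rfl
  rw [this]
  fun_prop

lemma ek_mk (k : Freq) (y : Fin 2 → ℝ) :
    ek k (mk y) = Complex.exp (∑ j, (y j : ℂ) * (2 * (Real.pi : ℂ) * Complex.I * (k j : ℂ))) := by
  simp only [ek, UnitAddTorus.mFourier, ContinuousMap.coe_mk, mk, Complex.exp_sum]
  refine Finset.prod_congr rfl fun j _ => ?_
  rw [fourier_coe_apply]
  congr 1; push_cast; ring

lemma hasFDerivAt_lift_ek (k : Freq) (y : Fin 2 → ℝ) :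
    HasFDerivAt (lift (ek k))
      (gradMap fun j => 2 * (Real.pi : ℂ) * Complex.I * (k j : ℂ) * ek k (mk y)) y := by
  have e : lift (ek k) = fun y : Fin 2 → ℝ =>
      Complex.exp (gradMap (fun j => 2 * (Real.pi : ℂ) * Complex.I * (k j : ℂ)) y) := by
    ext y
    rw [lift_apply, ek_mk, gradMap_apply]
    simp only [Complex.real_smul]
  rw [e]
  refine ((gradMap fun j => 2 * (Real.pi : ℂ) * Complex.I * (k j : ℂ)).hasFDerivAt.cexp).congr_fderiv
    ?_
  ext w
  have : Complex.exp (gradMap (fun j => 2 * (Real.pi : ℂ) * Complex.I * (k j : ℂ)) y)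
      = ek k (mk y) := (congrFun e y).symm
  rw [this]
  simp only [FunLike.coe_smul, Pi.smul_apply, gradMap_apply, smul_eq_mul, Complex.real_smul,
    Finset.mul_sum]
  exact Finset.sum_congr rfl fun j _ => by ring

lemma hasFDerivAt_lift_block (n : ℕ) (u : Dist) (y : Fin 2 → ℝ) :
    HasFDerivAt (lift (block χ n u)) (gradMap fun j => block χ n (dDist j u) (mk y)) y := by
  have e : lift (block χ n u) = fun y => ∑ k ∈ lball (4 / 3 * 2 ^ n),
      ((χ.cutoff n (freqVec k) : ℂ) * u k) • lift (ek k) y := by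
    ext y
    rw [lift_apply, block_eq_sum]; rfl
  rw [e]
  refine (HasFDerivAt.fun_sum fun k _ => (hasFDerivAt_lift_ek k y).const_smul
    ((χ.cutoff n (freqVec k) : ℂ) * u k)).congr_fderiv ?_
  ext w
  simp only [gradMap_apply, block_eq_sum, dDist, FunLike.coe_sum, Finset.sum_apply,
    FunLike.coe_smul, Pi.smul_apply, Finset.smul_sum, smul_eq_mul, Complex.real_smul]
  rw [Finset.sum_comm]
  refine Finset.sum_congr rfl fun k _ => ?_
  rw [Finset.mul_sum]
  exact Finset.sum_congr rfl fun j _ => by ring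

/-- `g` is the derivative of `f` in the `j`-th coordinate. -/
def HasPartial (j : Fin 2) (f g : Torus → ℂ) : Prop :=
  ∀ x, HasDerivAt (fun h : ℝ => f (x + Pi.single j (h : UnitAddCircle))) (g x) 0

lemma hasDerivAt_line {f : Torus → ℂ} {L : (Fin 2 → ℝ) →L[ℝ] ℂ} {y : Fin 2 → ℝ}
    (h : HasFDerivAt (lift f) L y) (j : Fin 2) :
    HasDerivAt (fun h : ℝ => f (mk y + Pi.single j (h : UnitAddCircle))) (L (Pi.single j 1)) 0 := by
  have e : (fun h : ℝ => f (mk y + Pi.single j (h : UnitAddCircle)))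
      = lift f ∘ fun h : ℝ => y + h • Pi.single j (1 : ℝ) := by
    ext h
    rw [Function.comp_apply, lift_apply]
    congr 1
    ext i
    by_cases hi : i = j
    · subst hi; simp [mk]
    · simp [mk, hi]
  rw [e]
  have h1 : HasDerivAt (fun h : ℝ => y + h • (Pi.single j (1 : ℝ) : Fin 2 → ℝ))
      (Pi.single j 1) 0 := by
    have := ((hasDerivAt_id (0 : ℝ)).smul_const (Pi.single j (1 : ℝ) : Fin 2 → ℝ)).const_add y
    simpa using this
  refine HasFDerivAt.comp_hasDerivAt (0 : ℝ) ?_ h1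
  simpa using h

lemma hasPartial_ek (k : Freq) (j : Fin 2) :
    HasPartial j (ek k) fun x => 2 * (Real.pi : ℂ) * Complex.I * (k j : ℂ) * ek k x := fun x => by
  obtain ⟨y, rfl⟩ := exists_mk x
  have := hasDerivAt_line (hasFDerivAt_lift_ek k y) j
  rwa [gradMap_single] at this

lemma HasPartial.partialDeriv_eq {j : Fin 2} {f g : Torus → ℂ} (h : HasPartial j f g) :
    partialDeriv j f = g := funext fun x => (h x).deriv

lemma HasPartial.at_shift {j : Fin 2} {f g : Torus → ℂ} (h : HasPartial j f g) (x : Torus) (s : ℝ) :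
    HasDerivAt (fun h : ℝ => f (x + Pi.single j (h : UnitAddCircle)))
      (g (x + Pi.single j (s : UnitAddCircle))) s := by
  have h1 := h (x + Pi.single j (s : UnitAddCircle))
  have h2 : HasDerivAt (fun r : ℝ => r - s) 1 s := (hasDerivAt_id s).sub_const s
  have h3 := HasDerivAt.scomp (h := fun r : ℝ => r - s) s (by rwa [sub_self]) h2
  rw [one_smul] at h3
  refine h3.congr_of_eventuallyEq (Eventually.of_forall fun r => ?_)
  show f _ = f _
  rw [add_assoc, ← Pi.single_add, ← AddCircle.coe_add, add_sub_cancel]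

lemma HasPartial.integral_eq_zero {j : Fin 2} {f g : Torus → ℂ} (h : HasPartial j f g)
    (hf : Continuous f) (hg : Continuous g) : ∫ x, g x ∂torusMeasure = 0 := by
  obtain ⟨C, hC⟩ := (isCompact_range hg).isBounded.exists_norm_le
  have hC' : ∀ x, ‖g x‖ ≤ C := fun x => hC _ ⟨x, rfl⟩
  have hshift : ∀ s : ℝ, Continuous fun x : Torus => x + Pi.single j (s : UnitAddCircle) :=
    fun s => continuous_id.add continuous_const
  have hfs : ∀ s : ℝ, Continuous fun x : Torus => f (x + Pi.single j (s : UnitAddCircle)) :=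
    fun s => hf.comp (hshift s)
  have hgs : ∀ s : ℝ, Continuous fun x : Torus => g (x + Pi.single j (s : UnitAddCircle)) :=
    fun s => hg.comp (hshift s)
  have key := hasDerivAt_integral_of_dominated_loc_of_deriv_le (μ := torusMeasure)
    (F := fun (s : ℝ) x => f (x + Pi.single j (s : UnitAddCircle)))
    (F' := fun (s : ℝ) x => g (x + Pi.single j (s : UnitAddCircle)))
    (x₀ := 0) (s := Set.univ) (bound := fun _ => C) Filter.univ_mem
    (Eventually.of_forall fun s => (integrable_of_continuous (hfs s)).1)
    (integrable_of_continuous (hfs 0))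
    (integrable_of_continuous (hgs 0)).1
    (Eventually.of_forall fun x s _ => hC' _) (integrable_const _)
    (Eventually.of_forall fun x s _ => h.at_shift x s)
  have e : (fun s : ℝ => ∫ x, f (x + Pi.single j (s : UnitAddCircle)) ∂torusMeasure)
      = fun _ => ∫ x, f x ∂torusMeasure := by
    ext s
    exact integral_add_right_eq_self f _
  rw [e] at key
  have := key.2.unique (hasDerivAt_const _ _)
  simpa using this

lemma HasPartial.mul {j : Fin 2} {f g f' g' : Torus → ℂ} (h : HasPartial j f f')
    (h' : HasPartial j g g') :
    HasPartial j (fun x => f x * g x) (fun x => f' x * g x + f x * g' x) := fun x => by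
  refine ((h x).fun_mul (h' x)).congr_deriv ?_
  simp

lemma HasPartial.ofFun_eq {j : Fin 2} {f g : Torus → ℂ} (h : HasPartial j f g)
    (hf : Continuous f) (hg : Continuous g) : ofFun g = dDist j (ofFun f) := by
  ext k
  have c1 := continuous_ek (-k)
  have h1 := ((hasPartial_ek (-k) j).mul h).integral_eq_zero (by fun_prop) (by fun_prop)
  rw [integral_add (integrable_of_continuous (by fun_prop))
    (integrable_of_continuous (by fun_prop))] at h1
  simp only [mul_assoc] at h1
  have e : ∀ x, (2 : ℂ) * (Real.pi * (Complex.I * (((-k) j : ℤ) * (ek (-k) x * f x))))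
      = (-(2 * Real.pi * Complex.I * (k j : ℂ))) * (ek (-k) x * f x) := fun x => by
    rw [Pi.neg_apply]; push_cast; ring
  simp only [e] at h1
  rw [integral_const_mul] at h1
  rw [dDist, ofFun_apply, ofFun_apply]
  linear_combination h1

/-- The function with Fourier coefficients `2πi k_j û(k)`. -/
def dfun (χ : DyadicPartition) (j : Fin 2) (u : Dist) (x : Torus) : ℂ :=
  ∑' n, block χ n (dDist j u) x

lemma continuous_dfun {s C : ℝ} (hs : 0 < s) {u : Dist} {j : Fin 2}
    (h : BlockBound χ s C (dDist j u)) : Continuous (dfun χ j u) :=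
  continuous_tsum (fun n => continuous_block χ n _) ((hasSum_dy hs).summable.mul_left C) h

lemma norm_dfun_le {s C : ℝ} (hs : 0 < s) {u : Dist} {j : Fin 2}
    (h : BlockBound χ s C (dDist j u)) (x : Torus) : ‖dfun χ j u x‖ ≤ C * geo s :=
  tsum_of_norm_bounded ((hasSum_dy hs).mul_left C) fun n => h n x

lemma c1_of_blockBound {β C s C' : ℝ} (hβ : 0 < β) (hs : 0 < s) {v : Torus → ℂ}
    (hv : Continuous v) (h : BlockBound χ β C (ofFun v))
    (h' : ∀ j, BlockBound χ s C' (dDist j (ofFun v))) :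
    ContDiff ℝ 1 (lift v) ∧ ∀ j, HasPartial j v (dfun χ j (ofFun v)) := by
  have hb : Summable fun n => 2 * (C' * dy (-s) n) :=
    ((hasSum_dy hs).summable.mul_left C').mul_left 2
  have hbd : ∀ n y, ‖gradMap fun j => block χ n (dDist j (ofFun v)) (mk y)‖ ≤ 2 * (C' * dy (-s) n) :=
    fun n y => by
    refine (norm_gradMap_le _).trans ?_
    rw [Fin.sum_univ_two, two_mul]
    exact add_le_add (h' 0 n _) (h' 1 n _)
  have hlift : lift v = fun y => ∑' n, lift (block χ n (ofFun v)) y := by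
    ext y
    exact (h.hasSum_block hβ hv (mk y)).tsum_eq.symm
  have hd : ∀ y, HasFDerivAt (lift v)
      (∑' n, gradMap fun j => block χ n (dDist j (ofFun v)) (mk y)) y := fun y => by
    rw [hlift]
    exact hasFDerivAt_tsum hb (fun n y => hasFDerivAt_lift_block n _ y) hbd
      (h.hasSum_block hβ hv (mk 0)).summable y
  refine ⟨?_, fun j x => ?_⟩
  · rw [contDiff_one_iff_hasFDerivAt]
    refine ⟨_, continuous_tsum (fun n => ?_) hb hbd, hd⟩
    exact continuous_gradMap.comp (continuous_pi fun j =>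
      (continuous_block χ n _).comp continuous_mk)
  · obtain ⟨y, rfl⟩ := exists_mk x
    have h1 := hasDerivAt_line (hd y) j
    have h2 : HasSum (fun n => gradMap fun j => block χ n (dDist j (ofFun v)) (mk y)) _ :=
      (Summable.of_norm_bounded hb fun n => hbd n y).hasSum
    have h3 := (ContinuousLinearMap.apply ℝ ℂ (Pi.single j (1 : ℝ) : Fin 2 → ℝ)).hasSum h2
    simp only [ContinuousLinearMap.apply_apply, gradMap_single] at h3
    rw [← h3.tsum_eq] at h1
    exact h1

/-! ### The function `|z|^{2p-2} z̄` -/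

/-- The function `|z|^{2p-2} z̄`. -/
def powConj (p : ℝ) (z : ℂ) : ℂ := ((‖z‖ ^ (2 * p - 2) : ℝ) : ℂ) * (starRingEnd ℂ) z

/-- The derivative of `|z|^{2p-2} z̄` in the direction `w`. -/
def dPowConj (p : ℝ) (z w : ℂ) : ℂ :=
  ((‖z‖ ^ (2 * p - 2) : ℝ) : ℂ) * (starRingEnd ℂ) w
    + (((2 * p - 2) * ‖z‖ ^ (2 * p - 4) * ((starRingEnd ℂ) z * w).re : ℝ) : ℂ) * (starRingEnd ℂ) z

lemma continuous_powConj {p : ℝ} (hp : 1 ≤ p) : Continuous (powConj p) := by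
  unfold powConj
  refine (Complex.continuous_ofReal.comp (continuous_norm.rpow_const fun x => ?_)).mul
    Complex.continuous_conj
  right; linarith

lemma norm_powConj {p : ℝ} (z : ℂ) : ‖powConj p z‖ = ‖z‖ ^ (2 * p - 2) * ‖z‖ := by
  rw [powConj, norm_mul, RCLike.norm_conj, Complex.norm_real, Real.norm_eq_abs,
    abs_of_nonneg (by positivity)]

lemma powConj_mul_self {p : ℝ} (hp : 1 ≤ p) (z : ℂ) : powConj p z * z = ((‖z‖ ^ (2 * p) : ℝ) : ℂ) := by
  rw [powConj, mul_assoc, Complex.conj_mul', ← Complex.ofReal_pow, ← Complex.ofReal_mul]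
  congr 1
  rcases eq_or_ne z 0 with rfl | hz
  · rw [norm_zero, Real.zero_rpow (x := 2 * p) (by linarith)]; simp
  · rw [← Real.rpow_natCast, ← Real.rpow_add (norm_pos_iff.2 hz)]; congr 1; push_cast; ring

lemma hasDerivAt_powConj {p : ℝ} (hp : 1 ≤ p) {z : ℝ → ℂ} {w : ℂ} {t : ℝ} (h : HasDerivAt z w t) :
    HasDerivAt (fun s => powConj p (z s)) (dPowConj p (z t) w) t := by
  have hconj : HasDerivAt (fun s => (starRingEnd ℂ) (z s)) ((starRingEnd ℂ) w) t := h.star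
  rcases hp.eq_or_lt with rfl | hp
  · have e : ∀ z, powConj 1 z = (starRingEnd ℂ) z := fun z => by simp [powConj]
    have e2 : dPowConj 1 (z t) w = (starRingEnd ℂ) w := by simp [dPowConj]
    simp only [e, e2]; exact hconj
  rcases eq_or_ne (z t) 0 with h0 | h0
  · have e2 : dPowConj p (z t) w = 0 := by
      rw [dPowConj, h0, norm_zero, Real.zero_rpow (by linarith)]; simp
    rw [e2, hasDerivAt_iff_isLittleO]
    have e3 : powConj p (z t) = 0 := by rw [h0]; simp [powConj]
    simp only [e3, sub_zero, smul_zero]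
    have hO : (fun s => z s) =O[𝓝 t] fun s => s - t := by
      have := h.isBigO_sub
      simpa [h0] using this
    have ho : (fun s => ((‖z s‖ ^ (2 * p - 2) : ℝ) : ℂ)) =o[𝓝 t] fun _ => (1 : ℝ) := by
      rw [Asymptotics.isLittleO_one_iff]
      have h1 : Tendsto (fun s => ‖z s‖ ^ (2 * p - 2)) (𝓝 t) (𝓝 (‖z t‖ ^ (2 * p - 2))) :=
        (h.continuousAt.norm.rpow_const (Or.inr (by linarith)))
      rw [h0, norm_zero, Real.zero_rpow (by linarith)] at h1
      have := (Complex.continuous_ofReal.tendsto 0).comp h1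
      simpa [Function.comp_def] using this
    have hO2 : (fun s => (starRingEnd ℂ) (z s)) =O[𝓝 t] fun s => s - t :=
      (Asymptotics.isBigO_norm_left.1 (by simpa [RCLike.norm_conj] using hO.norm_left))
    have := ho.mul_isBigO hO2
    simpa [powConj] using this
  · have hn : 0 < ‖z t‖ := norm_pos_iff.2 h0
    have e : ∀ z : ℂ, ‖z‖ ^ (2 * p - 2) = (‖z‖ ^ 2) ^ (p - 1) := fun z => by
      rw [← Real.rpow_natCast, ← Real.rpow_mul (norm_nonneg _)]; congr 1; push_cast; ring
    have h1 := (h.norm_sq.rpow_const (p := p - 1) (Or.inl (by positivity))).ofReal_comp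
    have h2 := h1.mul hconj
    have h3 : (fun s => powConj p (z s)) = fun s => (((‖z s‖ ^ 2) ^ (p - 1) : ℝ) : ℂ) *
        (starRingEnd ℂ) (z s) := by ext s; rw [powConj, e]
    rw [h3]
    refine h2.congr_deriv ?_
    have e4 : (‖z t‖ ^ 2) ^ (p - 1 - 1) = ‖z t‖ ^ (2 * p - 4) := by
      rw [← Real.rpow_natCast, ← Real.rpow_mul (norm_nonneg _)]; congr 1; push_cast; ring
    rw [dPowConj, e4, e, Complex.inner, mul_comm w]
    push_cast
    ring

lemma rpow_sub_mul_sq {q r : ℝ} (hr : 0 < r) : r ^ (2 * q - 4) * r ^ 2 = r ^ (2 * q - 2) := by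
  rw [← Real.rpow_natCast, ← Real.rpow_add hr]; congr 1; push_cast; ring

lemma norm_dPowConj_le {p : ℝ} (hp : 1 ≤ p) (z w : ℂ) :
    ‖dPowConj p z w‖ ≤ (2 * p - 1) * (‖z‖ ^ (2 * p - 2) * ‖w‖) := by
  have h1 : ‖((‖z‖ ^ (2 * p - 2) : ℝ) : ℂ) * (starRingEnd ℂ) w‖ = ‖z‖ ^ (2 * p - 2) * ‖w‖ := by
    rw [norm_mul, RCLike.norm_conj, Complex.norm_real, Real.norm_eq_abs,
      abs_of_nonneg (by positivity)]
  have h2 : ‖(((2 * p - 2) * ‖z‖ ^ (2 * p - 4) * ((starRingEnd ℂ) z * w).re : ℝ) : ℂ) *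
      (starRingEnd ℂ) z‖ ≤ (2 * p - 2) * (‖z‖ ^ (2 * p - 2) * ‖w‖) := by
    rcases eq_or_ne z 0 with rfl | hz
    · rw [map_zero, mul_zero, norm_zero]
      exact mul_nonneg (by linarith) (by positivity)
    · have hn : 0 < ‖z‖ := norm_pos_iff.2 hz
      rw [norm_mul, RCLike.norm_conj, Complex.norm_real, Real.norm_eq_abs, abs_mul,
        abs_of_nonneg (mul_nonneg (by linarith) (by positivity) :
          0 ≤ (2 * p - 2) * ‖z‖ ^ (2 * p - 4))]
      have h3 : |((starRingEnd ℂ) z * w).re| ≤ ‖z‖ * ‖w‖ := by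
        refine (Complex.abs_re_le_norm _).trans (le_of_eq ?_)
        rw [norm_mul, RCLike.norm_conj]
      rw [← rpow_sub_mul_sq hn]
      have h4 : 0 ≤ (2 * p - 2) * ‖z‖ ^ (2 * p - 4) := mul_nonneg (by linarith) (by positivity)
      calc _ ≤ (2 * p - 2) * ‖z‖ ^ (2 * p - 4) * (‖z‖ * ‖w‖) * ‖z‖ := by gcongr
        _ = _ := by ring
  rw [dPowConj]
  refine (norm_add_le _ _).trans ?_
  rw [h1]; linarith

lemma continuous_dPowConj {p : ℝ} (hp : 1 ≤ p) :
    Continuous fun q : ℂ × ℂ => dPowConj p q.1 q.2 := by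
  rcases hp.eq_or_lt with rfl | hp'
  · have : (fun q : ℂ × ℂ => dPowConj 1 q.1 q.2) = fun q => (starRingEnd ℂ) q.2 := by
      ext q; simp [dPowConj]
    rw [this]; exact Complex.continuous_conj.comp continuous_snd
  rw [continuous_iff_continuousAt]
  rintro ⟨z, w⟩
  rcases eq_or_ne z 0 with rfl | hz
  · have e : dPowConj p 0 w = 0 := by
      rw [dPowConj, norm_zero, Real.zero_rpow (by linarith)]; simp
    rw [ContinuousAt, e]
    refine squeeze_zero_norm (fun q => norm_dPowConj_le hp q.1 q.2) ?_
    have h1 : ContinuousAt (fun q : ℂ × ℂ => (2 * p - 1) * (‖q.1‖ ^ (2 * p - 2) * ‖q.2‖)) (0, w) :=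
      continuousAt_const.mul ((continuousAt_fst.norm.rpow_const (Or.inr (by linarith))).mul
        continuousAt_snd.norm)
    have h2 := h1.tendsto
    simp only [norm_zero] at h2
    rwa [Real.zero_rpow (by linarith), zero_mul, mul_zero] at h2
  · have hn : ‖z‖ ≠ 0 := norm_ne_zero_iff.2 hz
    have c1 : ContinuousAt (fun q : ℂ × ℂ => ‖q.1‖ ^ (2 * p - 2)) (z, w) :=
      continuousAt_fst.norm.rpow_const (Or.inl hn)
    have c2 : ContinuousAt (fun q : ℂ × ℂ => ‖q.1‖ ^ (2 * p - 4)) (z, w) :=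
      continuousAt_fst.norm.rpow_const (Or.inl hn)
    have c3 : Continuous fun q : ℂ × ℂ => ((starRingEnd ℂ) q.1 * q.2).re :=
      Complex.continuous_re.comp ((Complex.continuous_conj.comp continuous_fst).mul continuous_snd)
    unfold dPowConj
    exact ((Complex.continuous_ofReal.continuousAt.comp c1).mul
      (Complex.continuous_conj.comp continuous_snd).continuousAt).add
      ((Complex.continuous_ofReal.continuousAt.comp
        ((continuousAt_const.mul c2).mul c3.continuousAt)).mul
        (Complex.continuous_conj.comp continuous_fst).continuousAt)

/-- The coercivity of the dispersive Laplacian tested against `|v|^{2p-2} v̄`. -/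
lemma coercivity {μ p δ : ℝ} (hμ : 0 < μ) (hp : 1 ≤ p) (hδ₁ : δ < 1)
    (hδ : (p - 1) / (μ * (μ + √(1 + μ ^ 2))) ≤ 1 - δ) (z w : ℂ) :
    δ * μ * (‖w‖ ^ 2 * ‖z‖ ^ (2 * p - 2)) ≤ ((Complex.I + (μ : ℂ)) * (dPowConj p z w * w)).re := by
  have hre : ((Complex.I + (μ : ℂ)) * (dPowConj p z w * w)).re =
      μ * (‖z‖ ^ (2 * p - 2) * ‖w‖ ^ 2) + (2 * p - 2) * ‖z‖ ^ (2 * p - 4) *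
        (((starRingEnd ℂ) z * w).re * (μ * ((starRingEnd ℂ) z * w).re
          - ((starRingEnd ℂ) z * w).im)) := by
    have e : dPowConj p z w * w = ((‖z‖ ^ (2 * p - 2) * ‖w‖ ^ 2 : ℝ) : ℂ)
        + (((2 * p - 2) * ‖z‖ ^ (2 * p - 4) * ((starRingEnd ℂ) z * w).re : ℝ) : ℂ) *
          ((starRingEnd ℂ) z * w) := by
      rw [dPowConj, add_mul, mul_assoc, Complex.conj_mul']; push_cast; ring
    rw [e]
    simp only [Complex.mul_re, Complex.add_re, Complex.I_re, Complex.add_im, Complex.I_im,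
      Complex.ofReal_re, Complex.ofReal_im, Complex.mul_im]
    ring
  rw [hre]
  rcases eq_or_ne z 0 with rfl | hz
  · simp only [map_zero, zero_mul, Complex.zero_re, mul_zero, add_zero]
    have : 0 ≤ μ * (‖(0 : ℂ)‖ ^ (2 * p - 2) * ‖w‖ ^ 2) := by positivity
    nlinarith
  have hn : 0 < ‖z‖ := norm_pos_iff.2 hz
  set a := ((starRingEnd ℂ) z * w).re
  set b := ((starRingEnd ℂ) z * w).im
  have hab : a ^ 2 + b ^ 2 = ‖z‖ ^ 2 * ‖w‖ ^ 2 := by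
    have : Complex.normSq ((starRingEnd ℂ) z * w) = ‖z‖ ^ 2 * ‖w‖ ^ 2 := by
      rw [Complex.normSq_eq_norm_sq, norm_mul, RCLike.norm_conj, mul_pow]
    rw [← this, Complex.normSq_apply]; ring
  have hY : ‖z‖ ^ (2 * p - 2) * ‖w‖ ^ 2 = ‖z‖ ^ (2 * p - 4) * (a ^ 2 + b ^ 2) := by
    rw [hab, ← rpow_sub_mul_sq hn]; ring
  have hYpos : 0 ≤ ‖z‖ ^ (2 * p - 4) := by positivity
  rw [mul_comm (‖w‖ ^ 2), hY]
  set s := √(1 + μ ^ 2) with hs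
  have hs2 : s ^ 2 = 1 + μ ^ 2 := Real.sq_sqrt (by positivity)
  have hs0 : 0 ≤ s := Real.sqrt_nonneg _
  set κ := μ + s with hκ
  have hκ0 : 0 < κ := by positivity
  have h1 : p - 1 ≤ (1 - δ) * (μ * κ) := by
    rwa [div_le_iff₀ (by positivity)] at hδ
  have hκμ : κ ^ 2 = 1 + 2 * μ * κ := by rw [hκ]; nlinarith
  have h2 : 0 ≤ κ * (2 * (a * (μ * a - b))) + (a ^ 2 + b ^ 2) := by
    nlinarith [sq_nonneg (κ * a - b)]
  have main : 0 ≤ (1 - δ) * μ * (a ^ 2 + b ^ 2) + 2 * (p - 1) * (a * (μ * a - b)) := by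
    have h3 : 0 ≤ (p - 1) * (κ * (2 * (a * (μ * a - b))) + (a ^ 2 + b ^ 2)) :=
      mul_nonneg (by linarith) h2
    have h4 : (p - 1) * (a ^ 2 + b ^ 2) ≤ (1 - δ) * (μ * κ) * (a ^ 2 + b ^ 2) := by gcongr
    have h5 : 0 ≤ κ * ((1 - δ) * μ * (a ^ 2 + b ^ 2) + 2 * (p - 1) * (a * (μ * a - b))) := by
      nlinarith
    exact nonneg_of_mul_nonneg_right h5 hκ0
  nlinarith [mul_nonneg hYpos main]

/-- Convexity of `|z|^{2p}`. -/
lemma convexity {p : ℝ} (hp : 1 ≤ p) (a b : ℂ) :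
    ‖a‖ ^ (2 * p) + 2 * p * (powConj p a * (b - a)).re ≤ ‖b‖ ^ (2 * p) := by
  rcases eq_or_ne a 0 with rfl | ha
  · have : powConj p 0 = 0 := by simp [powConj]
    rw [this, norm_zero, Real.zero_rpow (by linarith)]
    simp; positivity
  have hn : 0 < ‖a‖ := norm_pos_iff.2 ha
  have h1 : (powConj p a * (b - a)).re ≤ ‖a‖ ^ (2 * p - 2) * ‖a‖ * ‖b‖ - ‖a‖ ^ (2 * p) := by
    rw [mul_sub, powConj_mul_self hp, Complex.sub_re, Complex.ofReal_re]
    have := Complex.re_le_norm (powConj p a * b)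
    rw [norm_mul, norm_powConj] at this
    linarith
  have e1 : ‖a‖ ^ (2 * p - 2) * ‖a‖ * ‖b‖ = ‖a‖ ^ (2 * p) * (‖b‖ / ‖a‖) := by
    have : ‖a‖ ^ (2 * p) = ‖a‖ ^ (2 * p - 2) * ‖a‖ ^ 2 := by
      rw [← Real.rpow_natCast, ← Real.rpow_add hn]; congr 1; push_cast; ring
    rw [this]; field_simp
  have bern := one_add_mul_self_le_rpow_one_add (s := ‖b‖ / ‖a‖ - 1)
    (by have : 0 ≤ ‖b‖ / ‖a‖ := by positivity
        linarith) (p := 2 * p) (by linarith)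
  rw [add_sub_cancel, Real.div_rpow (norm_nonneg _) hn.le] at bern
  have hpos : 0 < ‖a‖ ^ (2 * p) := Real.rpow_pos_of_pos hn _
  have h2 : ‖a‖ ^ (2 * p) * (1 + 2 * p * (‖b‖ / ‖a‖ - 1)) ≤ ‖b‖ ^ (2 * p) := by
    calc _ ≤ ‖a‖ ^ (2 * p) * (‖b‖ ^ (2 * p) / ‖a‖ ^ (2 * p)) := by gcongr
      _ = _ := by field_simp
  rw [e1] at h1
  nlinarith

end

section

variable {χ : DyadicPartition}

/-! ### Uniform regularity on `[s₀, T]` -/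

lemma norm_dDist_sq (j : Fin 2) (u : Dist) (k : Freq) :
    ‖dDist j u k‖ ^ 2 = 4 * Real.pi ^ 2 * (k j : ℝ) ^ 2 * ‖u k‖ ^ 2 := by
  have h : ‖((k j : ℤ) : ℂ)‖ = |(k j : ℝ)| := by
    rw [← Complex.ofReal_intCast, Complex.norm_real, Real.norm_eq_abs]
  rw [dDist, norm_mul, norm_mul, norm_mul, norm_mul, Complex.norm_I, Complex.norm_real, h,
    Real.norm_eq_abs, abs_of_pos Real.pi_pos]
  simp only [mul_pow, sq_abs, Complex.norm_ofNat]
  ring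

lemma wt_sq_le (k : Freq) (hk : k ≠ 0) : wt k ^ 2 ≤ 4 * ((k 0 : ℝ) ^ 2 + (k 1 : ℝ) ^ 2) := by
  have h1 : (1 : ℝ) ≤ (k 0 : ℝ) ^ 2 + (k 1 : ℝ) ^ 2 := by
    have : k 0 ≠ 0 ∨ k 1 ≠ 0 := by
      by_contra! h
      exact hk (funext fun i => by fin_cases i <;> simp [h.1, h.2])
    have h2 : (1 : ℤ) ≤ k 0 ^ 2 + k 1 ^ 2 := by
      rcases this with h | h
      · have := Int.one_le_abs h; nlinarith [sq_abs (k 0), sq_nonneg (k 1)]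
      · have := Int.one_le_abs h; nlinarith [sq_abs (k 1), sq_nonneg (k 0)]
    exact_mod_cast h2
  rw [← norm_freqVec_sq] at h1 ⊢
  unfold wt
  have := norm_nonneg (freqVec k)
  nlinarith

lemma wBound_of_dDist {s M₀ M : ℝ} {u : Dist} (h₀ : ∀ S : Finset Freq, ∑ k ∈ S, ‖u k‖ ^ 2 ≤ M₀)
    (h : ∀ j, WBound s M (dDist j u)) : WBound (1 + s) (M₀ + (M + M)) u := fun S => by
  refine le_trans ?_ (add_le_add (h₀ S) (add_le_add (h 0 S) (h 1 S)))
  rw [← Finset.sum_add_distrib, ← Finset.sum_add_distrib]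
  refine Finset.sum_le_sum fun k _ => ?_
  rw [norm_dDist_sq, norm_dDist_sq]
  have hw := wt_pos k
  have hws : 0 < wt k ^ (2 * s) := Real.rpow_pos_of_pos hw _
  rcases eq_or_ne k 0 with rfl | hk
  · have : wt 0 = 1 := by
      have : freqVec 0 = 0 := by ext i; simp [freqVec]
      rw [wt, this, norm_zero, add_zero]
    simp [this]
  · have e : wt k ^ (2 * (1 + s)) = wt k ^ (2 * s) * wt k ^ 2 := by
      rw [← Real.rpow_natCast, ← Real.rpow_add hw]; congr 1; push_cast; ring
    have h1 := wt_sq_le k hk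
    have hpi : (1 : ℝ) ≤ Real.pi ^ 2 := by nlinarith [Real.pi_gt_three]
    have h2 : wt k ^ 2 ≤ 4 * Real.pi ^ 2 * ((k 0 : ℝ) ^ 2 + (k 1 : ℝ) ^ 2) := by
      nlinarith [sq_nonneg (k 0 : ℝ), sq_nonneg (k 1 : ℝ)]
    rw [e]
    calc wt k ^ (2 * s) * wt k ^ 2 * ‖u k‖ ^ 2
        ≤ wt k ^ (2 * s) * (4 * Real.pi ^ 2 * ((k 0 : ℝ) ^ 2 + (k 1 : ℝ) ^ 2)) * ‖u k‖ ^ 2 := by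
          gcongr
      _ = 0 + (wt k ^ (2 * s) * (4 * Real.pi ^ 2 * (k 0 : ℝ) ^ 2 * ‖u k‖ ^ 2)
          + wt k ^ (2 * s) * (4 * Real.pi ^ 2 * (k 1 : ℝ) ^ 2 * ‖u k‖ ^ 2)) := by ring
      _ ≤ _ := by gcongr; positivity

lemma wBound_zero_of_bound {f : Torus → ℂ} (hf : Continuous f) {C : ℝ} (h : ∀ x, ‖f x‖ ≤ C) :
    WBound 0 (C ^ 2) (ofFun f) := fun S => by
  simpa using bessel hf h S

lemma HasPartial.powConj {j : Fin 2} {f g : Torus → ℂ} {p : ℝ} (hp : 1 ≤ p)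
    (h : HasPartial j f g) :
    HasPartial j (fun x => powConj p (f x)) (fun x => dPowConj p (f x) (g x)) := fun x => by
  refine (hasDerivAt_powConj hp (h x)).congr_deriv ?_
  simp

lemma norm_powConj_le {p B : ℝ} (hp : 1 ≤ p) {z : ℂ} (h : ‖z‖ ≤ B) :
    ‖powConj p z‖ ≤ B ^ (2 * p - 2) * B := by
  have hB : 0 ≤ B := (norm_nonneg _).trans h
  rw [norm_powConj]
  have : ‖z‖ ^ (2 * p - 2) ≤ B ^ (2 * p - 2) :=
    Real.rpow_le_rpow (norm_nonneg _) h (by linarith)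
  gcongr

lemma norm_symb_le {μ : ℝ} (hμ : 0 < μ) (k : Freq) :
    ‖symb μ k‖ ≤ (1 + 4 * Real.pi ^ 2 * (1 + μ)) * wt k ^ 2 := by
  have h1 : ‖Complex.I + (μ : ℂ)‖ ≤ 1 + μ := by
    refine (norm_add_le _ _).trans ?_
    rw [Complex.norm_I, Complex.norm_real, Real.norm_eq_abs, abs_of_pos hμ]
  have hn := norm_nonneg (freqVec k)
  have h2 : ‖freqVec k‖ ^ 2 ≤ wt k ^ 2 := by unfold wt; gcongr; linarith
  have h3 : 1 ≤ wt k ^ 2 := one_le_pow₀ (one_le_wt k)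
  have h4 : ‖4 * (Real.pi : ℂ) ^ 2 * (Complex.I + (μ : ℂ)) * ((‖freqVec k‖ ^ 2 : ℝ) : ℂ)‖
      ≤ 4 * Real.pi ^ 2 * (1 + μ) * wt k ^ 2 := by
    rw [norm_mul, norm_mul, norm_mul, norm_pow, Complex.norm_real, Complex.norm_real,
      Real.norm_eq_abs, Real.norm_eq_abs, sq_abs, abs_of_nonneg (sq_nonneg _), Complex.norm_ofNat]
    gcongr
  refine (norm_add_le _ _).trans ?_
  rw [norm_one]
  linarith

/-- The right-hand side of the equation for the Fourier coefficients. -/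
def rhsDist (m : ℕ) (μ : ℝ) (ν τ : ℂ) (D : DrivingData) (f : Torus → ℂ) (t : ℝ) : Dist :=
  fun k => -symb μ k * ofFun f k + Psi m ν τ D f t k

section Reg

variable {m : ℕ} {μ : ℝ} {ν τ : ℂ} {D : DrivingData} {β γ T : ℝ} {u₀ : Dist}
  {v : ℝ → Torus → ℂ}

lemma Setting.contDiff_sol (H : Setting χ m μ ν τ D β γ T u₀ v) {t : ℝ} (ht : t ∈ Set.Ioc 0 T) :
    ContDiff ℝ 1 (lift (v t)) ∧ ∀ j, HasPartial j (v t) (dfun χ j (ofFun (v t))) := by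
  obtain ⟨B, -, hB⟩ := H.exists_blockBound_sol
  obtain ⟨C, -, hC⟩ := H.exists_blockBound_grad ht.1
  exact c1_of_blockBound H.hβ (by norm_num : (0 : ℝ) < 1 / 4) (H.hv.continuous t ht) (hB t ht)
    (hC t ⟨le_rfl, ht.2⟩)

lemma Setting.continuous_dfun_sol (H : Setting χ m μ ν τ D β γ T u₀ v)
    {t : ℝ} (ht : t ∈ Set.Ioc 0 T) (j : Fin 2) :
    Continuous (dfun χ j (ofFun (v t))) := by
  obtain ⟨C, -, hC⟩ := H.exists_blockBound_grad ht.1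
  exact continuous_dfun (by norm_num : (0 : ℝ) < 1 / 4) (hC t ⟨le_rfl, ht.2⟩ j)

lemma Setting.exists_bound_dfun (H : Setting χ m μ ν τ D β γ T u₀ v)
    {s₀ : ℝ} (hs₀ : 0 < s₀) : ∃ C : ℝ, 0 ≤ C ∧
    ∀ t ∈ Set.Icc s₀ T, ∀ j x, ‖dfun χ j (ofFun (v t)) x‖ ≤ C := by
  obtain ⟨C, hC0, hC⟩ := H.exists_blockBound_grad hs₀
  have := geo_pos (by norm_num : (0 : ℝ) < 1 / 4)
  exact ⟨C * geo (1 / 4), by positivity, fun t ht j x => norm_dfun_le (by norm_num) (hC t ht j) x⟩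

lemma Setting.exists_wBound_sol (H : Setting χ m μ ν τ D β γ T u₀ v)
    {s₀ : ℝ} (hs₀ : 0 < s₀) : ∃ M : ℝ,
    ∀ t ∈ Set.Icc s₀ T, WBound (9 / 8) M (ofFun (v t)) := by
  obtain ⟨C, hC0, hC⟩ := H.exists_blockBound_grad hs₀
  obtain ⟨B, hB0, hB⟩ := H.exists_bound_sol_unif hs₀
  set K := 4 ^ |2 * (1 / 8 : ℝ)| * geo (1 / 4 - 1 / 8) ^ 2 * C ^ 2
  refine ⟨B ^ 2 + (K + K), fun t ht => ?_⟩
  rw [show (9 / 8 : ℝ) = 1 + 1 / 8 by norm_num]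
  exact wBound_of_dDist (bessel (H.hv.continuous t ⟨hs₀.trans_le ht.1, ht.2⟩) (hB t ht))
    fun j => (hC t ht j).wBound (s' := 1 / 8) (by norm_num)

lemma Setting.continuous_test (H : Setting χ m μ ν τ D β γ T u₀ v)
    {p : ℝ} (hp : 1 ≤ p) {t : ℝ} (ht : t ∈ Set.Ioc 0 T) :
    Continuous fun x => powConj p (v t x) :=
  (continuous_powConj hp).comp (H.hv.continuous t ht)

lemma Setting.continuous_dtest (H : Setting χ m μ ν τ D β γ T u₀ v)
    {p : ℝ} (hp : 1 ≤ p) {t : ℝ} (ht : t ∈ Set.Ioc 0 T) (j : Fin 2) :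
    Continuous fun x => dPowConj p (v t x) (dfun χ j (ofFun (v t)) x) :=
  (continuous_dPowConj hp).comp ((H.hv.continuous t ht).prodMk (H.continuous_dfun_sol ht j))

lemma Setting.exists_wBound_test (H : Setting χ m μ ν τ D β γ T u₀ v)
    {p : ℝ} (hp : 1 ≤ p) {s₀ : ℝ} (hs₀ : 0 < s₀) : ∃ M : ℝ,
    ∀ t ∈ Set.Icc s₀ T, WBound 1 M (ofFun fun x => powConj p (v t x)) := by
  obtain ⟨C, hC0, hC⟩ := H.exists_bound_dfun hs₀
  obtain ⟨B, hB0, hB⟩ := H.exists_bound_sol_unif hs₀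
  set K := ((2 * p - 1) * (B ^ (2 * p - 2) * C)) ^ 2
  refine ⟨(B ^ (2 * p - 2) * B) ^ 2 + (K + K), fun t ht => ?_⟩
  have ht' : t ∈ Set.Ioc 0 T := ⟨hs₀.trans_le ht.1, ht.2⟩
  have c1 := H.continuous_test hp ht'
  have := wBound_of_dDist (s := 0) (M := K)
    (bessel c1 fun x => norm_powConj_le hp (hB t ht x)) fun j => by
      rw [← (((H.contDiff_sol ht').2 j).powConj hp).ofFun_eq c1 (H.continuous_dtest hp ht' j)]
      refine wBound_zero_of_bound (H.continuous_dtest hp ht' j) fun x => ?_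
      refine (norm_dPowConj_le hp _ _).trans ?_
      have h1 : ‖v t x‖ ^ (2 * p - 2) ≤ B ^ (2 * p - 2) :=
        Real.rpow_le_rpow (norm_nonneg _) (hB t ht x) (by linarith)
      have h2 := hC t ht j x
      have h3 : 0 ≤ 2 * p - 1 := by linarith
      gcongr
  rw [add_zero] at this
  exact this

lemma Setting.exists_wBound_Psi (H : Setting χ m μ ν τ D β γ T u₀ v)
    {s₀ σ : ℝ} (hs₀ : 0 < s₀) (hσ : 0 < σ) : ∃ M : ℝ,
    ∀ t ∈ Set.Icc s₀ T, WBound (-σ) M (Psi m ν τ D (v t) t) := by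
  have hβ := H.hβ
  set α := min (min β 1) σ / 2 with hα
  have h1 : min (min β 1) σ ≤ β := (min_le_left _ _).trans (min_le_left _ _)
  have h2 : min (min β 1) σ ≤ 1 := (min_le_left _ _).trans (min_le_right _ _)
  have h3 : min (min β 1) σ ≤ σ := min_le_right _ _
  have h0 : 0 < min (min β 1) σ := by positivity
  obtain ⟨C, hC0, hC⟩ := H.exists_dualBound_Psi_unif (α := α) ⟨by linarith, by linarith⟩
    (by linarith) hs₀
  exact ⟨_, fun t ht => (hC t ht).wBound hC0 (by linarith) (by linarith)⟩

lemma Setting.exists_wBound_rhs (H : Setting χ m μ ν τ D β γ T u₀ v)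
    {s₀ : ℝ} (hs₀ : 0 < s₀) : ∃ M : ℝ,
    ∀ t ∈ Set.Icc s₀ T, WBound (-(7 / 8)) M (rhsDist m μ ν τ D (v t) t) := by
  obtain ⟨M, hM⟩ := H.exists_wBound_sol hs₀
  obtain ⟨M', hM'⟩ := H.exists_wBound_Psi hs₀ (by norm_num : (0 : ℝ) < 7 / 8)
  set K := 1 + 4 * Real.pi ^ 2 * (1 + μ)
  refine ⟨2 * (K ^ 2 * M) + 2 * M', fun t ht => ?_⟩
  have h1 : WBound (-(7 / 8)) (K ^ 2 * M) fun k => -symb μ k * ofFun (v t) k := fun S => by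
    refine le_trans ?_ (mul_le_mul_of_nonneg_left (hM t ht S) (sq_nonneg K))
    rw [Finset.mul_sum]
    refine Finset.sum_le_sum fun k _ => ?_
    have hw := wt_pos k
    have e : wt k ^ (2 * (9 / 8 : ℝ)) = wt k ^ (2 * (-(7 / 8) : ℝ)) * (wt k ^ 2) ^ 2 := by
      rw [← pow_mul, ← Real.rpow_natCast, ← Real.rpow_add hw]; norm_num
    rw [norm_mul, norm_neg, mul_pow, e]
    have h2 := norm_symb_le H.hμ k
    calc _ ≤ wt k ^ (2 * (-(7 / 8) : ℝ)) * ((K * wt k ^ 2) ^ 2 * ‖ofFun (v t) k‖ ^ 2) := by gcongr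
      _ = _ := by ring
  exact h1.add (hM' t ht)

lemma Setting.wBound_diffQuot (H : Setting χ m μ ν τ D β γ T u₀ v) {s₀ M : ℝ} (hs₀ : 0 < s₀)
    (hM : ∀ t ∈ Set.Icc s₀ T, WBound (-(7 / 8)) M (rhsDist m μ ν τ D (v t) t)) {r t : ℝ}
    (hr : r ∈ Set.Icc s₀ T) (ht : t ∈ Set.Icc s₀ T) :
    WBound (-(7 / 8)) M fun k => ((r - t : ℝ) : ℂ)⁻¹ * (ofFun (v r) k - ofFun (v t) k) := fun S => by
  have hM0 : 0 ≤ M := (hM t ht).nonneg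
  rcases eq_or_ne r t with rfl | hne
  · simpa using hM0
  let L := (PiLp.continuousLinearEquiv 2 ℝ fun _ : S => ℂ).symm
  let w : Freq → ℂ := fun k => ((wt k ^ (-(7 / 8) : ℝ) : ℝ) : ℂ)
  have hw : ∀ (u : ℂ) k, ‖w k * u‖ ^ 2 = wt k ^ (2 * (-(7 / 8) : ℝ)) * ‖u‖ ^ 2 := fun u k => by
    have h0 : 0 ≤ wt k ^ (-(7 / 8) : ℝ) := Real.rpow_nonneg (wt_pos k).le _
    rw [norm_mul, mul_pow, Complex.norm_real, Real.norm_eq_abs, abs_of_nonneg h0,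
      ← Real.rpow_natCast, ← Real.rpow_mul (wt_pos k).le, mul_comm (2 : ℝ)]
    norm_num
  have hn : ∀ u : Dist, ‖L fun k : S => w k * u k‖ ^ 2
      = ∑ k ∈ S, wt k ^ (2 * (-(7 / 8) : ℝ)) * ‖u k‖ ^ 2 := fun u => by
    rw [EuclideanSpace.norm_sq_eq, ← Finset.sum_coe_sort S]
    exact Finset.sum_congr rfl fun k _ => hw (u k) k
  have hd : ∀ θ ∈ Set.Icc s₀ T, HasDerivWithinAt (fun r => L fun k : S => w k * ofFun (v r) k)
      (L fun k : S => w k * rhsDist m μ ν τ D (v θ) θ k) (Set.Icc s₀ T) θ := fun θ hθ => by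
    have h1 : HasDerivWithinAt (fun r => fun k : S => w k * ofFun (v r) k)
        (fun k : S => w k * rhsDist m μ ν τ D (v θ) θ k) (Set.Icc s₀ T) θ := by
      rw [hasDerivWithinAt_pi]
      intro k
      exact ((H.hasDerivWithinAt_coeff k ⟨hs₀.trans_le hθ.1, hθ.2⟩).mono fun x hx =>
        ⟨hs₀.trans_le hx.1, hx.2⟩).const_mul (w k)
    exact L.toContinuousLinearMap.hasFDerivAt.comp_hasDerivWithinAt θ h1
  have hb : ∀ θ ∈ Set.Icc s₀ T, ‖L fun k : S => w k * rhsDist m μ ν τ D (v θ) θ k‖ ≤ √M :=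
    fun θ hθ => by
    refine Real.le_sqrt_of_sq_le ?_
    rw [hn]
    exact hM θ hθ S
  have h2 := (convex_Icc s₀ T).norm_image_sub_le_of_norm_hasDerivWithin_le hd hb ht hr
  rw [← map_sub] at h2
  have e : ((fun k : S => w k * ofFun (v r) k) - fun k : S => w k * ofFun (v t) k)
      = fun k : S => w k * (ofFun (v r) - ofFun (v t)) k := by
    ext k; simp [mul_sub]
  rw [e] at h2
  have h3 := pow_le_pow_left₀ (norm_nonneg _) h2 2
  rw [hn, mul_pow, Real.sq_sqrt hM0, Real.norm_eq_abs, sq_abs] at h3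
  have hpos : 0 < (r - t) ^ 2 := by have := sub_ne_zero.2 hne; positivity
  calc _ = ((r - t) ^ 2)⁻¹ * ∑ k ∈ S, wt k ^ (2 * (-(7 / 8) : ℝ)) *
        ‖(ofFun (v r) - ofFun (v t)) k‖ ^ 2 := by
        rw [Finset.mul_sum]
        refine Finset.sum_congr rfl fun k _ => ?_
        rw [norm_mul, norm_inv, Complex.norm_real, Real.norm_eq_abs, mul_pow, inv_pow, sq_abs,
          Pi.sub_apply]
        ring
    _ ≤ ((r - t) ^ 2)⁻¹ * (M * (r - t) ^ 2) := by gcongr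
    _ = M := by field_simp

end Reg

end

section

variable {χ : DyadicPartition}

/-- The pairing `⟨|f|^{2p-2} f̄, u⟩`. -/
def testPairing (p : ℝ) (f : Torus → ℂ) (u : Dist) : ℂ :=
  ∑' k, ofFun (fun x => powConj p (f x)) (-k) * u k

section Deriv
variable {m : ℕ} {μ : ℝ} {ν τ : ℂ} {D : DrivingData} {β γ T : ℝ} {u₀ : Dist}
  {v : ℝ → Torus → ℂ}

/-! ### The time derivative of the `L^{2p}` norm -/

lemma eventually_mem_Icc {t : ℝ} (ht : 0 < t) :
    ∀ᶠ s in 𝓝[Set.Ioc 0 T] t, s ∈ Set.Icc (t / 2) T :=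
  (eventually_half_le ht).mono fun _ h => ⟨h.2, h.1.2⟩

lemma exists_bound_on_ball {E : Type*} [NormedAddCommGroup E] {φ : ℂ → E} (hφ : Continuous φ)
    (B : ℝ) : ∃ C, ∀ z, ‖z‖ ≤ B → ‖φ z‖ ≤ C := by
  obtain ⟨C, hC⟩ := ((isCompact_closedBall (0 : ℂ) B).image hφ).isBounded.exists_norm_le
  exact ⟨C, fun z hz => hC _ ⟨z, by simpa using hz, rfl⟩⟩

lemma Setting.continuousOn_coeff_comp (H : Setting χ m μ ν τ D β γ T u₀ v)
    {φ : ℂ → ℂ} (hφ : Continuous φ) (k : Freq) :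
    ContinuousOn (fun t => ofFun (fun x => φ (v t x)) k) (Set.Ioc 0 T) := fun t ht => by
  obtain ⟨B, -, hB⟩ := H.exists_bound_sol_unif (half_pos ht.1)
  obtain ⟨C, hC⟩ := exists_bound_on_ball hφ B
  refine tendsto_ofFun (M := C) ?_ ?_ (fun x => ?_) k
  · exact eventually_mem_nhdsWithin.mono fun s hs => hφ.comp (H.hv.continuous s hs)
  · exact (eventually_mem_Icc ht.1).mono fun s hs x => hC _ (hB s hs x)
  · exact (hφ.tendsto _).comp (H.continuousOn_sol x t ht)

lemma Setting.continuousOn_lpPow (H : Setting χ m μ ν τ D β γ T u₀ v) {q : ℝ} (hq : 0 ≤ q) :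
    ContinuousOn (fun t => lpPow q (v t)) (Set.Ioc 0 T) := fun t ht => by
  obtain ⟨B, -, hB⟩ := H.exists_bound_sol_unif (half_pos ht.1)
  have hφ : Continuous fun z : ℂ => ‖z‖ ^ q := continuous_norm.rpow_const fun _ => Or.inr hq
  obtain ⟨C, hC⟩ := exists_bound_on_ball hφ B
  refine tendsto_integral_filter_of_dominated_convergence (fun _ => C) ?_ ?_ (integrable_const _) ?_
  · exact eventually_mem_nhdsWithin.mono fun s hs =>
      (integrable_of_continuous (hφ.comp (H.hv.continuous s hs))).1
  · exact (eventually_mem_Icc ht.1).mono fun s hs => Eventually.of_forall fun x => hC _ (hB s hs x)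
  · exact Eventually.of_forall fun x => (hφ.tendsto _).comp (H.continuousOn_sol x t ht)

lemma Setting.lpPow_sub_ge (H : Setting χ m μ ν τ D β γ T u₀ v)
    {p : ℝ} (hp : 1 ≤ p) {r t : ℝ} (hr : r ∈ Set.Ioc 0 T)
    (ht : t ∈ Set.Ioc 0 T) :
    2 * p * (∑' k, ofFun (fun x => powConj p (v t x)) (-k) * (ofFun (v r) k - ofFun (v t) k)).re
      ≤ lpPow (2 * p) (v r) - lpPow (2 * p) (v t) := by
  have cr := H.hv.continuous r hr
  have ct := H.hv.continuous t ht
  have cF := H.continuous_test hp ht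
  have e := (parseval cF (cr.sub ct)).tsum_eq
  have e2 : ofFun (v r - v t) = ofFun (v r) - ofFun (v t) := ofFun_sub cr ct
  rw [e2] at e
  simp only [Pi.sub_apply] at e
  have hφ : Continuous fun z : ℂ => ‖z‖ ^ (2 * p) :=
    continuous_norm.rpow_const fun _ => Or.inr (by linarith)
  have cG : Continuous fun x => powConj p (v t x) * (v r x - v t x) := by fun_prop
  have i1 : Integrable (fun x => ‖v r x‖ ^ (2 * p)) torusMeasure :=
    integrable_of_continuous (hφ.comp cr)
  have i2 : Integrable (fun x => ‖v t x‖ ^ (2 * p)) torusMeasure :=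
    integrable_of_continuous (hφ.comp ct)
  have i3 := integrable_of_continuous cG
  have e4 : (∫ x, powConj p (v t x) * (v r x - v t x) ∂torusMeasure).re
      = ∫ x, (powConj p (v t x) * (v r x - v t x)).re ∂torusMeasure :=
    (Complex.reCLM.integral_comp_comm i3).symm
  have i5 : Integrable (fun x => (powConj p (v t x) * (v r x - v t x)).re) torusMeasure :=
    integrable_of_continuous (Complex.continuous_re.comp cG)
  rw [e, e4, ← integral_const_mul, lpPow, lpPow, ← integral_sub i1 i2]
  refine integral_mono (i5.const_mul _) (i1.sub i2) fun x => ?_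
  have := convexity hp (v t x) (v r x)
  beta_reduce
  linarith
lemma Setting.hasDerivWithinAt_lpPow (H : Setting χ m μ ν τ D β γ T u₀ v)
    {p : ℝ} (hp : 1 ≤ p) {t : ℝ} (ht : t ∈ Set.Ioc 0 T) :
    HasDerivWithinAt (fun r => lpPow (2 * p) (v r))
      (2 * p * (testPairing p (v t) (rhsDist m μ ν τ D (v t) t)).re) (Set.Ioc 0 T) t := by
  obtain ⟨M, hM⟩ := H.exists_wBound_test hp (half_pos ht.1)
  obtain ⟨M', hM'⟩ := H.exists_wBound_rhs (half_pos ht.1)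
  set q : ℝ → Dist := fun r k => ((r - t : ℝ) : ℂ)⁻¹ * (ofFun (v r) k - ofFun (v t) k) with hq
  have htI : t ∈ Set.Icc (t / 2) T := ⟨by linarith [ht.1], ht.2⟩
  have hle : 𝓝[Set.Ioc 0 T \ {t}] t ≤ 𝓝[Set.Ioc 0 T] t := nhdsWithin_mono _ Set.sdiff_subset
  have hev : ∀ᶠ r in 𝓝[Set.Ioc 0 T \ {t}] t, r ∈ Set.Icc (t / 2) T :=
    (eventually_mem_Icc ht.1).filter_mono hle
  have hqb : ∀ᶠ r in 𝓝[Set.Ioc 0 T \ {t}] t, WBound (-(7 / 8)) M' (q r) :=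
    hev.mono fun r hr => H.wBound_diffQuot (half_pos ht.1) hM' hr htI
  have hqt : ∀ k, Tendsto (fun r => q r k) (𝓝[Set.Ioc 0 T \ {t}] t)
      (𝓝 (rhsDist m μ ν τ D (v t) t k)) := fun k => by
    have := hasDerivWithinAt_iff_tendsto_slope.1 (H.hasDerivWithinAt_coeff k ht)
    refine this.congr fun r => ?_
    rw [slope_def_module, Complex.real_smul, hq, Complex.ofReal_inv]
  have hA : Tendsto (fun r => testPairing p (v t) (q r)) (𝓝[Set.Ioc 0 T \ {t}] t)
      (𝓝 (testPairing p (v t) (rhsDist m μ ν τ D (v t) t))) :=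
    tendsto_tsum_mul (by norm_num : (7 / 8 : ℝ) < 1) (Eventually.of_forall fun _ => (hM t htI).neg)
      hqb (fun k => tendsto_const_nhds) hqt
  have hB : Tendsto (fun r => testPairing p (v r) (q r)) (𝓝[Set.Ioc 0 T \ {t}] t)
      (𝓝 (testPairing p (v t) (rhsDist m μ ν τ D (v t) t))) :=
    tendsto_tsum_mul (by norm_num : (7 / 8 : ℝ) < 1) (hev.mono fun r hr => (hM r hr).neg)
      hqb (fun k => (H.continuousOn_coeff_comp (continuous_powConj hp) (-k) t ht).mono_left hle) hqt
  have hA' := ((Complex.continuous_re.tendsto _).comp hA).const_mul (2 * p)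
  have hB' := ((Complex.continuous_re.tendsto _).comp hB).const_mul (2 * p)
  rw [hasDerivWithinAt_iff_tendsto_slope]
  have hmin := hA'.min hB'
  have hmax := hA'.max hB'
  rw [min_self] at hmin
  rw [max_self] at hmax
  have hpull : ∀ (s r : ℝ), ((r - t) * (testPairing p (v s) (q r)).re) =
      if r = t then 0 else
      (∑' k, ofFun (fun x => powConj p (v s x)) (-k) * (ofFun (v r) k - ofFun (v t) k)).re :=
    fun s r => by
    split_ifs with h
    · rw [h, sub_self, zero_mul]
    have h0 : ((r - t : ℝ) : ℂ) ≠ 0 := by exact_mod_cast sub_ne_zero.2 h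
    rw [← Complex.re_ofReal_mul, testPairing, ← tsum_mul_left]
    congr 1
    refine tsum_congr fun k => ?_
    rw [hq]
    field_simp
  refine tendsto_of_tendsto_of_tendsto_of_le_of_le' hmin hmax ?_ ?_
  all_goals
    filter_upwards [eventually_mem_nhdsWithin] with r hr
    have hrt : r ≠ t := hr.2
    have h1 := H.lpPow_sub_ge hp hr.1 ht
    have h2 := H.lpPow_sub_ge hp ht hr.1
    have h3 := hpull t r
    have h4 := hpull r r
    rw [if_neg hrt] at h3 h4
    have h5 : (∑' k, ofFun (fun x => powConj p (v r x)) (-k) * (ofFun (v t) k - ofFun (v r) k)).re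
        = -(∑' k, ofFun (fun x => powConj p (v r x)) (-k) * (ofFun (v r) k - ofFun (v t) k)).re := by
      rw [← Complex.neg_re, ← tsum_neg]
      congr 1
      exact tsum_congr fun k => by ring
    rw [h5, ← h4] at h2
    rw [← h3] at h1
    simp only [Function.comp_apply, slope_def_field]
  · rcases lt_or_gt_of_ne hrt with h | h
    · refine (min_le_right _ _).trans ?_
      rw [le_div_iff_of_neg (by linarith)]; linarith
    · refine (min_le_left _ _).trans ?_
      rw [le_div_iff₀ (by linarith)]; linarith
  · rcases lt_or_gt_of_ne hrt with h | h
    · refine le_trans ?_ (le_max_left _ _)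
      rw [div_le_iff_of_neg (by linarith)]; linarith
    · refine le_trans ?_ (le_max_right _ _)
      rw [div_le_iff₀ (by linarith)]; linarith

/-! ### Integration by parts -/

lemma parseval_dDist {j : Fin 2} {f g f' g' : Torus → ℂ} (hf : Continuous f) (hg : Continuous g)
    (hf' : Continuous f') (hg' : Continuous g') (h : HasPartial j f f') (h' : HasPartial j g g') :
    HasSum (fun k => ofFun f (-k) * (4 * (Real.pi : ℂ) ^ 2 * (k j : ℂ) ^ 2 * ofFun g k))
      (∫ x, f' x * g' x ∂torusMeasure) := by
  have := parseval hf' hg'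
  rw [h.ofFun_eq hf hf', h'.ofFun_eq hg hg'] at this
  refine this.congr_fun fun k => ?_
  simp only [dDist, Pi.neg_apply]
  push_cast
  linear_combination (4 * (Real.pi : ℂ) ^ 2 * (k j : ℂ) ^ 2 * ofFun f (-k) * ofFun g k) *
    Complex.I_sq

lemma powConj_mul_pow {p : ℝ} (hp : 1 ≤ p) (m : ℕ) (z : ℂ) :
    powConj p z * (z ^ (m + 1) * (starRingEnd ℂ) z ^ m) = ((‖z‖ ^ (2 * p + 2 * m) : ℝ) : ℂ) := by
  have h1 : z ^ m * (starRingEnd ℂ) z ^ m = ((‖z‖ ^ (2 * (m : ℝ)) : ℝ) : ℂ) := by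
    rw [← mul_pow, Complex.mul_conj', ← Complex.ofReal_pow, ← Complex.ofReal_pow, ← pow_mul]
    congr 1
    rw [← Real.rpow_natCast]; push_cast; rfl
  calc _ = powConj p z * z * (z ^ m * (starRingEnd ℂ) z ^ m) := by ring
    _ = _ := by
      rw [powConj_mul_self hp, h1, ← Complex.ofReal_mul, ← Real.rpow_add_of_nonneg (norm_nonneg _)]
      · linarith
      · positivity

lemma Setting.testPairing_rhs (H : Setting χ m μ ν τ D β γ T u₀ v)
    {p : ℝ} (hp : 1 ≤ p) {t : ℝ} (ht : t ∈ Set.Ioc 0 T) :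
    testPairing p (v t) (rhsDist m μ ν τ D (v t) t) =
      testPairing p (v t) (Psi' m ν τ D (v t) t) - ν * (lpPow (2 * p + 2 * m) (v t) : ℂ)
      - (lpPow (2 * p) (v t) : ℂ)
      - ∑ j, (Complex.I + (μ : ℂ)) * ∫ x, dPowConj p (v t x) (dfun χ j (ofFun (v t)) x) *
        dfun χ j (ofFun (v t)) x ∂torusMeasure := by
  have cv := H.hv.continuous t ht
  have cF := H.continuous_test hp ht
  obtain ⟨M, hM⟩ := H.exists_wBound_test hp ht.1
  obtain ⟨M', hM'⟩ := H.exists_wBound_Psi ht.1 (by norm_num : (0 : ℝ) < 1)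
  have htI : t ∈ Set.Icc t T := ⟨le_rfl, ht.2⟩
  have s1 := ((hM t htI).neg.summable_mul (hM' t htI) le_rfl).hasSum
  have cm : Continuous (monomial (m + 1) m (v t)) := by unfold monomial; fun_prop
  have s2 := parseval cF cm
  have e2 : ∫ x, powConj p (v t x) * monomial (m + 1) m (v t) x ∂torusMeasure
      = (lpPow (2 * p + 2 * m) (v t) : ℂ) := by
    rw [lpPow, ← integral_complex_ofReal]
    exact integral_congr_ae (Eventually.of_forall fun x => powConj_mul_pow hp m (v t x))
  rw [e2] at s2
  have s3 := parseval cF cv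
  have e3 : ∫ x, powConj p (v t x) * v t x ∂torusMeasure = (lpPow (2 * p) (v t) : ℂ) := by
    rw [lpPow, ← integral_complex_ofReal]
    exact integral_congr_ae (Eventually.of_forall fun x => powConj_mul_self hp (v t x))
  rw [e3] at s3
  have s4 := hasSum_sum (s := Finset.univ) fun j _ => (parseval_dDist cF cv
    (H.continuous_dtest hp ht j) (H.continuous_dfun_sol ht j)
    (((H.contDiff_sol ht).2 j).powConj hp) ((H.contDiff_sol ht).2 j)).mul_left (Complex.I + (μ : ℂ))
  have s5 := s1.add (s2.mul_left ν)
  have e5 : testPairing p (v t) (Psi' m ν τ D (v t) t) = (∑' k, ofFun (fun x => powConj p (v t x)) (-k) *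
      Psi m ν τ D (v t) t k) + ν * (lpPow (2 * p + 2 * m) (v t) : ℂ) := by
    rw [← s5.tsum_eq, testPairing]
    refine tsum_congr fun k => ?_
    simp only [Psi', Pi.add_apply, Pi.smul_apply, smul_eq_mul]
    ring
  have s6 := (s1.sub s3).sub s4
  rw [e5, add_sub_cancel_right, ← s6.tsum_eq]
  refine tsum_congr fun k => ?_
  rw [rhsDist, symb, norm_freqVec_sq, Fin.sum_univ_two]
  push_cast
  ring

lemma Setting.gradTerm_eq (H : Setting χ m μ ν τ D β γ T u₀ v)
    {p : ℝ} {t : ℝ} (ht : t ∈ Set.Ioc 0 T) :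
    gradTerm p (v t) = ∫ x, (∑ j, ‖dfun χ j (ofFun (v t)) x‖ ^ 2) * ‖v t x‖ ^ (2 * p - 2)
      ∂torusMeasure := by
  unfold gradTerm
  simp only [((H.contDiff_sol ht).2 _).partialDeriv_eq]

lemma Setting.gradTerm_le (H : Setting χ m μ ν τ D β γ T u₀ v) {p δ : ℝ} (hp : 1 ≤ p) (hδ₁ : δ < 1)
    (hδ : (p - 1) / (μ * (μ + √(1 + μ ^ 2))) ≤ 1 - δ) {t : ℝ} (ht : t ∈ Set.Ioc 0 T) :
    δ * μ * gradTerm p (v t) ≤ (∑ j, (Complex.I + (μ : ℂ)) *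
      ∫ x, dPowConj p (v t x) (dfun χ j (ofFun (v t)) x) * dfun χ j (ofFun (v t)) x
        ∂torusMeasure).re := by
  have cv := H.hv.continuous t ht
  have cd := H.continuous_dfun_sol ht
  have cD := H.continuous_dtest hp ht
  have cpow : Continuous fun x => ‖v t x‖ ^ (2 * p - 2) :=
    cv.norm.rpow_const fun _ => Or.inr (by linarith)
  have cG : Continuous fun x => ∑ j, (Complex.I + (μ : ℂ)) *
      (dPowConj p (v t x) (dfun χ j (ofFun (v t)) x) * dfun χ j (ofFun (v t)) x) := by
    fun_prop
  have e : ∑ j, (Complex.I + (μ : ℂ)) * ∫ x, dPowConj p (v t x) (dfun χ j (ofFun (v t)) x) *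
      dfun χ j (ofFun (v t)) x ∂torusMeasure = ∫ x, ∑ j, (Complex.I + (μ : ℂ)) *
      (dPowConj p (v t x) (dfun χ j (ofFun (v t)) x) * dfun χ j (ofFun (v t)) x) ∂torusMeasure := by
    rw [integral_finsetSum _ fun j _ => integrable_of_continuous (by fun_prop)]
    exact Finset.sum_congr rfl fun j _ => (integral_const_mul _ _).symm
  have e2 := Complex.reCLM.integral_comp_comm (integrable_of_continuous cG)
  rw [e, H.gradTerm_eq ht, ← integral_const_mul]
  refine le_trans ?_ e2.le
  refine integral_mono (integrable_of_continuous (by fun_prop))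
    (integrable_of_continuous (Complex.continuous_re.comp cG)) fun x => ?_
  simp only [Complex.reCLM_apply, Complex.re_sum]
  rw [Finset.sum_mul, Finset.mul_sum]
  exact Finset.sum_le_sum fun j _ => coercivity H.hμ hp hδ₁ hδ _ _

end Deriv

end

section

variable {χ : DyadicPartition}

/-! ### Fractional regularity of Hölder functions -/

lemma exists_holder_rpow {q : ℝ} (hq : 0 ≤ q) : ∃ η : ℝ, 0 < η ∧ ∀ B : ℝ, ∃ K : ℝ, 0 ≤ K ∧
    ∀ a b : ℝ, 0 ≤ a → 0 ≤ b → a ≤ B → b ≤ B → |a ^ q - b ^ q| ≤ K * |a - b| ^ η := by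
  rcases hq.eq_or_lt with rfl | hq0
  · exact ⟨1, one_pos, fun B => ⟨0, le_rfl, fun a b _ _ _ _ => by simp⟩⟩
  rcases le_total q 1 with h1 | h1
  · refine ⟨q, hq0, fun B => ⟨1, zero_le_one, fun a b ha hb _ _ => ?_⟩⟩
    have key : ∀ a b : ℝ, 0 ≤ a → 0 ≤ b → a ^ q - b ^ q ≤ |a - b| ^ q := fun a b ha hb => by
      have h2 : a ^ q ≤ (b + |a - b|) ^ q :=
        Real.rpow_le_rpow ha (by linarith [le_abs_self (a - b)]) hq
      have h3 := Real.rpow_add_le_add_rpow hb (abs_nonneg (a - b)) hq h1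
      linarith
    rw [one_mul, abs_le]
    have := key b a hb ha
    rw [abs_sub_comm] at this
    exact ⟨by linarith, key a b ha hb⟩
  · refine ⟨1, one_pos, fun B => ⟨q * |B| ^ (q - 1), by positivity, fun a b ha hb haB hbB => ?_⟩⟩
    rw [Real.rpow_one]
    refine (convex_Icc (0 : ℝ) B).norm_image_sub_le_of_norm_hasDerivWithin_le
      (f := fun x : ℝ => x ^ q) (f' := fun x => q * x ^ (q - 1))
      (fun x _ => (Real.hasDerivAt_rpow_const (Or.inr h1)).hasDerivWithinAt) (fun x hx => ?_)
      ⟨hb, hbB⟩ ⟨ha, haB⟩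
    rw [Real.norm_eq_abs, abs_of_nonneg (mul_nonneg hq (Real.rpow_nonneg hx.1 _))]
    have : x ^ (q - 1) ≤ |B| ^ (q - 1) :=
      Real.rpow_le_rpow hx.1 (hx.2.trans (le_abs_self B)) (by linarith)
    gcongr

lemma HasPartial.norm_sub_le {j : Fin 2} {f g : Torus → ℂ} (h : HasPartial j f g) {C : ℝ}
    (hC : ∀ x, ‖g x‖ ≤ C) (x : Torus) (s : ℝ) :
    ‖f (x + Pi.single j (s : UnitAddCircle)) - f x‖ ≤ C * |s| := by
  have := convex_univ.norm_image_sub_le_of_norm_hasDerivWithin_le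
    (f := fun h : ℝ => f (x + Pi.single j (h : UnitAddCircle)))
    (fun r _ => (h.at_shift x r).hasDerivWithinAt) (fun r _ => hC _) (Set.mem_univ 0)
    (Set.mem_univ s)
  simpa using this

lemma ofFun_translate (g : Torus → ℂ) (y : Torus) (k : Freq) :
    ofFun (fun x => g (x + y)) k = ek k y * ofFun g k := by
  rw [ofFun_apply, ofFun_apply, ← integral_const_mul,
    ← integral_add_right_eq_self (fun x => ek k y * (ek (-k) x * g x)) y]
  refine integral_congr_ae (Eventually.of_forall fun x => ?_)
  have : ek k y * ek (-k) y = 1 := by rw [← ek_add, add_neg_cancel, ek_zero]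
  beta_reduce
  rw [ek_add_apply]
  linear_combination (-(ek (-k) x * g (x + y))) * this

lemma ek_single (k : Freq) (j : Fin 2) (h : ℝ) :
    ek k (Pi.single j (h : UnitAddCircle)) =
      Complex.exp (((2 * Real.pi * (k j * h) : ℝ) : ℂ) * Complex.I) := by
  have e : (Pi.single j (h : UnitAddCircle) : Torus) = mk (Pi.single j h) := by
    ext i
    by_cases hi : i = j
    · subst hi; simp [mk]
    · simp [mk, hi]
  rw [e, ek_mk, Fintype.sum_eq_single j]
  · simp only [Pi.single_eq_same]; congr 1; push_cast; ring
  · intro i hi; simp [hi]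

lemma one_le_norm_ek_sub_one {k : Freq} {j : Fin 2} {h : ℝ} (h1 : 1 / 4 ≤ |k j * h|)
    (h2 : |k j * h| ≤ 1 / 2) : 1 ≤ ‖ek k (Pi.single j (h : UnitAddCircle)) - 1‖ := by
  have hpi := Real.pi_pos
  have h3 : Real.cos (2 * Real.pi * (k j * h)) ≤ 0 := by
    rw [← Real.cos_abs, abs_mul, abs_of_pos (by positivity)]
    exact Real.cos_nonpos_of_pi_div_two_le_of_le (by nlinarith) (by nlinarith)
  have h4 := Complex.abs_re_le_norm (ek k (Pi.single j (h : UnitAddCircle)) - 1)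
  rw [ek_single, Complex.sub_re, Complex.exp_ofReal_mul_I_re, Complex.one_re,
    abs_of_nonpos (by linarith)] at h4
  rw [ek_single]
  linarith

lemma sum_translate_le {g : Torus → ℂ} (hg : Continuous g) {y : Torus} {C : ℝ}
    (h : ∀ x, ‖g (x + y) - g x‖ ≤ C) (S : Finset Freq) :
    ∑ k ∈ S, ‖ek k y - 1‖ ^ 2 * ‖ofFun g k‖ ^ 2 ≤ C ^ 2 := by
  have c1 : Continuous fun x => g (x + y) := by fun_prop
  refine le_trans (le_of_eq ?_) (bessel (c1.sub hg) h S)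
  refine Finset.sum_congr rfl fun k _ => ?_
  have e : ofFun ((fun x => g (x + y)) - g) = ofFun (fun x => g (x + y)) - ofFun g := ofFun_sub c1 hg
  change _ = ‖ofFun ((fun x => g (x + y)) - g) k‖ ^ 2
  rw [e, Pi.sub_apply, ofFun_translate, ← mul_pow, ← norm_mul]
  congr 2; ring

lemma sum_coord_le {g : Torus → ℂ} (hg : Continuous g) {η s K : ℝ} (hs : 0 < s) (hs2 : 2 * s ≤ 1)
    (hsη : s < η) {j : Fin 2}
    (h : ∀ x (r : ℝ), ‖g (x + Pi.single j (r : UnitAddCircle)) - g x‖ ≤ K * |r| ^ η)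
    (S : Finset Freq) :
    ∑ k ∈ S, |(k j : ℝ)| ^ (2 * s) * ‖ofFun g k‖ ^ 2 ≤ 2 * K ^ 2 * geo (2 * (η - s)) := by
  set N := ∑ k ∈ S, (k j).natAbs + 1 with hN
  set r : ℕ → ℝ := fun n => (1 / 4) * (2 ^ n)⁻¹ with hr
  have hterm : ∀ k ∈ S, |(k j : ℝ)| ^ (2 * s) * ‖ofFun g k‖ ^ 2 ≤ ∑ n ∈ Finset.range N,
      2 * dy (2 * s) n * (‖ek k (Pi.single j ((r n : ℝ) : UnitAddCircle)) - 1‖ ^ 2 *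
        ‖ofFun g k‖ ^ 2) := fun k hk => by
    have hnn : ∀ n ∈ Finset.range N, 0 ≤ 2 * dy (2 * s) n *
        (‖ek k (Pi.single j ((r n : ℝ) : UnitAddCircle)) - 1‖ ^ 2 * ‖ofFun g k‖ ^ 2) :=
      fun n _ => by have := dy_nonneg (2 * s) n; positivity
    rcases eq_or_ne (k j) 0 with h0 | h0
    · rw [h0, Int.cast_zero, abs_zero, Real.zero_rpow (by linarith), zero_mul]
      exact Finset.sum_nonneg hnn
    set n := Nat.log 2 (k j).natAbs with hn
    have hnN : n ∈ Finset.range N := by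
      rw [Finset.mem_range, hN, Nat.lt_succ_iff]
      refine (Nat.log_le_self _ _).trans ?_
      exact Finset.single_le_sum (f := fun k : Freq => (k j).natAbs) (fun _ _ => Nat.zero_le _) hk
    have eabs : (((k j).natAbs : ℕ) : ℝ) = |(k j : ℝ)| := by
      rw [Nat.cast_natAbs, Int.cast_abs]
    have hlo : (2 : ℝ) ^ n ≤ |(k j : ℝ)| := by
      rw [← eabs]; exact_mod_cast Nat.pow_log_le_self 2 (Int.natAbs_ne_zero.2 h0)
    have hhi : |(k j : ℝ)| ≤ 2 ^ (n + 1) := by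
      rw [← eabs]; exact_mod_cast (Nat.lt_pow_succ_log_self one_lt_two _).le
    have h2n : (0 : ℝ) < 2 ^ n := by positivity
    have habs : |(k j : ℝ) * r n| = |(k j : ℝ)| / 2 ^ n / 4 := by
      rw [abs_mul, hr, abs_of_pos (by positivity : (0 : ℝ) < 1 / 4 * (2 ^ n)⁻¹)]; field_simp
    have hone : 1 ≤ ‖ek k (Pi.single j ((r n : ℝ) : UnitAddCircle)) - 1‖ := by
      apply one_le_norm_ek_sub_one
      · rw [habs]
        have : 1 ≤ |(k j : ℝ)| / 2 ^ n := (one_le_div h2n).2 hlo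
        linarith
      · rw [habs]
        have : |(k j : ℝ)| / 2 ^ n ≤ 2 := by
          rw [div_le_iff₀ h2n]; rw [pow_succ] at hhi; linarith
        linarith
    refine le_trans ?_ (Finset.single_le_sum hnn hnN)
    have h5 : |(k j : ℝ)| ^ (2 * s) ≤ 2 * dy (2 * s) n := by
      calc |(k j : ℝ)| ^ (2 * s) ≤ ((2 : ℝ) ^ (n + 1)) ^ (2 * s) :=
            Real.rpow_le_rpow (abs_nonneg _) hhi (by linarith)
        _ = dy (2 * s) 1 * dy (2 * s) n := by rw [pow_rpow_eq_dy, dy_add_right, mul_comm]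
        _ ≤ 2 * dy (2 * s) n := by
            have : dy (2 * s) 1 ≤ dy 1 1 := dy_mono hs2 1
            rw [dy_one, pow_one] at this
            have h0 := dy_nonneg (2 * s) n
            gcongr
    have h6 : 1 ≤ ‖ek k (Pi.single j ((r n : ℝ) : UnitAddCircle)) - 1‖ ^ 2 := one_le_pow₀ hone
    have h0 := dy_nonneg (2 * s) n
    calc _ ≤ 2 * dy (2 * s) n * (1 * ‖ofFun g k‖ ^ 2) := by rw [one_mul]; gcongr
      _ ≤ _ := by gcongr
  refine (Finset.sum_le_sum hterm).trans ?_
  rw [Finset.sum_comm]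
  have hn : ∀ n ∈ Finset.range N, ∑ k ∈ S, 2 * dy (2 * s) n *
      (‖ek k (Pi.single j ((r n : ℝ) : UnitAddCircle)) - 1‖ ^ 2 * ‖ofFun g k‖ ^ 2)
      ≤ 2 * K ^ 2 * dy (-(2 * (η - s))) n := fun n _ => by
    have h1 := sum_translate_le hg (fun x => h x (r n)) S
    have h0 := dy_nonneg (2 * s) n
    have h2 : |r n| ^ η ≤ dy (-η) n := by
      have hr0 : 0 < r n := by rw [hr]; positivity
      rw [abs_of_pos hr0, ← pow_rpow_eq_dy, Real.rpow_neg (by positivity),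
        ← Real.inv_rpow (by positivity)]
      refine Real.rpow_le_rpow hr0.le ?_ (by linarith)
      rw [hr]
      have : (0 : ℝ) < (2 ^ n)⁻¹ := by positivity
      linarith
    have h3 : (|r n| ^ η) ^ 2 ≤ dy (-η) n ^ 2 := by
      have : 0 ≤ |r n| ^ η := by positivity
      gcongr
    rw [← Finset.mul_sum]
    calc _ ≤ 2 * dy (2 * s) n * (K * |r n| ^ η) ^ 2 := by gcongr
      _ = 2 * K ^ 2 * (dy (2 * s) n * (|r n| ^ η) ^ 2) := by ring
      _ ≤ 2 * K ^ 2 * (dy (2 * s) n * dy (-η) n ^ 2) := by gcongr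
      _ = _ := by rw [dy_sq, dy_mul]; congr 2; ring
  refine (Finset.sum_le_sum hn).trans ?_
  rw [← Finset.mul_sum]
  gcongr
  exact sum_dy_le (by linarith) _

lemma wBound_of_holder {g : Torus → ℂ} (hg : Continuous g) {η s K B : ℝ} (hs : 0 < s)
    (hs2 : 2 * s ≤ 1) (hsη : s < η) (hB : ∀ x, ‖g x‖ ≤ B)
    (h : ∀ j x (r : ℝ), ‖g (x + Pi.single j (r : UnitAddCircle)) - g x‖ ≤ K * |r| ^ η) :
    WBound s (B ^ 2 + 2 * K ^ 2 * geo (2 * (η - s)) + 2 * K ^ 2 * geo (2 * (η - s))) (ofFun g) :=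
  fun S => by
  refine le_trans ?_ (add_le_add (add_le_add (bessel hg hB S) (sum_coord_le hg hs hs2 hsη (h 0) S))
    (sum_coord_le hg hs hs2 hsη (h 1) S))
  rw [← Finset.sum_add_distrib, ← Finset.sum_add_distrib]
  refine Finset.sum_le_sum fun k _ => ?_
  have h1 : wt k ≤ 1 + |(k 0 : ℝ)| + |(k 1 : ℝ)| := by
    unfold wt
    have h2 := norm_freqVec_sq k
    have p0 := abs_nonneg (k 0 : ℝ)
    have p1 := abs_nonneg (k 1 : ℝ)
    have : ‖freqVec k‖ ≤ |(k 0 : ℝ)| + |(k 1 : ℝ)| := by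
      refine le_of_sq_le_sq ?_ (by positivity)
      rw [h2, ← sq_abs (k 0 : ℝ), ← sq_abs (k 1 : ℝ)]
      nlinarith
    linarith
  have h2 : wt k ^ (2 * s) ≤ 1 + |(k 0 : ℝ)| ^ (2 * s) + |(k 1 : ℝ)| ^ (2 * s) := by
    refine (Real.rpow_le_rpow (wt_pos k).le h1 (by linarith)).trans ?_
    refine (Real.rpow_add_le_add_rpow (by positivity) (abs_nonneg _) (by linarith) hs2).trans ?_
    have := Real.rpow_add_le_add_rpow zero_le_one (abs_nonneg (k 0 : ℝ)) (by linarith) hs2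
    rw [Real.one_rpow] at this
    linarith
  calc _ ≤ (1 + |(k 0 : ℝ)| ^ (2 * s) + |(k 1 : ℝ)| ^ (2 * s)) * ‖ofFun g k‖ ^ 2 := by gcongr
    _ = _ := by ring

/-! ### Associativity of the products -/

lemma summable_wt_rpow {r : ℝ} (hr : 2 < r) : Summable fun k : Freq => wt k ^ (-r) := by
  refine Summable.of_norm_bounded_eventually (EisensteinSeries.summable_one_div_norm_rpow hr) ?_
  filter_upwards [(Set.finite_singleton (0 : Freq)).compl_mem_cofinite] with k hk
  have hk0 : 0 < ‖k‖ := norm_pos_iff.2 hk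
  have hle : ‖k‖ ≤ wt k := by
    refine (pi_norm_le_iff_of_nonneg (wt_pos k).le).2 fun i => ?_
    have := abs_coord_le k i
    rw [Int.norm_eq_abs, wt]
    linarith
  rw [Real.norm_eq_abs, abs_of_pos (Real.rpow_pos_of_pos (wt_pos k) _)]
  exact Real.rpow_le_rpow_of_nonpos hk0 hle (by linarith)

lemma summable_wt_mul {s σ M : ℝ} {u : Dist} (h : WBound s M u) (hs : 2 < 2 * s - 2 * σ) :
    Summable fun k => wt k ^ σ * ‖u k‖ := by
  refine Summable.of_nonneg_of_le (fun k => ?_) (fun k => ?_)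
    (h.summable.add (summable_wt_rpow hs))
  · have := wt_pos k; positivity
  · have hw := wt_pos k
    set a := wt k ^ s * ‖u k‖ with ha
    set b := wt k ^ (-(s - σ)) with hb
    have e1 : wt k ^ σ * ‖u k‖ = a * b := by
      rw [ha, hb, mul_right_comm, ← Real.rpow_add hw]; congr 2; ring
    have e2 : wt k ^ (2 * s) * ‖u k‖ ^ 2 = a ^ 2 := by
      rw [ha, mul_pow, ← Real.rpow_natCast (wt k ^ s), ← Real.rpow_mul hw.le]
      congr 2; push_cast; ring
    have e3 : wt k ^ (-(2 * s - 2 * σ)) = b ^ 2 := by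
      rw [hb, ← Real.rpow_natCast, ← Real.rpow_mul hw.le]; congr 1; push_cast; ring
    rw [e1, e2, e3]
    nlinarith [sq_nonneg (a - b), sq_nonneg a, sq_nonneg b]

lemma WBound.translate {σ M : ℝ} {u : Dist} (h : WBound (-σ) M u) (hσ : 0 ≤ σ) (n : Freq) :
    WBound (-σ) (wt n ^ (2 * σ) * M) fun k => u (k - n) := by
  refine h.reindex (Equiv.subRight n) fun k => ?_
  have h1 : wt (k - n) ≤ wt k * wt n := by
    have := wt_add_le k (-n)
    rwa [wt_neg, ← sub_eq_add_neg] at this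
  have hk := wt_pos k
  have hn := wt_pos n
  have hkn := wt_pos (k - n)
  rw [Equiv.subRight_apply, show 2 * -σ = -(2 * σ) by ring, Real.rpow_neg hk.le,
    Real.rpow_neg hkn.le, ← div_eq_mul_inv, inv_eq_one_div, div_le_div_iff₀ (by positivity)
      (by positivity), one_mul, mul_comm (wt n ^ _), ← Real.mul_rpow hk.le hn.le]
  exact Real.rpow_le_rpow hkn.le h1 (by linarith)

lemma summable_triple {g f u : Dist} {σ M M' : ℝ} (hσ : 0 ≤ σ) (hg : WBound σ M g)
    (hu : WBound (-σ) M' u) (hf : Summable fun n => wt n ^ (2 * σ) * ‖f n‖) :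
    Summable fun q : Freq × Freq => g (-q.1) * (f (q.1 - q.2) * u q.2) := by
  have h1 : Summable fun q : Freq × Freq => f q.1 * (g (-q.2) * u (q.2 - q.1)) := by
    rw [← summable_norm_iff, summable_prod_of_nonneg (fun _ => norm_nonneg _)]
    have hs : ∀ n, Summable fun k => ‖g (-k) * u (k - n)‖ := fun n =>
      (hg.neg.summable_mul (hu.translate hσ n) le_rfl).norm
    have hn : ∀ n, (fun k => ‖f n * (g (-k) * u (k - n))‖)
        = fun k => ‖f n‖ * ‖g (-k) * u (k - n)‖ := fun n => funext fun k => norm_mul _ _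
    refine ⟨fun n => ?_, ?_⟩
    · simp only [hn]; exact (hs n).mul_left _
    · refine Summable.of_nonneg_of_le (fun n => tsum_nonneg fun _ => norm_nonneg _) (fun n => ?_)
        (hf.mul_left ((M + M') / 2))
      simp only [hn]
      rw [tsum_mul_left]
      have h2 : ∑' k, ‖g (-k) * u (k - n)‖ ≤ (M + wt n ^ (2 * σ) * M') / 2 := by
        refine (hs n).tsum_le_of_sum_le fun S => ?_
        have := hg.neg.sum_mul_le (hu.translate hσ n) S
        simpa using this
      have h3 : 1 ≤ wt n ^ (2 * σ) := Real.one_le_rpow (one_le_wt n) (by linarith)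
      have h4 := hg.nonneg
      have h5 : (M + wt n ^ (2 * σ) * M') / 2 ≤ wt n ^ (2 * σ) * ((M + M') / 2) := by nlinarith
      calc _ ≤ ‖f n‖ * (wt n ^ (2 * σ) * ((M + M') / 2)) := by gcongr; exact h2.trans h5
        _ = _ := by ring
  let e : Freq × Freq ≃ Freq × Freq :=
    { toFun := fun q => (q.1 - q.2, q.1)
      invFun := fun q => (q.2, q.2 - q.1)
      left_inv := fun q => by simp
      right_inv := fun q => by simp }
  have h2 := (e.summable_iff (f := fun q : Freq × Freq => f q.1 * (g (-q.2) * u (q.2 - q.1)))).2 h1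
  refine h2.congr fun q => ?_
  simp only [Function.comp_apply, e, Equiv.coe_fn_mk, sub_sub_cancel]
  ring

lemma hasSum_mulDist_assoc {g f : Torus → ℂ} (hg : Continuous g) (hf : Continuous f) {u : Dist}
    {σ M M' : ℝ} (hσ : 0 ≤ σ) (hgb : WBound σ M (ofFun g)) (hu : WBound (-σ) M' u)
    (hfb : Summable fun n => wt n ^ (2 * σ) * ‖ofFun f n‖) :
    HasSum (fun k => ofFun g (-k) * mulDist f u k)
      (∑' l, ofFun (fun x => g x * f x) (-l) * u l) := by
  have hs := summable_triple hσ hgb hu hfb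
  have h1 : ∀ l, ∑' k, ofFun g (-k) * (ofFun f (k - l) * u l)
      = ofFun (fun x => g x * f x) (-l) * u l := fun l => by
    have h2 := (Equiv.subRight l).hasSum_iff.2 (ofFun_mul hg hf (-l))
    rw [← h2.tsum_eq, ← tsum_mul_right]
    refine tsum_congr fun k => ?_
    simp only [Function.comp_apply, Equiv.subRight_apply]
    rw [show -l - (k - l) = -k by abel]
    ring
  have h3 := hs.hasSum.prod_fiberwise fun k => (hs.prod_factor k).hasSum
  have h4 : ∑' q : Freq × Freq, ofFun g (-q.1) * (ofFun f (q.1 - q.2) * u q.2)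
      = ∑' l, ofFun (fun x => g x * f x) (-l) * u l := by
    rw [hs.tsum_prod]
    exact (Summable.tsum_comm
      (f := fun k l => ofFun g (-k) * (ofFun f (k - l) * u l)) hs).symm.trans (tsum_congr h1)
  rw [h4] at h3
  refine h3.congr_fun fun k => ?_
  exact tsum_mul_left.symm

lemma pairing_reDist {g : Torus → ℂ} {w : Dist} {a : ℂ} (hg : ∀ x, (starRingEnd ℂ) (g x) = g x)
    (h : HasSum (fun k => ofFun g (-k) * w k) a) :
    HasSum (pairingTerm g (reDist w)) (a.re : ℂ) := by
  have hc : ∀ k, (starRingEnd ℂ) (ofFun g k) = ofFun g (-k) := fun k => by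
    have := ofFun_conj g (-k)
    rw [neg_neg] at this
    rw [← this, funext hg]
  have h1 := (Equiv.neg Freq).hasSum_iff.2 ((Complex.hasSum_conj').2 h)
  have h2 := (h.add h1).div_const 2
  have e : (a + (starRingEnd ℂ) a) / 2 = (a.re : ℂ) := by rw [Complex.add_conj]; push_cast; ring
  rw [e] at h2
  refine h2.congr_fun fun k => ?_
  simp only [pairingTerm, reDist, conjDist, Function.comp_apply, Equiv.neg_apply, map_mul, neg_neg,
    hc]
  ring

end

section

variable {χ : DyadicPartition}

section Energy

variable {m : ℕ} {μ : ℝ} {ν τ : ℂ} {D : DrivingData} {β γ T : ℝ} {u₀ : Dist}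
  {v : ℝ → Torus → ℂ}

/-! ### The pairing on the right-hand side -/

lemma Setting.continuous_absPow (H : Setting χ m μ ν τ D β γ T u₀ v)
    {p : ℝ} (hp : 1 ≤ p) {t : ℝ} (ht : t ∈ Set.Ioc 0 T) :
    Continuous (absPow p (v t)) :=
  Complex.continuous_ofReal.comp
    ((H.hv.continuous t ht).norm.rpow_const fun _ => Or.inr (by linarith))

lemma Setting.exists_wBound_absPow (H : Setting χ m μ ν τ D β γ T u₀ v)
    {p : ℝ} (hp : 1 ≤ p) : ∃ η : ℝ, 0 < η ∧ ∀ s, 0 < s →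
    2 * s ≤ 1 → s < η → ∀ t ∈ Set.Ioc 0 T, ∃ M, WBound s M (ofFun (absPow p (v t))) := by
  obtain ⟨η, hη, hK⟩ := exists_holder_rpow (q := 2 * p - 2) (by linarith)
  refine ⟨η, hη, fun s hs hs2 hsη t ht => ?_⟩
  have htI : t ∈ Set.Icc t T := ⟨le_rfl, ht.2⟩
  obtain ⟨C, hC0, hC⟩ := H.exists_bound_dfun ht.1
  obtain ⟨B, hB0, hB⟩ := H.exists_bound_sol_unif ht.1
  obtain ⟨K, hK0, hK⟩ := hK B
  refine ⟨_, wBound_of_holder (H.continuous_absPow hp ht) (η := η) (K := K * C ^ η)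
    (B := B ^ (2 * p - 2)) hs hs2 hsη (fun x => ?_) fun j x r => ?_⟩
  · rw [absPow, Complex.norm_real, Real.norm_eq_abs, abs_of_nonneg (by positivity)]
    exact Real.rpow_le_rpow (norm_nonneg _) (hB t htI x) (by linarith)
  · rw [absPow, absPow, ← Complex.ofReal_sub, Complex.norm_real, Real.norm_eq_abs]
    refine (hK _ _ (norm_nonneg _) (norm_nonneg _) (hB t htI _) (hB t htI _)).trans ?_
    rw [mul_assoc, ← Real.mul_rpow hC0 (abs_nonneg _)]
    gcongr
    exact (abs_norm_sub_norm_le _ _).trans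
      (((H.contDiff_sol ht).2 j).norm_sub_le (hC t htI j) x r)

lemma Setting.exists_wBound_Psi' (H : Setting χ m μ ν τ D β γ T u₀ v)
    {s₀ σ : ℝ} (hs₀ : 0 < s₀) (hσ : 0 < σ) : ∃ M : ℝ,
    ∀ t ∈ Set.Icc s₀ T, WBound (-σ) M (Psi' m ν τ D (v t) t) := by
  obtain ⟨M, hM⟩ := H.exists_wBound_Psi hs₀ hσ
  obtain ⟨B, -, hB⟩ := H.exists_bound_sol_unif hs₀
  have hφ : Continuous fun z : ℂ => z ^ (m + 1) * (starRingEnd ℂ) z ^ m := by fun_prop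
  obtain ⟨C, hC⟩ := exists_bound_on_ball hφ B
  refine ⟨_, fun t ht => (hM t ht).add (WBound.smul (M := C ^ 2) ?_ ν)⟩
  exact (wBound_zero_of_bound (hφ.comp (H.hv.continuous t ⟨hs₀.trans_le ht.1, ht.2⟩))
    fun x => hC _ (hB t ht x)).anti (by linarith)

lemma Setting.hasSum_pairingTerm (H : Setting χ m μ ν τ D β γ T u₀ v)
    {p : ℝ} (hp : 1 ≤ p) {t : ℝ} (ht : t ∈ Set.Ioc 0 T) :
    HasSum (pairingTerm (absPow p (v t)) (rePsi' m ν τ D (v t) t))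
      ((testPairing p (v t) (Psi' m ν τ D (v t) t)).re : ℂ) := by
  obtain ⟨η, hη, hη2⟩ := H.exists_wBound_absPow hp
  set σ := min η (1 / 16) / 2 with hσ
  have h1 : min η (1 / 16) ≤ η := min_le_left _ _
  have h2 : min η (1 / 16) ≤ 1 / 16 := min_le_right _ _
  have h0 : 0 < min η (1 / 16) := by positivity
  have hσ0 : 0 < σ := by linarith
  have htI : t ∈ Set.Icc t T := ⟨le_rfl, ht.2⟩
  have cv := H.hv.continuous t ht
  obtain ⟨M, hM⟩ := hη2 σ hσ0 (by linarith) (by linarith) t ht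
  obtain ⟨M', hM'⟩ := H.exists_wBound_Psi' ht.1 hσ0
  obtain ⟨M₂, hM₂⟩ := H.exists_wBound_sol ht.1
  refine pairing_reDist (fun x => Complex.conj_ofReal _) ?_
  refine hasSum_mulDist_assoc (H.continuous_absPow hp ht) (Complex.continuous_conj.comp cv)
    hσ0.le hM (hM' t htI) ?_
  have := summable_wt_mul (σ := 2 * σ) (hM₂ t htI).neg (by linarith)
  refine this.congr fun k => ?_
  change _ = _ * ‖ofFun (fun x => (starRingEnd ℂ) (v t x)) k‖
  rw [ofFun_conj, RCLike.norm_conj]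

lemma Setting.pairTerm_eq (H : Setting χ m μ ν τ D β γ T u₀ v)
    {p : ℝ} (hp : 1 ≤ p) {t : ℝ} (ht : t ∈ Set.Ioc 0 T) :
    pairTerm m ν τ D p (v t) t = (testPairing p (v t) (Psi' m ν τ D (v t) t)).re := by
  rw [pairTerm, pairing, (H.hasSum_pairingTerm hp ht).tsum_eq, Complex.ofReal_re]

/-- The energy inequality in differential form. -/
lemma Setting.energy_ineq (H : Setting χ m μ ν τ D β γ T u₀ v) {p δ : ℝ} (hp : 1 ≤ p) (hδ₁ : δ < 1)
    (hδ : (p - 1) / (μ * (μ + √(1 + μ ^ 2))) ≤ 1 - δ) {t : ℝ} (ht : t ∈ Set.Ioc 0 T) :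
    (testPairing p (v t) (rhsDist m μ ν τ D (v t) t)).re + δ * μ * gradTerm p (v t)
        + ν.re * lpPow (2 * p + 2 * m) (v t) + lpPow (2 * p) (v t)
      ≤ pairTerm m ν τ D p (v t) t := by
  rw [H.pairTerm_eq hp ht, H.testPairing_rhs hp ht]
  have := H.gradTerm_le hp hδ₁ hδ ht
  simp only [Complex.sub_re, Complex.ofReal_re, Complex.re_mul_ofReal]
  linarith

/-! ### Continuity in time -/

lemma Setting.continuousOn_dfun (H : Setting χ m μ ν τ D β γ T u₀ v) (j : Fin 2) (x : Torus) :
    ContinuousOn (fun t => dfun χ j (ofFun (v t)) x) (Set.Ioc 0 T) := fun t ht => by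
  obtain ⟨C, hC0, hC⟩ := H.exists_blockBound_grad (half_pos ht.1)
  refine tendsto_tsum_of_dominated_convergence (bound := fun n => C * dy (-(1 / 4)) n)
    ((hasSum_dy (by norm_num : (0 : ℝ) < 1 / 4)).summable.mul_left C) (fun n => ?_)
    ((eventually_mem_Icc ht.1).mono fun s hs n => hC s hs j n x)
  simp only [block_dDist_eq]
  refine tendsto_finsetSum _ fun k _ => ?_
  exact ((tendsto_coeff H.hv.cont k t ht).const_mul _).mul_const _

lemma Setting.continuousOn_gradTerm (H : Setting χ m μ ν τ D β γ T u₀ v) {p : ℝ} (hp : 1 ≤ p) :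
    ContinuousOn (fun t => gradTerm p (v t)) (Set.Ioc 0 T) := by
  refine ContinuousOn.congr (f := fun t => ∫ x, (∑ j, ‖dfun χ j (ofFun (v t)) x‖ ^ 2) *
    ‖v t x‖ ^ (2 * p - 2) ∂torusMeasure) (fun t ht => ?_) fun t ht => H.gradTerm_eq ht
  obtain ⟨B, -, hB⟩ := H.exists_bound_sol_unif (half_pos ht.1)
  obtain ⟨C, -, hC⟩ := H.exists_bound_dfun (half_pos ht.1)
  refine tendsto_integral_filter_of_dominated_convergence
    (fun _ => (∑ _j : Fin 2, C ^ 2) * B ^ (2 * p - 2)) ?_ ?_ (integrable_const _) ?_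
  · refine eventually_mem_nhdsWithin.mono fun s hs => (integrable_of_continuous ?_).1
    have cd := H.continuous_dfun_sol hs
    have cpow : Continuous fun x => ‖v s x‖ ^ (2 * p - 2) :=
      (H.hv.continuous s hs).norm.rpow_const fun _ => Or.inr (by linarith)
    fun_prop
  · refine (eventually_mem_Icc ht.1).mono fun s hs => Eventually.of_forall fun x => ?_
    rw [Real.norm_eq_abs, abs_of_nonneg (by positivity)]
    have h1 : ‖v s x‖ ^ (2 * p - 2) ≤ B ^ (2 * p - 2) :=
      Real.rpow_le_rpow (norm_nonneg _) (hB s hs x) (by linarith)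
    gcongr
    exact hC s hs _ x
  · refine Eventually.of_forall fun x => ?_
    refine (tendsto_finsetSum _ fun j _ => ((H.continuousOn_dfun j x t ht).norm.pow 2)).mul ?_
    exact (H.continuousOn_sol x t ht).norm.rpow_const (Or.inr (by linarith))

lemma Setting.continuousOn_pairTerm (H : Setting χ m μ ν τ D β γ T u₀ v) {p : ℝ} (hp : 1 ≤ p) :
    ContinuousOn (fun t => pairTerm m ν τ D p (v t) t) (Set.Ioc 0 T) := by
  refine ContinuousOn.congr (f := fun t => (testPairing p (v t) (Psi' m ν τ D (v t) t)).re)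
    (fun t ht => ?_) fun t ht => H.pairTerm_eq hp ht
  obtain ⟨M, hM⟩ := H.exists_wBound_test hp (half_pos ht.1)
  obtain ⟨M', hM'⟩ := H.exists_wBound_Psi' (half_pos ht.1) (by norm_num : (0 : ℝ) < 1 / 2)
  refine (Complex.continuous_re.tendsto _).comp ?_
  refine tendsto_tsum_mul (by norm_num : (1 / 2 : ℝ) < 1)
    ((eventually_mem_Icc ht.1).mono fun s hs => (hM s hs).neg)
    ((eventually_mem_Icc ht.1).mono fun s hs => hM' s hs)
    (fun k => H.continuousOn_coeff_comp (continuous_powConj hp) (-k) t ht) fun k => ?_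
  refine (H.continuousOn_Psi k t ht).add (Tendsto.const_mul ν ?_)
  exact H.continuousOn_coeff_comp (φ := fun z => z ^ (m + 1) * (starRingEnd ℂ) z ^ m)
    (by fun_prop) k t ht

end Energy

end

end SCGL

end

theorem lp_energy_inequality
    (m : ℕ) (hm : 1 ≤ m) (μ : ℝ) (hμ : 0 < μ) (ν τ : ℂ) (hν : 0 < ν.re)
    (χ : SCGL.DyadicPartition) (T : ℝ) (hT : 0 < T)
    (D : SCGL.DrivingData) (hD : D.Admissible χ m T)
    (α₀ β γ : ℝ) (hα₀ : 0 < α₀) (hβ : 0 < β)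
    (hγ₁ : (α₀ + β) / 2 < γ) (hγ₂ : γ < 1 / (2 * (m : ℝ) + 1))
    (u₀ : SCGL.Dist) (hu₀ : SCGL.MemBesov χ (-α₀) u₀)
    (v : ℝ → SCGL.Torus → ℂ) (hv : SCGL.IsMildSolution χ m μ ν τ D β γ T u₀ v)
    (p : ℝ) (hp₁ : 1 ≤ p) (hp₂ : p ≤ 1 + μ * (μ + Real.sqrt (1 + μ ^ 2)))
    (δ : ℝ) (hδ₀ : 0 ≤ δ) (hδ₁ : δ < 1)
    (hδ : (p - 1) / (μ * (μ + Real.sqrt (1 + μ ^ 2))) ≤ 1 - δ) :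
    -- differential form; the gradient, the pairing and the time derivative make sense
    (∀ t ∈ Set.Ioc (0 : ℝ) T,
      ContDiff ℝ 1 (SCGL.lift (v t)) ∧
      Summable (SCGL.pairingTerm (SCGL.absPow p (v t)) (SCGL.rePsi' m ν τ D (v t) t)) ∧
      ∃ d : ℝ, HasDerivWithinAt (fun r => SCGL.lpPow (2 * p) (v r)) d (Set.Ioc 0 T) t ∧
        1 / (2 * p) * d + δ * μ * SCGL.gradTerm p (v t)
            + ν.re * SCGL.lpPow (2 * p + 2 * m) (v t) + SCGL.lpPow (2 * p) (v t)
          ≤ SCGL.pairTerm m ν τ D p (v t) t) ∧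
    -- integrated form; the time integrals make sense
    (∀ s₀ t : ℝ, 0 < s₀ → s₀ ≤ t → t ≤ T →
      IntervalIntegrable (fun s => SCGL.gradTerm p (v s)) volume s₀ t ∧
      IntervalIntegrable (fun s => SCGL.lpPow (2 * p + 2 * m) (v s)) volume s₀ t ∧
      IntervalIntegrable (fun s => SCGL.lpPow (2 * p) (v s)) volume s₀ t ∧
      IntervalIntegrable (fun s => SCGL.pairTerm m ν τ D p (v s) s) volume s₀ t ∧
      1 / (2 * p) * (SCGL.lpPow (2 * p) (v t) - SCGL.lpPow (2 * p) (v s₀))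
          + δ * μ * (∫ s in s₀..t, SCGL.gradTerm p (v s))
          + ν.re * (∫ s in s₀..t, SCGL.lpPow (2 * p + 2 * m) (v s))
          + (∫ s in s₀..t, SCGL.lpPow (2 * p) (v s))
        ≤ ∫ s in s₀..t, SCGL.pairTerm m ν τ D p (v s) s) := by
  have hm0 : (0 : ℝ) < 2 * (m : ℝ) + 1 := by positivity
  have H : SCGL.Setting χ m μ ν τ D β γ T u₀ v :=
    { hμ := hμ, hT := hT, hD := hD, hβ := hβ, hγ := by linarith, hv := hv
      hγ' := by rwa [lt_div_iff₀ hm0] at hγ₂ }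
  have hp0 : (0 : ℝ) < 2 * p := by linarith
  have energy := fun t (ht : t ∈ Set.Ioc (0 : ℝ) T) => H.energy_ineq hp₁ hδ₁ hδ ht
  have hderiv := fun t (ht : t ∈ Set.Ioc (0 : ℝ) T) => H.hasDerivWithinAt_lpPow hp₁ ht
  refine ⟨fun t ht => ⟨(H.contDiff_sol ht).1, (H.hasSum_pairingTerm hp₁ ht).summable, _,
    hderiv t ht, ?_⟩, fun s₀ t hs₀ hst htT => ?_⟩
  · rw [← mul_assoc, one_div_mul_cancel hp0.ne', one_mul]
    exact energy t ht
  have hsub : Set.Icc s₀ t ⊆ Set.Ioc 0 T := fun s hs => ⟨hs₀.trans_le hs.1, hs.2.trans htT⟩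
  have c1 := (H.continuousOn_gradTerm hp₁).mono hsub
  have c2 := (H.continuousOn_lpPow (q := 2 * p + 2 * m) (by positivity)).mono hsub
  have c3 := (H.continuousOn_lpPow (q := 2 * p) hp0.le).mono hsub
  have c4 := (H.continuousOn_pairTerm hp₁).mono hsub
  have i1 := c1.intervalIntegrable_of_Icc (μ := MeasureTheory.volume) hst
  have i2 := c2.intervalIntegrable_of_Icc (μ := MeasureTheory.volume) hst
  have i3 := c3.intervalIntegrable_of_Icc (μ := MeasureTheory.volume) hst
  have i4 := c4.intervalIntegrable_of_Icc (μ := MeasureTheory.volume) hst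
  refine ⟨i1, i2, i3, i4, ?_⟩
  have key := intervalIntegral.sub_le_integral_of_hasDeriv_right_of_le hst
    (g := fun r => 1 / (2 * p) * SCGL.lpPow (2 * p) (v r))
    (φ := fun s => SCGL.pairTerm m ν τ D p (v s) s - δ * μ * SCGL.gradTerm p (v s)
      - ν.re * SCGL.lpPow (2 * p + 2 * m) (v s) - SCGL.lpPow (2 * p) (v s))
    (c3.const_smul (1 / (2 * p)))
    (fun x hx => (((hderiv x (hsub ⟨hx.1.le, hx.2.le⟩)).hasDerivAt
      (Ioc_mem_nhds (hs₀.trans hx.1) (hx.2.trans_le htT))).const_mul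
        (1 / (2 * p))).hasDerivWithinAt)
    ((((c4.sub (c1.const_smul (δ * μ))).sub (c2.const_smul ν.re)).sub
      c3).integrableOn_compact isCompact_Icc)
    (fun x hx => by
      have := energy x (hsub ⟨hx.1.le, hx.2.le⟩)
      rw [← mul_assoc, one_div_mul_cancel hp0.ne', one_mul]
      linarith)
  rw [intervalIntegral.integral_sub ((i4.sub (i1.const_mul _)).sub (i2.const_mul _)) i3,
    intervalIntegral.integral_sub (i4.sub (i1.const_mul _)) (i2.const_mul _),
    intervalIntegral.integral_sub i4 (i1.const_mul _),
    intervalIntegral.integral_const_mul, intervalIntegral.integral_const_mul] at key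
  linarith
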